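/- There exists a function ε : (0,∞) → (0,∞) with the property that for every α ∈ (0, 1/12), ε(δ)/δ^{1/12−α} → 0 as δ → 0⁺, such that the following holds for every n ≥ 1 and every δ ∈ (0, 1/4): if (H₁, H₂, H₃) is a δ-representation of the sphere by n×n complex matrices and bott(H₁, H₂, H₃) = 0, then there exist pairwise commuting Hermitian n×n matrices H₁′, H₂′, H₃′ with (H₁′)² + (H₂′)² + (H₃′)² = I and ‖H_r′ − H_r‖ ≤ ε(δ) for r = 1, 2, 3. -/

import Mathlib

open Matrix

noncomputable section

namespace AC

variable {m : Type*} [Fintype m] [DecidableEq m]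

/-- The ℓ² operator norm of a complex matrix. -/
def opNorm (A : Matrix m m ℂ) : ℝ :=
  ‖Matrix.toEuclideanCLM (𝕜 := ℂ) A‖

/-- `(H₁, H₂, H₃)` is a δ-representation of the sphere: each `Hᵣ` is Hermitian, all
commutators have ℓ²-operator norm at most `δ`, and `‖H₁² + H₂² + H₃² − I‖ ≤ δ`. -/
def IsSphereRep (δ : ℝ) (H₁ H₂ H₃ : Matrix m m ℂ) : Prop :=
  H₁.IsHermitian ∧ H₂.IsHermitian ∧ H₃.IsHermitian ∧
  opNorm (H₁ * H₂ - H₂ * H₁) ≤ δ ∧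
  opNorm (H₁ * H₃ - H₃ * H₁) ≤ δ ∧
  opNorm (H₂ * H₃ - H₃ * H₂) ≤ δ ∧
  opNorm (H₁ ^ 2 + H₂ ^ 2 + H₃ ^ 2 - 1) ≤ δ

/-- The 2n×2n Hermitian block matrix `S(H₁,H₂,H₃) = [[H₃, H₁ − iH₂], [H₁ + iH₂, −H₃]]`. -/
def sphS (H₁ H₂ H₃ : Matrix m m ℂ) : Matrix (m ⊕ m) (m ⊕ m) ℂ :=
  Matrix.fromBlocks H₃ (H₁ - Complex.I • H₂) (H₁ + Complex.I • H₂) (-H₃)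

open Classical in
/-- The Bott index: the number of positive eigenvalues (with multiplicity) of
`S(H₁,H₂,H₃)` minus `n`.  (Junk value `0` if `S(H₁,H₂,H₃)` is not Hermitian.) -/
def bott (H₁ H₂ H₃ : Matrix m m ℂ) : ℤ :=
  if h : (sphS H₁ H₂ H₃).IsHermitian then
    ((Finset.univ.filter fun i => 0 < h.eigenvalues i).card : ℤ) - Fintype.card m
  else 0

end AC

namespace AC

section Exp
open NormedSpace Complex

variable {A : Type*} [CStarAlgebra A]

/-- The one-parameter unitary group `t ↦ exp(itS)`. -/
def expI (S : A) (t : ℝ) : A := NormedSpace.exp (t • (I • S))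

lemma expI_mul_neg (S : A) (t : ℝ) : expI S t * expI S (-t) = 1 := by
  let : NormedAlgebra ℚ A := NormedAlgebra.restrictScalars ℚ ℝ A
  rw [expI, expI, ← NormedSpace.exp_add_of_commute, neg_smul, add_neg_cancel, NormedSpace.exp_zero]
  exact ((Commute.refl _).smul_left _).smul_right _

lemma expI_neg_mul (S : A) (t : ℝ) : expI S (-t) * expI S t = 1 := by
  simpa using expI_mul_neg S (-t)

lemma star_expI {S : A} (hS : IsSelfAdjoint S) (t : ℝ) : star (expI S t) = expI S (-t) := by
  rw [expI, expI, NormedSpace.star_exp, star_smul, star_smul, hS.star_eq]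
  simp

lemma norm_expI_le {S : A} (hS : IsSelfAdjoint S) (t : ℝ) : ‖expI S t‖ ≤ 1 := by
  have : ‖star (expI S t) * expI S t‖ ≤ 1 := by
    rw [star_expI hS, expI_neg_mul]
    rcases subsingleton_or_nontrivial A with h | h
    · rw [Subsingleton.elim (1 : A) 0]; simp
    · simp
  rw [CStarRing.norm_star_mul_self] at this
  nlinarith [norm_nonneg (expI S t)]

lemma hasDerivAt_expI (S : A) (t : ℝ) : HasDerivAt (expI S) (expI S t * (I • S)) t :=
  hasDerivAt_exp_smul_const (I • S) t

lemma hasDerivAt_expI_neg (S : A) (t : ℝ) :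
    HasDerivAt (fun u => expI S (-u)) (-((I • S) * expI S (-t))) t := by
  have h := (hasDerivAt_exp_smul_const' (𝕂 := ℝ) (I • S) (-t)).scomp t (hasDerivAt_neg t)
  simpa [Function.comp_def, expI] using h

@[fun_prop]
lemma continuous_expI (S : A) : Continuous (expI S) :=
  continuous_iff_continuousAt.2 fun t => (hasDerivAt_expI S t).continuousAt

lemma norm_expI_conj_sub_le {S : A} (hS : IsSelfAdjoint S) (K : A) (t : ℝ) :
    ‖expI S t * K * expI S (-t) - K‖ ≤ |t| * ‖S * K - K * S‖ := by
  have hd : ∀ u : ℝ, HasDerivAt (fun u => expI S u * K * expI S (-u))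
      (expI S u * (I • (S * K - K * S)) * expI S (-u)) u := by
    intro u
    refine (((hasDerivAt_expI S u).mul_const K).mul (hasDerivAt_expI_neg S u)).congr_deriv ?_
    simp only [smul_sub, mul_sub, sub_mul, mul_smul_comm, smul_mul_assoc, mul_neg, mul_assoc]
    abel
  have hb : ∀ u : ℝ, ‖expI S u * (I • (S * K - K * S)) * expI S (-u)‖ ≤ ‖S * K - K * S‖ := by
    intro u
    calc _ ≤ ‖expI S u‖ * ‖I • (S * K - K * S)‖ * ‖expI S (-u)‖ :=
          (norm_mul_le _ _).trans (by gcongr; exact norm_mul_le _ _)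
      _ ≤ 1 * ‖S * K - K * S‖ * 1 := by
          rw [norm_smul, norm_I, one_mul]
          exact mul_le_mul (mul_le_of_le_one_left (norm_nonneg _) (norm_expI_le hS _))
            (norm_expI_le hS _) (norm_nonneg _) (norm_nonneg _)
      _ = _ := by ring
  have h := convex_univ.norm_image_sub_le_of_norm_hasDerivWithin_le
    (fun u _ => (hd u).hasDerivWithinAt) (fun u _ => hb u) (Set.mem_univ (0 : ℝ)) (Set.mem_univ t)
  simpa [expI, NormedSpace.exp_zero, mul_comm] using h

lemma norm_comm_expI_le {S : A} (hS : IsSelfAdjoint S) (K : A) (t : ℝ) :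
    ‖expI S t * K - K * expI S t‖ ≤ |t| * ‖S * K - K * S‖ := by
  have : expI S t * K - K * expI S t = (expI S t * K * expI S (-t) - K) * expI S t := by
    rw [sub_mul, mul_assoc _ _ (expI S t), expI_neg_mul, mul_one]
  rw [this]
  calc _ ≤ ‖expI S t * K * expI S (-t) - K‖ * ‖expI S t‖ := norm_mul_le _ _
    _ ≤ (|t| * ‖S * K - K * S‖) * 1 := by
        gcongr
        · exact norm_expI_conj_sub_le hS K t
        · exact norm_expI_le hS _
    _ = _ := mul_one _

lemma cfc_cexp_eq_expI {S : A} (hS : IsSelfAdjoint S) (t : ℝ) :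
    cfc (fun z : ℂ => Complex.exp (t * I * z)) S = expI S t := by
  have h1 : t • (I • S) = (t * I : ℂ) • S := by
    rw [← Complex.coe_smul, smul_smul]
  have hn := hS.isStarNormal
  rw [expI, h1, cfc_comp_const_mul (t * I : ℂ) Complex.exp S (by fun_prop)]
  exact CFC.complex_exp_eq_normedSpace_exp (ha := hn.smul _)

end Exp

section Fourier
open MeasureTheory FourierTransform Real
open scoped SchwartzMap ContDiff

/-- `g` is an integrable Fourier density of `f`, with first moment at most `C`. -/
structure IsFourierDensity (f : ℝ → ℝ) (g : ℝ → ℂ) (C : ℝ) : Prop where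
  cont : Continuous g
  integrable : Integrable g
  integrable_moment : Integrable fun t => 2 * π * |t| * ‖g t‖
  moment_le : ∫ t, 2 * π * |t| * ‖g t‖ ≤ C
  eq_integral : ∀ x : ℝ, (f x : ℂ) = ∫ t, g t * Complex.exp ((2 * π * t : ℝ) * Complex.I * x)

lemma fourierDensity_schwartz (φ : 𝓢(ℝ, ℂ)) (f : ℝ → ℝ) (hf : ∀ x, φ x = f x) :
    IsFourierDensity f (𝓕 φ : 𝓢(ℝ, ℂ)) (∫ t, 2 * π * |t| * ‖(𝓕 φ : 𝓢(ℝ, ℂ)) t‖) where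
  cont := (𝓕 φ : 𝓢(ℝ, ℂ)).continuous
  integrable := (𝓕 φ : 𝓢(ℝ, ℂ)).integrable
  integrable_moment := by
    have := ((𝓕 φ : 𝓢(ℝ, ℂ)).integrable_pow_mul volume 1).const_mul (2 * π)
    simpa [mul_assoc] using this
  moment_le := le_rfl
  eq_integral x := by
    have h : (𝓕⁻ (𝓕 φ)) x = φ x := by simp
    rw [← hf, ← h, SchwartzMap.fourierInv_coe, Real.fourierInv_eq']
    congr 1; ext t
    rw [smul_eq_mul, mul_comm]
    congr 2
    simp
    ring

lemma contDiff_ofReal_comp {f : ℝ → ℝ} (hf : ContDiff ℝ ∞ f) :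
    ContDiff ℝ ∞ (fun x => (f x : ℂ)) :=
  Complex.ofRealCLM.contDiff.comp hf

lemma exists_fourierDensity {f : ℝ → ℝ} (hf : ContDiff ℝ ∞ f) (hc : HasCompactSupport f) :
    ∃ g C, IsFourierDensity f g C := by
  have hc' : HasCompactSupport (fun x => (f x : ℂ)) := hc.comp_left Complex.ofReal_zero
  exact ⟨_, _, fourierDensity_schwartz (hc'.toSchwartzMap (contDiff_ofReal_comp hf)) f
    fun x => rfl⟩

lemma norm_fourier_comp_sub (ψ : ℝ → ℂ) (M w : ℝ) :
    ‖𝓕 (fun x => ψ (x - M)) w‖ = ‖𝓕 ψ w‖ := by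
  have h := congr_fun (VectorFourier.fourierIntegral_comp_add_right Real.fourierChar volume
    (innerₗ ℝ) ψ (-M)) w
  have h2 : 𝓕 (fun x => ψ (x - M)) w = VectorFourier.fourierIntegral Real.fourierChar volume
    (innerₗ ℝ) (ψ ∘ fun v => v + -M) w := rfl
  rw [h2, h]
  exact Circle.norm_smul _ _

lemma moment_fourier_le_of_deriv_eq (φ ψ : 𝓢(ℝ, ℂ)) (M : ℝ)
    (hder : deriv φ = fun x => ψ x - ψ (x - M)) (t : ℝ) :
    2 * π * |t| * ‖(𝓕 φ : 𝓢(ℝ, ℂ)) t‖ ≤ 2 * ‖(𝓕 ψ : 𝓢(ℝ, ℂ)) t‖ := by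
  have hint : Integrable (fun x => ψ (x - M)) := ψ.integrable.comp_sub_right M
  have h1 := congr_fun (Real.fourier_deriv φ.integrable φ.differentiable
    (by rw [hder]; exact ψ.integrable.sub hint)) t
  have h2 : 𝓕 (deriv φ) t = 𝓕 (ψ : ℝ → ℂ) t - 𝓕 (fun x => ψ (x - M)) t := by
    rw [hder, Real.fourier_eq, Real.fourier_eq, Real.fourier_eq, ← integral_sub]
    · simp only [smul_sub]
    · exact (Real.fourierIntegral_convergent_iff t).2 ψ.integrable
    · exact (Real.fourierIntegral_convergent_iff t).2 hint
  have h3 : ‖𝓕 (deriv φ) t‖ = 2 * π * |t| * ‖(𝓕 φ : 𝓢(ℝ, ℂ)) t‖ := by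
    rw [h1, norm_smul, SchwartzMap.fourier_coe]
    simp [abs_of_pos Real.pi_pos]
  rw [← h3, h2, SchwartzMap.fourier_coe]
  refine (norm_sub_le _ _).trans ?_
  rw [norm_fourier_comp_sub]
  linarith

lemma exists_schwartz {f : ℝ → ℝ} (hf : ContDiff ℝ ∞ f) {a b : ℝ} (h0 : ∀ x < a, f x = 0)
    (h1 : ∀ x > b, f x = 0) : ∃ φ : 𝓢(ℝ, ℂ), ∀ x, φ x = f x := by
  have hc : HasCompactSupport f := by
    refine HasCompactSupport.intro (isCompact_Icc (a := a) (b := b)) fun x hx => ?_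
    rw [Set.mem_Icc, not_and_or, not_le, not_le] at hx
    exact hx.elim (h0 x) (h1 x)
  have hc' : HasCompactSupport (fun x => (f x : ℂ)) := hc.comp_left Complex.ofReal_zero
  exact ⟨hc'.toSchwartzMap (contDiff_ofReal_comp hf), fun x => rfl⟩

lemma exists_schwartz_deriv_smoothTransition :
    ∃ ψ : 𝓢(ℝ, ℂ), ∀ x, ψ x = deriv smoothTransition x := by
  have hst : ContDiff ℝ ∞ smoothTransition := smoothTransition.contDiff
  refine exists_schwartz (contDiff_infty_iff_deriv.1 hst).2 (a := 0) (b := 1)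
    (fun x hx => ?_) fun x hx => ?_
  · have : smoothTransition =ᶠ[nhds x] fun _ => 0 := by
      filter_upwards [Iio_mem_nhds hx] with y hy
        using smoothTransition.zero_of_nonpos (le_of_lt hy)
    rw [this.deriv_eq, deriv_const]
  · have : smoothTransition =ᶠ[nhds x] fun _ => 1 := by
      filter_upwards [Ioi_mem_nhds hx] with y hy
        using smoothTransition.one_of_one_le (le_of_lt hy)
    rw [this.deriv_eq, deriv_const]

lemma exists_uniform_fourierDensity_smoothTransition :
    ∃ C : ℝ, ∀ M : ℝ, 0 ≤ M → ∃ g,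
      IsFourierDensity (fun x => smoothTransition x - smoothTransition (x - M)) g C := by
  have hst : ContDiff ℝ ∞ smoothTransition := smoothTransition.contDiff
  obtain ⟨ψ, hψx⟩ := exists_schwartz_deriv_smoothTransition
  refine ⟨∫ t, 2 * ‖(𝓕 ψ : 𝓢(ℝ, ℂ)) t‖, fun M hM => ?_⟩
  obtain ⟨φ, hφx⟩ := exists_schwartz (a := 0) (b := M + 1)
    (hst.sub (hst.comp (contDiff_id.sub (contDiff_const (c := M))))) (fun x hx => by
      simp [smoothTransition.zero_of_nonpos hx.le,
        smoothTransition.zero_of_nonpos (show x - M ≤ 0 by linarith)]) (fun x hx => by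
      simp [smoothTransition.one_of_one_le (show 1 ≤ x by linarith),
        smoothTransition.one_of_one_le (show 1 ≤ x - M by linarith)])
  have hφ := fourierDensity_schwartz φ _ hφx
  refine ⟨(𝓕 φ : 𝓢(ℝ, ℂ)), hφ.cont, hφ.integrable, hφ.integrable_moment, ?_, hφ.eq_integral⟩
  refine integral_mono hφ.integrable_moment ((𝓕 ψ : 𝓢(ℝ, ℂ)).integrable.norm.const_mul 2)
    (moment_fourier_le_of_deriv_eq φ ψ M ?_)
  ext x
  have hd : Differentiable ℝ smoothTransition := hst.differentiable (by simp)
  have h2 := ((hd x).hasDerivAt.sub ((hd (x - M)).hasDerivAt.comp_sub_const x M)).ofReal_comp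
  rw [hψx, hψx, ← Complex.ofReal_sub, ← h2.deriv, funext hφx]
  rfl

end Fourier

section Smear
open MeasureTheory Real
open scoped ContDiff

variable {A : Type*} [CStarAlgebra A] {f : ℝ → ℝ} {g : ℝ → ℂ} {C : ℝ}

lemma norm_integral_smul_le_of_norm_le (hg : Integrable g) {F : ℝ → A} {c : ℝ}
    (hF : ∀ t, ‖F t‖ ≤ c) : ‖∫ t, g t • F t‖ ≤ (∫ t, ‖g t‖) * c := by
  rw [← integral_mul_const]
  refine norm_integral_le_of_norm_le (hg.norm.mul_const c) (Filter.Eventually.of_forall fun t => ?_)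
  rw [norm_smul]
  exact mul_le_mul_of_nonneg_left (hF t) (norm_nonneg _)

lemma IsFourierDensity.norm_integral_smul_le (hg : IsFourierDensity f g C) {F : ℝ → A} {c : ℝ}
    (hc : 0 ≤ c) (hF : ∀ t, ‖F t‖ ≤ |2 * π * t| * c) : ‖∫ t, g t • F t‖ ≤ C * c := by
  refine le_trans ?_ (mul_le_mul_of_nonneg_right hg.moment_le hc)
  rw [← integral_mul_const]
  refine norm_integral_le_of_norm_le (hg.integrable_moment.mul_const c)
    (Filter.Eventually.of_forall fun t => ?_)
  rw [norm_smul]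
  refine (mul_le_mul_of_nonneg_left (hF t) (norm_nonneg _)).trans (le_of_eq ?_)
  rw [abs_mul, abs_of_pos Real.two_pi_pos]
  ring

lemma IsFourierDensity.integrable_smul (hg : IsFourierDensity f g C) {F : ℝ → A} {c : ℝ}
    (hFc : Continuous F) (hF : ∀ t, ‖F t‖ ≤ c) : Integrable fun t => g t • F t := by
  refine Integrable.mono' (hg.integrable.norm.mul_const c)
    (hg.cont.smul hFc).aestronglyMeasurable (Filter.Eventually.of_forall fun t => ?_)
  rw [norm_smul]
  exact mul_le_mul_of_nonneg_left (hF t) (norm_nonneg _)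

lemma norm_expI_conj_le {S : A} (hS : IsSelfAdjoint S) (K : A) (t : ℝ) :
    ‖expI S t * K * expI S (-t)‖ ≤ ‖K‖ := by
  calc _ ≤ ‖expI S t‖ * ‖K‖ * ‖expI S (-t)‖ :=
        (norm_mul_le _ _).trans (by gcongr; exact norm_mul_le _ _)
    _ ≤ ‖K‖ * 1 := mul_le_mul (mul_le_of_le_one_left (norm_nonneg _) (norm_expI_le hS _))
            (norm_expI_le hS _) (norm_nonneg _) (norm_nonneg _)
    _ = _ := mul_one _

lemma IsFourierDensity.cfc_eq_integral (hg : IsFourierDensity f g C) {S : A}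
    (hS : IsSelfAdjoint S) : cfc f S = ∫ t, g t • expI S (2 * π * t) := by
  have hn := hS.isStarNormal
  rw [cfc_real_eq_complex f hS]
  have h1 : ∀ t : ℝ, g t • expI S (2 * π * t) =
      cfc (fun z : ℂ => g t * Complex.exp ((2 * π * t : ℝ) * Complex.I * z)) S := by
    intro t
    rw [← cfc_cexp_eq_expI hS, cfc_const_mul _ _ S (by fun_prop)]
  simp_rw [h1]
  have hre : ∀ z ∈ spectrum ℂ S, z = (z.re : ℂ) := fun z hz => hS.mem_spectrum_eq_re hz
  rw [← cfc_integral (fun t z => g t * Complex.exp ((2 * π * t : ℝ) * Complex.I * z))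
    (fun t => ‖g t‖) S]
  · refine cfc_congr fun z hz => ?_
    rw [hg.eq_integral, ← hre z hz]
  · have := hg.cont
    refine Continuous.continuousOn ?_
    simp only [Function.uncurry_def]
    fun_prop
  · refine Filter.Eventually.of_forall fun t z hz => ?_
    rw [hre z hz, norm_mul, mul_right_comm, ← Complex.ofReal_mul, Complex.norm_exp_ofReal_mul_I,
      mul_one]
  · exact hg.integrable.norm.hasFiniteIntegral

/-- Commutators with a function of `S` are controlled by commutators with `S`. -/
lemma IsFourierDensity.norm_comm_cfc_le (hg : IsFourierDensity f g C) {S : A}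
    (hS : IsSelfAdjoint S) (K : A) :
    ‖cfc f S * K - K * cfc f S‖ ≤ C * ‖S * K - K * S‖ := by
  have hi : Integrable fun t => g t • expI S (2 * π * t) :=
    hg.integrable_smul (by fun_prop) fun t => norm_expI_le hS _
  rw [hg.cfc_eq_integral hS, ← integral_mul_const_of_integrable hi,
    ← integral_const_mul_of_integrable hi, ← integral_sub (hi.mul_const K) (hi.const_mul K)]
  simp_rw [smul_mul_assoc, mul_smul_comm, ← smul_sub]
  exact hg.norm_integral_smul_le (norm_nonneg _) fun t => norm_comm_expI_le hS K _

/-- The average of the conjugates of `K` by `exp(2πitB)` against the density `g`. -/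
def smear (g : ℝ → ℂ) (B K : A) : A :=
  ∫ t, g t • (expI B (2 * π * t) * K * expI B (-(2 * π * t)))

lemma IsFourierDensity.integrable_smear (hg : IsFourierDensity f g C) {B : A}
    (hB : IsSelfAdjoint B) (K : A) :
    Integrable fun t => g t • (expI B (2 * π * t) * K * expI B (-(2 * π * t))) :=
  hg.integrable_smul (by fun_prop) fun _ => norm_expI_conj_le hB K _

lemma IsFourierDensity.norm_smear_le (hg : IsFourierDensity f g C) {B : A}
    (hB : IsSelfAdjoint B) (K : A) : ‖smear g B K‖ ≤ (∫ t, ‖g t‖) * ‖K‖ :=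
  norm_integral_smul_le_of_norm_le hg.integrable fun _ => norm_expI_conj_le hB K _

lemma IsFourierDensity.norm_smear_sub_le (hg : IsFourierDensity f g C) (h0 : f 0 = 1) {B : A}
    (hB : IsSelfAdjoint B) (K : A) : ‖smear g B K - K‖ ≤ C * ‖B * K - K * B‖ := by
  have h1 : K = ∫ t, g t • K := by
    have h := hg.eq_integral 0
    simp only [h0, Complex.ofReal_one, Complex.ofReal_zero, mul_zero, Complex.exp_zero,
      mul_one] at h
    rw [integral_smul_const, ← h, one_smul]
  have h2 : smear g B K - K =
      ∫ t, g t • (expI B (2 * π * t) * K * expI B (-(2 * π * t)) - K) := by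
    simp_rw [smul_sub]
    rw [integral_sub (hg.integrable_smear hB K) (hg.integrable.smul_const K), ← h1, smear]
  rw [h2]
  exact hg.norm_integral_smul_le (norm_nonneg _) fun t => norm_expI_conj_sub_le hB K _

lemma commute_expI (B : A) (t : ℝ) : Commute B (expI B t) := by
  let : NormedAlgebra ℚ A := NormedAlgebra.restrictScalars ℚ ℝ A
  exact (((Commute.refl B).smul_right _).smul_right _).exp_right

lemma IsFourierDensity.comm_smear (hg : IsFourierDensity f g C) {B : A}
    (hB : IsSelfAdjoint B) (K : A) :
    B * smear g B K - smear g B K * B = smear g B (B * K - K * B) := by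
  have hi := hg.integrable_smear hB K
  rw [smear, smear, ← integral_mul_const_of_integrable hi,
    ← integral_const_mul_of_integrable hi, ← integral_sub (hi.const_mul B) (hi.mul_const B)]
  congr 1; ext t
  rw [smul_mul_assoc, mul_smul_comm, ← smul_sub]
  congr 1
  rw [mul_sub, sub_mul, mul_assoc _ _ B, ← (commute_expI B _).eq, ← mul_assoc, ← mul_assoc,
    (commute_expI B _).eq]
  simp only [mul_assoc]

end Smear

section Cutoff
open Real
open scoped ContDiff

/-- A bump function equal to `1` on `[-M, M]`. -/
def cutoff (M x : ℝ) : ℝ := smoothTransition (M + 1 + x) * smoothTransition (M + 1 - x)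

lemma contDiff_cutoff (M : ℝ) : ContDiff ℝ ∞ (cutoff M) :=
  (smoothTransition.contDiff.comp (contDiff_const.add contDiff_id)).mul
    (smoothTransition.contDiff.comp (contDiff_const.sub contDiff_id))

lemma cutoff_eq_one {M x : ℝ} (hx : |x| ≤ M) : cutoff M x = 1 := by
  rw [abs_le] at hx
  rw [cutoff, smoothTransition.one_of_one_le (by linarith),
    smoothTransition.one_of_one_le (by linarith), one_mul]

lemma cutoff_eq_zero {M x : ℝ} (hx : M + 1 ≤ |x|) : cutoff M x = 0 := by
  rcases le_abs.1 hx with h | h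
  · rw [cutoff, smoothTransition.zero_of_nonpos (x := M + 1 - x) (by linarith), mul_zero]
  · rw [cutoff, smoothTransition.zero_of_nonpos (x := M + 1 + x) (by linarith), zero_mul]

lemma hasCompactSupport_cutoff (M : ℝ) : HasCompactSupport (cutoff M) := by
  refine HasCompactSupport.intro (isCompact_Icc (a := -(M + 1)) (b := M + 1)) fun x hx => ?_
  refine cutoff_eq_zero ?_
  rw [Set.mem_Icc, ← abs_le] at hx
  exact (not_le.1 hx).le

lemma norm_le_of_mem_spectrum {A : Type*} [CStarAlgebra A] {S : A} {M : ℝ} (hM : ‖S‖ ≤ M)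
    {x : ℝ} (hx : x ∈ spectrum ℝ S) : |x| ≤ M := by
  rcases subsingleton_or_nontrivial A with h | h
  · simp [spectrum.of_subsingleton] at hx
  · exact (spectrum.norm_le_norm_of_mem hx).trans hM

lemma exists_norm_comm_cfc_le {f : ℝ → ℝ} (hf : ContDiff ℝ ∞ f) (M : ℝ) :
    ∃ C : ℝ, 0 ≤ C ∧ ∀ {A : Type} [CStarAlgebra A] (S K : A), IsSelfAdjoint S → ‖S‖ ≤ M →
      ‖cfc f S * K - K * cfc f S‖ ≤ C * ‖S * K - K * S‖ := by
  obtain ⟨g, C, hg⟩ := exists_fourierDensity (hf.mul (contDiff_cutoff M))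
    (hasCompactSupport_cutoff M).mul_left
  refine ⟨C, ?_, fun {A} _ S K hS hM => ?_⟩
  · exact le_trans (MeasureTheory.integral_nonneg fun t => by positivity) hg.moment_le
  · have : cfc f S = cfc (fun x => f x * cutoff M x) S := by
      refine cfc_congr fun x hx => ?_
      rw [cutoff_eq_one (norm_le_of_mem_spectrum hM hx), mul_one]
    rw [this]
    exact hg.norm_comm_cfc_le hS K

end Cutoff

section Order
open scoped ComplexOrder

variable {A : Type*} [CStarAlgebra A] [PartialOrder A] [StarOrderedRing A]

lemma norm_le_of_neg_le_of_le {a : A} (ha : IsSelfAdjoint a) {r : ℝ} (hr : 0 ≤ r)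
    (h1 : -(algebraMap ℝ A r) ≤ a) (h2 : a ≤ algebraMap ℝ A r) : ‖a‖ ≤ r := by
  rw [← cfc_id ℝ a]
  refine norm_cfc_le hr fun x hx => ?_
  rw [← map_neg] at h1
  exact abs_le.2 ⟨(algebraMap_le_iff_le_spectrum ha).1 h1 x hx,
    (le_algebraMap_iff_spectrum_le ha).1 h2 x hx⟩

lemma le_add_sqrt_of_sq_le {a b : A} (ha : 0 ≤ a) (hb : 0 ≤ b) {r : ℝ} (hr : 0 ≤ r)
    (h : a * a ≤ b * b + algebraMap ℝ A r) : a ≤ b + algebraMap ℝ A √r := by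
  have hs : 0 ≤ algebraMap ℝ A √r := by
    rw [Algebra.algebraMap_eq_smul_one]; exact smul_nonneg (Real.sqrt_nonneg _) zero_le_one
  have hc : (b + algebraMap ℝ A √r) * (b + algebraMap ℝ A √r) =
      b * b + algebraMap ℝ A r + (2 * √r) • b := by
    have : algebraMap ℝ A r = algebraMap ℝ A √r * algebraMap ℝ A √r := by
      rw [← map_mul, Real.mul_self_sqrt hr]
    rw [this]
    simp only [Algebra.algebraMap_eq_smul_one, mul_add, add_mul, smul_mul_assoc, mul_smul_comm,
      one_mul, mul_one, two_mul, add_smul, smul_add]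
    abel
  have h2 : a * a ≤ (b + algebraMap ℝ A √r) * (b + algebraMap ℝ A √r) := by
    rw [hc]
    exact h.trans (le_add_of_nonneg_right (smul_nonneg (by positivity) hb))
  have h3 := CFC.sqrt_le_sqrt _ _ h2
  rwa [CFC.sqrt_mul_self a, CFC.sqrt_mul_self _ (add_nonneg hb hs)] at h3

lemma norm_sub_sq_le_of_nonneg {a b : A} (ha : 0 ≤ a) (hb : 0 ≤ b) :
    ‖a - b‖ ^ 2 ≤ ‖a * a - b * b‖ := by
  have sa : IsSelfAdjoint a := .of_nonneg ha
  have sb : IsSelfAdjoint b := .of_nonneg hb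
  have key : ∀ {a b : A}, 0 ≤ a → 0 ≤ b → a ≤ b + algebraMap ℝ A √‖a * a - b * b‖ := by
    intro a b ha hb
    have sa : IsSelfAdjoint a := .of_nonneg ha
    have sb : IsSelfAdjoint b := .of_nonneg hb
    refine le_add_sqrt_of_sq_le ha hb (norm_nonneg _) ?_
    have hs : IsSelfAdjoint (a * a - b * b) := by
      simp [isSelfAdjoint_iff, sa.star_eq, sb.star_eq]
    have := hs.le_algebraMap_norm_self
    exact sub_le_iff_le_add'.1 this
  have h1 := key ha hb
  have h2 := key hb ha
  rw [norm_sub_rev] at h2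
  have : ‖a - b‖ ≤ √‖a * a - b * b‖ := by
    refine norm_le_of_neg_le_of_le (sa.sub sb) (Real.sqrt_nonneg _) ?_ ?_
    · rw [neg_le, neg_sub, sub_le_iff_le_add']; exact h2
    · rw [sub_le_iff_le_add']; exact h1
  calc _ ≤ √‖a * a - b * b‖ ^ 2 := by gcongr
    _ = _ := Real.sq_sqrt (norm_nonneg _)

lemma norm_sq_le_of_star_mul_self_le {G W : A} (h : star G * G ≤ W) : ‖G‖ ^ 2 ≤ ‖W‖ := by
  have := CStarAlgebra.norm_le_norm_of_nonneg_of_le (star_mul_self_nonneg G) h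
  rwa [CStarRing.norm_star_mul_self, ← sq] at this

/-- Polar decomposition of an invertible element. -/
lemma exists_polar {T : A} (hT : IsUnit T) :
    ∃ U H : A, star U * U = 1 ∧ U * star U = 1 ∧ 0 ≤ H ∧ H * H = star T * T ∧ T = U * H ∧
      ‖U * H - H * U‖ ^ 2 ≤ ‖T * star T - star T * T‖ ∧
      ∀ K, Commute T K → Commute (star T) K → Commute U K := by
  have hn : 0 ≤ star T * T := star_mul_self_nonneg T
  set H : A := CFC.sqrt (star T * T) with hH
  have hHn : 0 ≤ H := CFC.sqrt_nonneg _
  have hHH : H * H = star T * T := CFC.sqrt_mul_sqrt_self _ hn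
  have hHs : star H = H := (IsSelfAdjoint.of_nonneg hHn).star_eq
  have hHu : IsUnit H := (CFC.isUnit_sqrt_iff _ hn).2 (hT.star.mul hT)
  obtain ⟨h, hh⟩ := hHu
  obtain ⟨t, ht⟩ := hT
  set h' : A := ↑h⁻¹ with hh'
  have e1 : H * h' = 1 := by rw [← hh]; exact h.mul_inv
  have e2 : h' * H = 1 := by rw [← hh]; exact h.inv_mul
  have e3 : star h' = h' := by
    calc star h' = star h' * (H * h') := by rw [e1, mul_one]
      _ = star (H * h') * h' := by rw [star_mul, hHs, mul_assoc]
      _ = h' := by rw [e1, star_one, one_mul]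
  have hU1 : star (T * h') * (T * h') = 1 := by
    calc _ = h' * (star T * T) * h' := by rw [star_mul, e3]; simp only [mul_assoc]
      _ = (h' * H) * (H * h') := by rw [← hHH]; simp only [mul_assoc]
      _ = 1 := by rw [e1, e2, one_mul]
  have hUu : IsUnit (T * h') := by rw [← ht]; exact (t * h⁻¹).isUnit
  have hU2 : (T * h') * star (T * h') = 1 := by
    refine hUu.mul_right_cancel ?_
    rw [mul_assoc, hU1, mul_one, one_mul]
  have hTU : T = T * h' * H := by rw [mul_assoc, e2, mul_one]
  refine ⟨T * h', H, hU1, hU2, hHn, hHH, hTU, ?_, ?_⟩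
  · set U := T * h'
    have h0 : U * H - H * U = (U * H * star U - H) * U := by
      rw [sub_mul, mul_assoc _ (star U) U, hU1, mul_one]
    have hUn : ‖U‖ ≤ 1 := by
      have := norm_sq_le_of_star_mul_self_le hU1.le
      rcases subsingleton_or_nontrivial A with hA | hA
      · rw [Subsingleton.elim U 0]; simp
      · rw [norm_one] at this; nlinarith [norm_nonneg U]
    have h1 : ‖U * H - H * U‖ ≤ ‖U * H * star U - H‖ := by
      rw [h0]
      exact (norm_mul_le _ _).trans (mul_le_of_le_one_right (norm_nonneg _) hUn)
    have h2 : U * H * star U * (U * H * star U) = T * star T := by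
      calc _ = U * H * (star U * U) * H * star U := by simp only [mul_assoc]
        _ = (U * H) * star (U * H) := by rw [hU1, mul_one, star_mul U H, hHs]; simp only [mul_assoc]
        _ = _ := by rw [← hTU]
    have h3 := norm_sub_sq_le_of_nonneg (star_right_conjugate_nonneg hHn U) hHn
    rw [h2, hHH] at h3
    exact le_trans (by gcongr) h3
  · intro K h1 h2
    have h3 : Commute H K := (h2.mul_left h1).cfcₙ_nnreal _
    refine h1.mul_left ?_
    have h4 : Commute (h : A) K := by rw [hh]; exact h3
    exact h4.units_inv_left

end Order

section Edge
open Real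
open scoped ContDiff

/-- A smooth step vanishing for `x ≤ 1/128` and equal to `1` for `x ≥ 1/64`. -/
def stepFn (x : ℝ) : ℝ := smoothTransition (128 * x - 1)

lemma contDiff_stepFn : ContDiff ℝ ∞ stepFn :=
  smoothTransition.contDiff.comp ((contDiff_const.mul contDiff_id).sub contDiff_const)

@[fun_prop]
lemma continuous_stepFn : Continuous stepFn := contDiff_stepFn.continuous

lemma stepFn_eq_zero {x : ℝ} (hx : x ≤ 1 / 128) : stepFn x = 0 :=
  smoothTransition.zero_of_nonpos (by linarith)

lemma stepFn_eq_one {x : ℝ} (hx : 1 / 64 ≤ x) : stepFn x = 1 :=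
  smoothTransition.one_of_one_le (by linarith)

lemma stepFn_nonneg (x : ℝ) : 0 ≤ stepFn x := smoothTransition.nonneg _

lemma stepFn_le_one (x : ℝ) : stepFn x ≤ 1 := smoothTransition.le_one _

lemma edge_arith {g s e D : ℝ} (hg : 0 ≤ g) (hs : 0 ≤ s) (he : 0 ≤ e)
    (h1 : s ^ 2 ≤ 1 / 64 * g ^ 2 + g * e) (h2 : g ≤ 3 * s + e) (h3 : e ≤ D + g / 128) :
    g ≤ 15 * D := by
  by_contra! h
  have h4 : e < 0.075 * g := by linarith
  have h5 : 0.925 * g < 3 * s := by linarith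
  nlinarith

lemma exists_norm_one_sub_stepFn_mul_le :
    ∃ C : ℝ, 0 ≤ C ∧ ∀ {A : Type} [CStarAlgebra A] [PartialOrder A] [StarOrderedRing A]
      (S H c χ d : A) (μ : ℝ), IsSelfAdjoint S → ‖S‖ ≤ 1 → 0 ≤ H → ‖H‖ ≤ 3 →
      ‖S * c - c * S‖ ≤ μ → ‖c - H * S‖ ≤ μ → ‖χ‖ ≤ 1 → ‖d‖ ≤ 1 / 128 → (c - 1) * χ = χ * d →
      ‖(1 - cfc stepFn S) * χ‖ ≤ C * μ := by
  obtain ⟨L, hL, hLC⟩ := exists_norm_comm_cfc_le contDiff_stepFn 1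
  refine ⟨15 * (1 + L), by positivity, fun {A} _ _ _ S H c χ d μ hS hS1 hH hH3 hc hcH hχ hd hcd => ?_⟩
  have hμ : 0 ≤ μ := (norm_nonneg _).trans hc
  have hθ : cfc (fun x => 1 - stepFn x) S = 1 - cfc stepFn S := by
    rw [cfc_sub _ _ S, cfc_const_one ℝ S]
  set θ : A := 1 - cfc stepFn S with hθdef
  have hθn : ‖θ‖ ≤ 1 := by
    rw [← hθ]
    refine norm_cfc_le zero_le_one fun x _ => ?_
    rw [Real.norm_eq_abs, abs_le]
    constructor <;> linarith [stepFn_nonneg x, stepFn_le_one x]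
  have hθs : star θ = θ := by rw [← hθ]; exact (cfc_predicate (fun x => 1 - stepFn x) S).star_eq
  set G : A := θ * χ with hG
  have hG1 : ‖G‖ ≤ 1 := by
    simpa using norm_mul_le_of_le hθn hχ
  set E : A := H * S * G - G with hE
  have hEe : E = -((c - H * S) * G) + ((cfc stepFn S * c - c * cfc stepFn S) * χ) + G * d := by
    have : G * d = θ * (c - 1) * χ := by rw [hG, mul_assoc, ← hcd, mul_assoc]
    rw [this, hE, hG, hθdef]
    noncomm_ring
  have hEn : ‖E‖ ≤ (1 + L) * μ + ‖G‖ / 128 := by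
    have e1 : ‖-((c - H * S) * G)‖ ≤ μ * 1 := by
      rw [norm_neg]; exact norm_mul_le_of_le hcH hG1
    have e2 : ‖(cfc stepFn S * c - c * cfc stepFn S) * χ‖ ≤ (L * μ) * 1 :=
      norm_mul_le_of_le ((hLC S c hS hS1).trans (by gcongr)) hχ
    have e3 : ‖G * d‖ ≤ ‖G‖ * (1 / 128) := norm_mul_le_of_le le_rfl hd
    rw [hEe]
    refine (norm_add_le_of_le (norm_add_le_of_le e1 e2) e3).trans (le_of_eq (by ring))
  have hpos1 : 0 ≤ star G * S * G + star G * S * E := by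
    have := star_left_conjugate_nonneg hH (S * G)
    convert this using 1
    rw [hE, star_mul S G, hS.star_eq]
    noncomm_ring
  have hpos2 : 0 ≤ star G * (algebraMap ℝ A (1 / 64) - S) * (S + 1) * G := by
    have h1 : 0 ≤ cfc (fun x => (1 - stepFn x) * ((1 / 64 - x) * (x + 1)) * (1 - stepFn x)) S := by
      refine cfc_nonneg fun x hx => ?_
      have hx1 := abs_le.1 (norm_le_of_mem_spectrum hS1 hx)
      rcases le_total x (1 / 64) with h | h
      · have := mul_nonneg (sub_nonneg.2 h) (show 0 ≤ x + 1 by linarith)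
        have h2 := stepFn_le_one x
        exact mul_nonneg (mul_nonneg (by linarith) this) (by linarith)
      · rw [stepFn_eq_one h]; simp
    rw [cfc_mul _ _ S, cfc_mul _ _ S, cfc_mul _ _ S, hθ, cfc_sub _ _ S, cfc_add S (fun x => x) (fun _ => 1),
      cfc_const _ S, cfc_const _ S, cfc_id' ℝ S, map_one] at h1
    have := star_left_conjugate_nonneg h1 χ
    convert this using 1
    rw [hG, star_mul, hθs]
    noncomm_ring
  have hsg : star (S * G) * (S * G) ≤
      (1 / 64 : ℝ) • (star G * G) + (63 / 64 : ℝ) • (star G * S * E) := by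
    rw [← sub_nonneg]
    have := add_nonneg hpos2 (smul_nonneg (show (0 : ℝ) ≤ 63 / 64 by norm_num) hpos1)
    convert this using 1
    rw [star_mul S G, hS.star_eq, Algebra.algebraMap_eq_smul_one]
    simp only [mul_add, mul_sub, add_mul, sub_mul, mul_smul_comm, smul_mul_assoc, mul_one,
      smul_add, mul_assoc]
    module
  have hs := norm_sq_le_of_star_mul_self_le hsg
  refine edge_arith (e := ‖E‖) (s := ‖S * G‖) (norm_nonneg _) (norm_nonneg _) (norm_nonneg _)
    (hs.trans ?_) ?_ hEn |>.trans (le_of_eq (by ring))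
  · have e1 : ‖star G * G‖ ≤ ‖G‖ * ‖G‖ := (norm_mul_le _ _).trans (by rw [norm_star])
    have e2 : ‖star G * S * E‖ ≤ ‖G‖ * 1 * ‖E‖ :=
      norm_mul_le_of_le (norm_mul_le_of_le (norm_star _).le hS1) le_rfl
    refine (norm_add_le _ _).trans ?_
    rw [norm_smul, norm_smul, Real.norm_eq_abs, Real.norm_eq_abs, abs_of_nonneg (by norm_num),
      abs_of_nonneg (by norm_num)]
    nlinarith [norm_nonneg (star G * S * E)]
  · have : G = H * (S * G) - E := by rw [hE]; noncomm_ring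
    calc ‖G‖ = ‖H * (S * G) - E‖ := by rw [← this]
      _ ≤ ‖H‖ * ‖S * G‖ + ‖E‖ := (norm_sub_le _ _).trans (by gcongr; exact norm_mul_le _ _)
      _ ≤ 3 * ‖S * G‖ + ‖E‖ := by gcongr

end Edge

section Frame
set_option linter.unusedSectionVars false
open Real Complex

variable {A : Type*} [CStarAlgebra A] [PartialOrder A] [StarOrderedRing A]

/-- An approximately normal polar decomposition `X + i c = U H`. -/
structure Frame (X c U H : A) (μ : ℝ) : Prop where
  saX : IsSelfAdjoint X
  sac : IsSelfAdjoint c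
  unit_left : star U * U = 1
  unit_right : U * star U = 1
  nonneg : 0 ≤ H
  norm_H : ‖H‖ ≤ 3
  eq : X + I • c = U * H
  comm : ‖U * H - H * U‖ ≤ μ

/-- The self-adjoint real part of `U`. -/
def rePt (U : A) : A := (1 / 2 : ℂ) • (U + star U)

/-- The self-adjoint imaginary part of `U`. -/
def imPt (U : A) : A := (-I / 2) • (U - star U)

omit [PartialOrder A] [StarOrderedRing A] in
lemma rePt_add_imPt (U : A) : rePt U + I • imPt U = U := by
  rw [rePt, imPt, smul_smul, show I * (-I / 2) = 1 / 2 by rw [mul_div_assoc', mul_neg, I_mul_I, neg_neg]]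
  rw [← smul_add, add_add_sub_cancel, ← two_smul ℂ, smul_smul]
  norm_num

omit [PartialOrder A] [StarOrderedRing A] in
lemma isSelfAdjoint_rePt (U : A) : IsSelfAdjoint (rePt U) := by
  rw [isSelfAdjoint_iff, rePt, star_smul, star_add, star_star, add_comm]
  simp

omit [PartialOrder A] [StarOrderedRing A] in
lemma isSelfAdjoint_imPt (U : A) : IsSelfAdjoint (imPt U) := by
  rw [isSelfAdjoint_iff, imPt, star_smul, star_sub, star_star, ← neg_sub, smul_neg, ← neg_smul]
  congr 1
  simp [neg_div]

omit [PartialOrder A] [StarOrderedRing A] in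
lemma norm_le_one_of_star_mul_self {U : A} (h : star U * U = 1) : ‖U‖ ≤ 1 := by
  rcases subsingleton_or_nontrivial A with hA | hA
  · rw [Subsingleton.elim U 0]; simp
  · have := CStarRing.norm_star_mul_self (x := U)
    rw [h, norm_one] at this
    nlinarith [norm_nonneg U]

omit [PartialOrder A] [StarOrderedRing A] in
lemma norm_rePt_le {U : A} {r : ℝ} (h1 : ‖U‖ ≤ r) : ‖rePt U‖ ≤ r := by
  rw [rePt, norm_smul]
  have := norm_add_le_of_le h1 ((norm_star U).le.trans h1)
  norm_num
  linarith

omit [PartialOrder A] [StarOrderedRing A] in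
lemma norm_imPt_le {U : A} {r : ℝ} (h1 : ‖U‖ ≤ r) : ‖imPt U‖ ≤ r := by
  rw [imPt, norm_smul]
  have := norm_sub_le_of_le h1 ((norm_star U).le.trans h1)
  norm_num
  linarith

namespace Frame

variable {X c U H : A} {μ : ℝ} (h : Frame X c U H μ)
include h

lemma norm_U : ‖U‖ ≤ 1 := norm_le_one_of_star_mul_self h.unit_left

lemma star_eq : X - I • c = H * star U := by
  have := congrArg star h.eq
  simpa [h.saX.star_eq, h.sac.star_eq, (IsSelfAdjoint.of_nonneg h.nonneg).star_eq,
    sub_eq_add_neg] using this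

lemma X_eq : X = (1 / 2 : ℂ) • (U * H + H * star U) := by
  rw [← h.eq, ← h.star_eq]
  module

lemma c_eq : c = (-I / 2) • (U * H - H * star U) := by
  rw [← h.eq, ← h.star_eq, add_sub_sub_cancel, ← two_smul ℂ, smul_smul, smul_smul,
    show -I / 2 * 2 * I = 1 by linear_combination -I_mul_I, one_smul]

lemma norm_comm_U_aux {a b : ℂ} (ha : ‖a‖ ≤ 1 / 2) (hb : ‖b‖ ≤ 1 / 2) :
    ‖U * (a • (U * H) + b • (H * star U)) - (a • (U * H) + b • (H * star U)) * U‖ ≤ μ := by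
  have e : U * (a • (U * H) + b • (H * star U)) - (a • (U * H) + b • (H * star U)) * U =
      a • (U * (U * H - H * U)) + b • ((U * H - H * U) * star U) := by
    have h1 : H * star U * U = H * U * star U := by
      rw [mul_assoc, h.unit_left, mul_assoc, h.unit_right]
    simp only [mul_add, add_mul, mul_smul_comm, smul_mul_assoc, h1, mul_sub, sub_mul, smul_sub,
      mul_assoc]
    abel
  have hU := h.norm_U
  have e1 : ‖a • (U * (U * H - H * U))‖ ≤ 1 / 2 * (1 * μ) := by
    rw [norm_smul]
    exact mul_le_mul ha (norm_mul_le_of_le hU h.comm) (norm_nonneg _) (by norm_num)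
  have e2 : ‖b • ((U * H - H * U) * star U)‖ ≤ 1 / 2 * (μ * 1) := by
    rw [norm_smul]
    exact mul_le_mul hb (norm_mul_le_of_le h.comm ((norm_star U).le.trans hU)) (norm_nonneg _)
      (by norm_num)
  rw [e]
  exact (norm_add_le_of_le e1 e2).trans (by linarith)

lemma norm_comm_U_X : ‖U * X - X * U‖ ≤ μ := by
  have := h.norm_comm_U_aux (a := 1 / 2) (b := 1 / 2) (by norm_num) (by norm_num)
  rwa [← smul_add, ← h.X_eq] at this

lemma norm_comm_U_c : ‖U * c - c * U‖ ≤ μ := by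
  have := h.norm_comm_U_aux (a := -I / 2) (b := -(-I / 2)) (by norm_num) (by norm_num)
  rwa [neg_smul, ← sub_eq_add_neg, ← smul_sub, ← h.c_eq] at this

omit h in
lemma norm_comm_star {V Y : A} {r : ℝ} (hY : IsSelfAdjoint Y) (hV : ‖V * Y - Y * V‖ ≤ r) :
    ‖star V * Y - Y * star V‖ ≤ r := by
  rw [← norm_star, star_sub, star_mul, star_mul, star_star, hY.star_eq, norm_sub_rev]
  exact hV

omit h in
lemma norm_comm_rePt {V Y : A} {r : ℝ} (hY : IsSelfAdjoint Y) (hV : ‖V * Y - Y * V‖ ≤ r) :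
    ‖rePt V * Y - Y * rePt V‖ ≤ r := by
  have : rePt V * Y - Y * rePt V =
      (1 / 2 : ℂ) • ((V * Y - Y * V) + (star V * Y - Y * star V)) := by
    rw [rePt]
    simp only [mul_add, add_mul, mul_smul_comm, smul_mul_assoc]
    module
  rw [this, norm_smul]
  have := norm_add_le_of_le hV (norm_comm_star hY hV)
  norm_num
  linarith

omit h in
lemma norm_comm_imPt {V Y : A} {r : ℝ} (hY : IsSelfAdjoint Y) (hV : ‖V * Y - Y * V‖ ≤ r) :
    ‖imPt V * Y - Y * imPt V‖ ≤ r := by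
  have : imPt V * Y - Y * imPt V =
      (-I / 2 : ℂ) • ((V * Y - Y * V) - (star V * Y - Y * star V)) := by
    rw [imPt]
    simp only [mul_sub, sub_mul, mul_smul_comm, smul_mul_assoc]
    module
  rw [this, norm_smul]
  have := norm_sub_le_of_le hV (norm_comm_star hY hV)
  norm_num
  linarith

lemma mu_nonneg : 0 ≤ μ := (norm_nonneg _).trans h.comm

lemma norm_c_sub : ‖c - H * imPt U‖ ≤ μ := by
  have : c - H * imPt U = (-I / 2) • (U * H - H * U) := by
    conv_lhs => rw [h.c_eq]
    rw [imPt, mul_smul_comm, ← smul_sub, mul_sub]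
    congr 1; abel
  rw [this, norm_smul]
  have := h.comm
  have := h.mu_nonneg
  norm_num
  linarith

lemma rePt_comm_imPt : Commute (rePt U) (imPt U) := by
  have h1 : Commute U (star U) := by rw [Commute, SemiconjBy, h.unit_left, h.unit_right]
  have h2 : Commute (U + star U) (U - star U) :=
    ((Commute.refl U).sub_right h1).add_left (h1.symm.sub_right (Commute.refl _))
  exact (h2.smul_left _).smul_right _

lemma rePt_sq : rePt U * rePt U = 1 - imPt U * imPt U := by
  rw [rePt, imPt, smul_mul_smul_comm, smul_mul_smul_comm,
    show -I / 2 * (-I / 2) = -(1 / 2 * (1 / 2)) by linear_combination I_mul_I / 4]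
  simp only [mul_add, add_mul, mul_sub, sub_mul, h.unit_left, h.unit_right]
  module

/-- The positivity of `H` excludes vectors where `Im U` is small, `Re U` has the sign `-σ`
and `X` acts as `σ`. -/
lemma norm_le_of_interior {G : A} {σ r : ℝ} (hσ : σ = 1 ∨ σ = -1) (hG : ‖G‖ ≤ 1)
    (hS : 0 ≤ star G * (algebraMap ℝ A ((1 / 64) ^ 2) - imPt U * imPt U) * G)
    (hR : 0 ≤ star G * ((algebraMap ℝ A (1 / 2) - σ • rePt U) * (1 + σ • rePt U)) * G)
    (hX : ‖X * G - σ • G‖ ≤ r) : ‖G‖ ≤ 2 * (r + μ) := by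
  have hσ2 : σ * σ = 1 := by rcases hσ with rfl | rfl <;> norm_num
  have hσn : ‖σ‖ = 1 := by rcases hσ with rfl | rfl <;> norm_num
  set R := rePt U with hRdef
  set S := imPt U with hSdef
  have hSs : star S = S := (isSelfAdjoint_imPt U).star_eq
  have hSG : ‖S * G‖ ≤ 1 / 64 * ‖G‖ := by
    have h1 : star (S * G) * (S * G) ≤ ((1 / 64 : ℝ) ^ 2) • (star G * G) := by
      rw [← sub_nonneg]
      convert hS using 1
      rw [star_mul S G, hSs, Algebra.algebraMap_eq_smul_one]
      simp only [mul_sub, sub_mul, smul_mul_assoc, mul_smul_comm, mul_one, mul_assoc]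
    have h2 := norm_sq_le_of_star_mul_self_le h1
    rw [norm_smul, CStarRing.norm_star_mul_self] at h2
    norm_num at h2
    refine abs_le_of_sq_le_sq' (by nlinarith) (by positivity) |>.2
  have hcG : ‖c * G‖ ≤ 3 / 64 * ‖G‖ + μ := by
    have : c * G = (c - H * S) * G + H * (S * G) := by noncomm_ring
    rw [this]
    refine (norm_add_le_of_le (norm_mul_le_of_le h.norm_c_sub hG)
      (norm_mul_le_of_le h.norm_H hSG)).trans (by linarith)
  set E := X * G - σ • G with hE
  set Z := -(I • (σ • (star G * S * G))) + star G * star U * (E + I • (c * G)) with hZ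
  have hHG : star G * H * G = σ • (star G * R * G) + Z := by
    have h1 : H * G = star U * (σ • G + E + I • (c * G)) := by
      rw [hE, add_sub_cancel, ← smul_mul_assoc, ← add_mul, h.eq, ← mul_assoc, ← mul_assoc,
        h.unit_left, one_mul]
    have h2 : star U = R - I • S := by
      have := congrArg star (rePt_add_imPt U)
      rw [star_add, star_smul, (isSelfAdjoint_rePt U).star_eq, (isSelfAdjoint_imPt U).star_eq] at this
      rw [← this, hRdef, hSdef]
      simp [sub_eq_add_neg]
    rw [mul_assoc, h1, add_assoc, mul_add, mul_add, hZ, ← mul_assoc _ (star U) (E + _), ← add_assoc]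
    congr 1
    rw [h2]
    simp only [mul_sub, sub_mul, smul_mul_assoc, mul_smul_comm, mul_assoc]
    rw [smul_sub, sub_eq_add_neg, smul_comm σ I]
  have hpos : 0 ≤ σ • (star G * R * G) + Z := hHG ▸ star_left_conjugate_nonneg h.nonneg G
  have hRG : 0 ≤ -(σ • (star G * R * G)) - (1 - 2 * (1 / 64) ^ 2 : ℝ) • (star G * G) := by
    have := add_nonneg (smul_nonneg (show (0 : ℝ) ≤ 2 by norm_num) hR)
      (smul_nonneg (show (0 : ℝ) ≤ 2 by norm_num) hS)
    convert this using 1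
    have h1 : (algebraMap ℝ A (1 / 2) - σ • R) * (1 + σ • R) =
        -((1 / 2 : ℝ) • 1) - (1 / 2 * σ) • R + S * S := by
      rw [Algebra.algebraMap_eq_smul_one]
      rw [mul_add, mul_one, sub_mul, smul_mul_smul_comm, smul_mul_smul_comm, hσ2, one_smul, hRdef, h.rePt_sq, ← hRdef,
        ← hSdef, one_mul]
      module
    rw [h1, Algebra.algebraMap_eq_smul_one]
    simp only [mul_sub, sub_mul, mul_add, add_mul, smul_mul_assoc, mul_smul_comm, mul_one, mul_neg,
      neg_mul]
    module
  have hfin : star G * G ≤ ((1 - 2 * (1 / 64) ^ 2 : ℝ)⁻¹) • Z := by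
    have h1 := add_nonneg hpos hRG
    have h2 := smul_nonneg (show (0 : ℝ) ≤ (1 - 2 * (1 / 64) ^ 2)⁻¹ by norm_num) h1
    rw [← sub_nonneg]
    convert h2 using 1
    rw [← add_sub_assoc, add_neg_cancel_comm, smul_sub, smul_smul, inv_mul_cancel₀ (by norm_num),
      one_smul]
  have hn := norm_sq_le_of_star_mul_self_le hfin
  have hZn : ‖Z‖ ≤ ‖G‖ * (1 / 64 * ‖G‖) + ‖G‖ * 1 * (r + (3 / 64 * ‖G‖ + μ)) := by
    refine norm_add_le_of_le ?_ (norm_mul_le_of_le (norm_mul_le_of_le (norm_star G).le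
      ((norm_star U).le.trans h.norm_U)) (norm_add_le_of_le hX ?_))
    · rw [norm_neg, norm_smul, norm_smul, hσn, norm_I, one_mul, one_mul, mul_assoc]
      exact norm_mul_le_of_le (norm_star G).le hSG
    · rw [norm_smul, norm_I, one_mul]; exact hcG
  rw [norm_smul] at hn
  norm_num at hn
  by_contra! hcon
  have hr : 0 ≤ r := (norm_nonneg _).trans hX
  have := h.mu_nonneg
  have hg : 0 < ‖G‖ := by linarith
  nlinarith

end Frame
end Frame

section Gluing

variable {A : Type*} [CStarAlgebra A]

/-- Two orthogonal approximately central cutoffs `ηp`, `ηm`, together with an element `O`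
localised (through `χm`, `χp`) where the cutoffs are one. -/
structure Gluing (X O ηp ηm χp χm : A) (q : ℝ) : Prop where
  saX : IsSelfAdjoint X
  sap : IsSelfAdjoint ηp
  sam : IsSelfAdjoint ηm
  sacp : IsSelfAdjoint χp
  sacm : IsSelfAdjoint χm
  norm_p : ‖ηp‖ ≤ 1
  norm_m : ‖ηm‖ ≤ 1
  norm_O : ‖O‖ ≤ 2
  norm_sum : ‖ηp + ηm‖ ≤ 1
  orth : ηp * ηm = 0
  O_left : χm * O = O
  O_right : O * χp = O
  comm_p : ‖ηp * X - X * ηp‖ ≤ q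
  comm_m : ‖ηm * X - X * ηm‖ ≤ q
  loc_p : ‖(1 - ηp) * χp‖ ≤ q
  loc_m : ‖(1 - ηm) * χm‖ ≤ q

/-- The glued operator on the region where one of the cutoffs is supported. -/
def glue (X O ηp ηm : A) : A :=
  ηp * X * ηp + ηm * X * ηm + (ηm * O * ηp + ηp * star O * ηm)

namespace Gluing

variable {X O ηp ηm χp χm : A} {q : ℝ} (h : Gluing X O ηp ηm χp χm q)
include h

lemma orth' : ηm * ηp = 0 := by
  simpa [h.sap.star_eq, h.sam.star_eq] using congrArg star h.orth

omit h in
lemma norm_one_le : ‖(1 : A)‖ ≤ 1 := norm_le_one_of_star_mul_self (by simp)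

omit h in
lemma norm_one_sub_le {η : A} (hη : ‖η‖ ≤ 1) : ‖1 - η‖ ≤ 2 :=
  (norm_sub_le_of_le norm_one_le hη).trans (by norm_num)

omit h in
lemma norm_mul_comm_le {x y : A} {r : ℝ} (hx : IsSelfAdjoint x) (hy : IsSelfAdjoint y)
    (hxy : ‖x * y‖ ≤ r) : ‖y * x‖ ≤ r := by
  rw [← norm_star, star_mul, hx.star_eq, hy.star_eq]
  exact hxy

lemma one_sub_sum : 1 - (ηp + ηm) = (1 - ηp) * (1 - ηm) := by
  have := h.orth
  simp only [mul_sub, sub_mul, one_mul, mul_one, this]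
  abel

lemma sum_left : ‖(1 - (ηp + ηm)) * O‖ ≤ 4 * q := by
  rw [← h.O_left, h.one_sub_sum,
    show (1 - ηp) * (1 - ηm) * (χm * O) = (1 - ηp) * ((1 - ηm) * χm) * O by noncomm_ring]
  exact (norm_mul_le_of_le (norm_mul_le_of_le (norm_one_sub_le h.norm_p) h.loc_m) h.norm_O).trans
    (by linarith)

lemma sum_right : ‖O * (1 - (ηp + ηm))‖ ≤ 4 * q := by
  rw [← h.O_right, h.one_sub_sum,
    show O * χp * ((1 - ηp) * (1 - ηm)) = O * (χp * (1 - ηp)) * (1 - ηm) by noncomm_ring]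
  exact (norm_mul_le_of_le (norm_mul_le_of_le h.norm_O
    (norm_mul_comm_le ((IsSelfAdjoint.one A).sub h.sap) h.sacp h.loc_p))
    (norm_one_sub_le h.norm_m)).trans (by linarith)

lemma left_p : ‖ηp * O‖ ≤ 2 * q := by
  have : ηp * O = ηp * ((1 - ηm) * χm) * O := by
    rw [mul_assoc, mul_assoc, h.O_left, ← mul_assoc, mul_sub, mul_one, h.orth, sub_zero]
  rw [this]
  exact (norm_mul_le_of_le (norm_mul_le_of_le h.norm_p h.loc_m) h.norm_O).trans (by linarith)

lemma right_m : ‖O * ηm‖ ≤ 2 * q := by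
  have : O * ηm = O * (χp * (1 - ηp)) * ηm := by
    rw [← mul_assoc, h.O_right, mul_assoc, sub_mul, one_mul, h.orth, sub_zero]
  rw [this]
  exact (norm_mul_le_of_le (norm_mul_le_of_le h.norm_O
    (norm_mul_comm_le ((IsSelfAdjoint.one A).sub h.sap) h.sacp h.loc_p)) h.norm_m).trans
    (by linarith)

lemma sa_sum : IsSelfAdjoint (ηp + ηm) := h.sap.add h.sam

lemma star_glue : IsSelfAdjoint (glue X O ηp ηm) := by
  rw [isSelfAdjoint_iff, glue]
  simp only [star_add, star_mul, h.sap.star_eq, h.sam.star_eq, h.saX.star_eq, star_star, mul_assoc]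
  abel

lemma comm_sum_O : ‖O * (ηp + ηm) - (ηp + ηm) * O‖ ≤ 8 * q := by
  rw [show O * (ηp + ηm) - (ηp + ηm) * O = (1 - (ηp + ηm)) * O - O * (1 - (ηp + ηm)) by
    noncomm_ring]
  exact (norm_sub_le_of_le h.sum_left h.sum_right).trans (by linarith)

lemma comm_sum_X : ‖(ηp + ηm) * X - X * (ηp + ηm)‖ ≤ 2 * q := by
  rw [show (ηp + ηm) * X - X * (ηp + ηm) = (ηp * X - X * ηp) + (ηm * X - X * ηm) by noncomm_ring]
  exact (norm_add_le_of_le h.comm_p h.comm_m).trans (by linarith)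

lemma comm_sum_W :
    ‖(X + O + star O) * (ηp + ηm) - (ηp + ηm) * (X + O + star O)‖ ≤ 18 * q := by
  have h1 := h.comm_sum_O
  have h2 := h.comm_sum_X
  have h3 : ‖star O * (ηp + ηm) - (ηp + ηm) * star O‖ ≤ 8 * q := by
    rw [← norm_star, star_sub, star_mul, star_mul, star_star, h.sa_sum.star_eq, norm_sub_rev]
    exact h1
  rw [norm_sub_rev] at h2
  rw [show (X + O + star O) * (ηp + ηm) - (ηp + ηm) * (X + O + star O) =
    (X * (ηp + ηm) - (ηp + ηm) * X) + (O * (ηp + ηm) - (ηp + ηm) * O) +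
    (star O * (ηp + ηm) - (ηp + ηm) * star O) by noncomm_ring]
  exact (norm_add_le_of_le (norm_add_le_of_le h2 h1) h3).trans (by linarith)

lemma norm_glue_sub :
    ‖(ηp + ηm) * (X + O + star O) * (ηp + ηm) - glue X O ηp ηm‖ ≤ 10 * q := by
  have e1 : ‖ηp * X * ηm‖ ≤ q := by
    rw [show ηp * X * ηm = (ηp * X - X * ηp) * ηm by
      rw [sub_mul, mul_assoc X, h.orth, mul_zero, sub_zero]]
    exact (norm_mul_le_of_le h.comm_p h.norm_m).trans (by linarith)
  have e2 : ‖ηm * X * ηp‖ ≤ q := by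
    rw [show ηm * X * ηp = (ηm * X - X * ηm) * ηp by
      rw [sub_mul, mul_assoc X, h.orth', mul_zero, sub_zero]]
    exact (norm_mul_le_of_le h.comm_m h.norm_p).trans (by linarith)
  have e3 : ‖ηp * O * (ηp + ηm) + ηm * (O * ηm)‖ ≤ 4 * q :=
    (norm_add_le_of_le (norm_mul_le_of_le h.left_p h.norm_sum)
      (norm_mul_le_of_le h.norm_m h.right_m)).trans (by linarith)
  have e4 : ‖star (ηp * O * (ηp + ηm) + ηm * (O * ηm))‖ ≤ 4 * q := (norm_star _).le.trans e3
  have : (ηp + ηm) * (X + O + star O) * (ηp + ηm) - glue X O ηp ηm =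
      ηp * X * ηm + ηm * X * ηp + (ηp * O * (ηp + ηm) + ηm * (O * ηm)) +
      star (ηp * O * (ηp + ηm) + ηm * (O * ηm)) := by
    simp only [star_add, star_mul, h.sap.star_eq, h.sam.star_eq, glue]
    noncomm_ring
  rw [this]
  exact (norm_add_le_of_le (norm_add_le_of_le (norm_add_le_of_le e1 e2) e3) e4).trans
    (by linarith)

/-- Approximate eigenvectors of `X + O + O*` are approximate eigenvectors of the glued operator,
up to the part in the complementary region. -/
lemma norm_glue_eigen {e : A} {σ ε : ℝ} (he : ‖e‖ ≤ 1)
    (hW : ‖(X + O + star O) * e - σ • e‖ ≤ ε) :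
    ‖glue X O ηp ηm * e - σ • ((ηp + ηm) * (ηp + ηm) * e)‖ ≤ 28 * q + ε := by
  set ζ := ηp + ηm
  set W := X + O + star O
  have : glue X O ηp ηm * e - σ • (ζ * ζ * e) = -((ζ * W * ζ - glue X O ηp ηm) * e) +
      ζ * ((W * ζ - ζ * W) * e) + ζ * (ζ * (W * e - σ • e)) := by
    simp only [mul_sub, sub_mul, mul_smul_comm, mul_assoc]
    abel
  rw [this]
  have h1 := norm_mul_le_of_le h.norm_glue_sub he
  rw [← norm_neg] at h1
  exact (norm_add_le_of_le (norm_add_le_of_le h1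
    (norm_mul_le_of_le h.norm_sum (norm_mul_le_of_le h.comm_sum_W he)))
    (norm_mul_le_of_le h.norm_sum (norm_mul_le_of_le h.norm_sum hW))).trans (by linarith)

/-- In the complementary region approximate eigenvectors of `X + O + O*` restrict to approximate
eigenvectors of `X`. -/
lemma norm_interior {κ e : A} {σ ε : ℝ} (hσ : ‖κ‖ ≤ 1)
    (hτ : ‖1 - (ηp + ηm) * (ηp + ηm)‖ ≤ 1) (hcomm : ‖κ * X - X * κ‖ ≤ q)
    (hκτ : Commute κ (ηp + ηm)) (he : ‖e‖ ≤ 1) (hW : ‖(X + O + star O) * e - σ • e‖ ≤ ε) :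
    ‖X * ((1 - (ηp + ηm) * (ηp + ηm)) * κ * e) -
      σ • ((1 - (ηp + ηm) * (ηp + ηm)) * κ * e)‖ ≤ ε + 21 * q := by
  have hO := h.sum_left
  have hO' : ‖(1 - (ηp + ηm)) * star O‖ ≤ 4 * q := by
    rw [← norm_star, star_mul, star_star, star_sub, star_one, h.sa_sum.star_eq]
    exact h.sum_right
  have hX := h.comm_sum_X
  have hz := h.norm_sum
  set ζ := ηp + ηm
  set W := X + O + star O
  set F := (1 - ζ * ζ) * κ
  have hF : F = κ * (1 + ζ) * (1 - ζ) := by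
    have : (1 - ζ * ζ) * κ = κ * (1 - ζ * ζ) :=
      (((Commute.one_right κ).sub_right (hκτ.mul_right hκτ)).eq).symm
    rw [show F = κ * (1 - ζ * ζ) from this]; noncomm_ring
  have h2 : ‖κ * (1 + ζ)‖ ≤ 2 :=
    (norm_mul_le_of_le hσ (norm_add_le_of_le norm_one_le hz)).trans (by norm_num)
  have h3 : ‖F * O‖ ≤ 8 * q := by
    rw [hF, mul_assoc]; exact (norm_mul_le_of_le h2 hO).trans (by linarith)
  have h4 : ‖F * star O‖ ≤ 8 * q := by
    rw [hF, mul_assoc]; exact (norm_mul_le_of_le h2 hO').trans (by linarith)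
  have h5 : ‖F * X - X * F‖ ≤ 5 * q := by
    rw [show F * X - X * F = (1 - ζ * ζ) * (κ * X - X * κ) -
      (ζ * (ζ * X - X * ζ) + (ζ * X - X * ζ) * ζ) * κ by simp only [F]; noncomm_ring]
    exact (norm_sub_le_of_le (norm_mul_le_of_le hτ hcomm) (norm_mul_le_of_le (norm_add_le_of_le
      (norm_mul_le_of_le hz hX) (norm_mul_le_of_le hX hz)) hσ)).trans (by linarith)
  have h6 : ‖F‖ ≤ 1 := (norm_mul_le_of_le hτ hσ).trans (by norm_num)
  have : X * (F * e) - σ • (F * e) = F * (W * e - σ • e) - F * O * e - F * star O * e -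
      (F * X - X * F) * e := by
    simp only [W, mul_sub, sub_mul, mul_add, add_mul, mul_smul_comm, mul_assoc]
    abel
  rw [this]
  exact (norm_sub_le_of_le (norm_sub_le_of_le (norm_sub_le_of_le (norm_mul_le_of_le h6 hW)
    (norm_mul_le_of_le h3 he)) (norm_mul_le_of_le h4 he)) (norm_mul_le_of_le h5 he)).trans
    (by linarith)

end Gluing
end Gluing

section Stair
open Real
open scoped ContDiff
set_option linter.unusedSectionVars false

lemma stepFn_mul_stepFn_neg (x : ℝ) : stepFn x * stepFn (-x) = 0 := by
  rcases le_total x 0 with hx | hx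
  · rw [stepFn_eq_zero (by linarith), zero_mul]
  · rw [stepFn_eq_zero (x := -x) (by linarith), mul_zero]

/-- The sum of the two cutoff functions on the positive and negative axes. -/
def twoStep (x : ℝ) : ℝ := stepFn x + stepFn (-x)

lemma twoStep_nonneg (x : ℝ) : 0 ≤ twoStep x := add_nonneg (stepFn_nonneg _) (stepFn_nonneg _)

lemma twoStep_le_one (x : ℝ) : twoStep x ≤ 1 := by
  have h0 := stepFn_mul_stepFn_neg x
  rcases mul_eq_zero.1 h0 with h | h <;> rw [twoStep, h]
  · simpa using stepFn_le_one (-x)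
  · simpa using stepFn_le_one x

lemma continuous_twoStep : Continuous twoStep := by unfold twoStep; fun_prop

lemma twoStep_interior_nonneg (x : ℝ) :
    0 ≤ (1 - twoStep x * twoStep x) * ((1 / 64) ^ 2 - x * x) * (1 - twoStep x * twoStep x) := by
  by_cases hx : |x| ≤ 1 / 64
  · have : 0 ≤ (1 / 64) ^ 2 - x * x := by nlinarith [sq_abs x, abs_nonneg x]
    rw [mul_right_comm]
    exact mul_nonneg (mul_self_nonneg _) this
  · have h1 : twoStep x = 1 := by
      rcases lt_abs.1 (not_le.1 hx) with h | h
      · rw [twoStep, stepFn_eq_one h.le, stepFn_eq_zero (by linarith), add_zero]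
      · rw [twoStep, stepFn_eq_one (x := -x) h.le, stepFn_eq_zero (by linarith), zero_add]
    simp [h1]

/-- A smooth sign function. -/
def sgnFn (x : ℝ) : ℝ := 2 * smoothTransition (x + 1 / 2) - 1

lemma contDiff_sgnFn : ContDiff ℝ ∞ sgnFn := by
  unfold sgnFn
  exact (contDiff_const.mul (smoothTransition.contDiff.comp (contDiff_id.add contDiff_const))).sub
    contDiff_const

@[fun_prop]
lemma continuous_sgnFn : Continuous sgnFn := contDiff_sgnFn.continuous

lemma norm_half_one_sub_sgnFn_le {σ : ℝ} (hσ : σ = 1 ∨ σ = -1) (x : ℝ) :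
    ‖(1 - σ * sgnFn x) / 2‖ ≤ 1 := by
  have h1 := smoothTransition.le_one (x + 1 / 2)
  have h2 := smoothTransition.nonneg (x + 1 / 2)
  rw [Real.norm_eq_abs, abs_le, sgnFn]
  rcases hσ with rfl | rfl <;> constructor <;> linarith

lemma sgnFn_interior_nonneg {σ x : ℝ} (hσ : σ = 1 ∨ σ = -1) (hx : |x| ≤ 1) :
    0 ≤ (1 - σ * sgnFn x) / 2 * ((1 / 2 - σ * x) * (1 + σ * x)) * ((1 - σ * sgnFn x) / 2) := by
  obtain ⟨h1, h2⟩ := abs_le.1 hx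
  rw [mul_right_comm]
  by_cases h : σ * x ≤ 1 / 2
  · refine mul_nonneg (mul_self_nonneg _) (mul_nonneg (by linarith) ?_)
    rcases hσ with rfl | rfl <;> linarith
  · have : (1 - σ * sgnFn x) / 2 = 0 := by
      rw [sgnFn]
      rcases hσ with rfl | rfl
      · rw [smoothTransition.one_of_one_le (by linarith)]; ring
      · rw [smoothTransition.zero_of_nonpos (by linarith)]; ring
    simp [this]

/-- A function vanishing on the positive and equal to one on the negative cutoff region. -/
def sideFn (x : ℝ) : ℝ := smoothTransition (1 / 2 - 64 * x)

@[fun_prop]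
lemma continuous_sideFn : Continuous sideFn :=
  smoothTransition.continuous.comp (by fun_prop)

lemma sideFn_mul_stepFn (x : ℝ) : sideFn x * stepFn x = 0 := by
  by_cases hx : x ≤ 1 / 128
  · rw [stepFn_eq_zero hx, mul_zero]
  · rw [sideFn, smoothTransition.zero_of_nonpos (by linarith), zero_mul]

lemma sideFn_mul_stepFn_neg (x : ℝ) : sideFn x * stepFn (-x) = stepFn (-x) := by
  by_cases hx : -x ≤ 1 / 128
  · rw [stepFn_eq_zero hx, mul_zero]
  · rw [sideFn, smoothTransition.one_of_one_le (by linarith), one_mul]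

/-- The data of a staircase: a central approximate fibre `X + i c = U H` over every step, an
integer-like height `K`, and a matrix `O` moving one step up, localised near the ends of the
steps. -/
structure Stair {A : Type} [CStarAlgebra A] [PartialOrder A] [StarOrderedRing A]
    (X c U H K O χp χm dp dm : A) (μ : ℝ) : Prop extends Frame X c U H μ where
  norm_X : ‖X‖ ≤ 2
  saK : IsSelfAdjoint K
  comm_KX : Commute K X
  comm_KU : Commute K U
  shift : K * O = O * K + O
  norm_O : ‖O‖ ≤ 2
  sacp : IsSelfAdjoint χp
  sacm : IsSelfAdjoint χm
  norm_cp : ‖χp‖ ≤ 1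
  norm_cm : ‖χm‖ ≤ 1
  O_left : χm * O = O
  O_right : O * χp = O
  norm_dp : ‖dp‖ ≤ 1 / 128
  norm_dm : ‖dm‖ ≤ 1 / 128
  edge_p : (c - 1) * χp = χp * dp
  edge_m : (-c - 1) * χm = χm * dm

variable {A : Type} [CStarAlgebra A] [PartialOrder A] [StarOrderedRing A]
  {X c U H K O χp χm dp dm : A} {μ : ℝ}

lemma cfc_stepFn_neg (S : A) (hS : IsSelfAdjoint S) :
    cfc (fun x => stepFn (-x)) S = cfc stepFn (-S) := by
  rw [← cfc_comp_neg stepFn S]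

lemma cfc_twoStep (S : A) :
    cfc twoStep S = cfc stepFn S + cfc (fun x => stepFn (-x)) S := by
  rw [← cfc_add S stepFn (fun x => stepFn (-x))]
  rfl

lemma cfc_stepFn_mul_neg (S : A) :
    cfc stepFn S * cfc (fun x => stepFn (-x)) S = 0 := by
  rw [← cfc_mul stepFn (fun x => stepFn (-x)) S]
  simp only [stepFn_mul_stepFn_neg]
  exact cfc_const_zero ℝ _

lemma exists_gluing : ∃ C : ℝ, 1 ≤ C ∧
    ∀ {A : Type} [CStarAlgebra A] [PartialOrder A] [StarOrderedRing A]
      {X c U H K O χp χm dp dm : A} {μ : ℝ}, Stair X c U H K O χp χm dp dm μ →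
      Gluing X O (cfc stepFn (imPt U)) (cfc (fun x => stepFn (-x)) (imPt U)) χp χm (C * μ) ∧
      ‖cfc sgnFn (rePt U) * X - X * cfc sgnFn (rePt U)‖ ≤ C * μ := by
  obtain ⟨C1, hC1, h1⟩ := exists_norm_comm_cfc_le contDiff_stepFn 1
  obtain ⟨C2, hC2, h2⟩ := exists_norm_comm_cfc_le contDiff_sgnFn 1
  obtain ⟨C3, hC3, h3⟩ := exists_norm_one_sub_stepFn_mul_le
  refine ⟨1 + C1 + C2 + C3, by linarith, fun {A} _ _ _ X c U H K O χp χm dp dm μ h => ?_⟩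
  have hμ := h.mu_nonneg
  have hS : IsSelfAdjoint (imPt U) := isSelfAdjoint_imPt U
  have hS1 : ‖imPt U‖ ≤ 1 := norm_imPt_le h.norm_U
  have hSX : ‖imPt U * X - X * imPt U‖ ≤ μ := Frame.norm_comm_imPt h.saX h.norm_comm_U_X
  have hSc : ‖imPt U * c - c * imPt U‖ ≤ μ := Frame.norm_comm_imPt h.sac h.norm_comm_U_c
  have hRX : ‖rePt U * X - X * rePt U‖ ≤ μ := Frame.norm_comm_rePt h.saX h.norm_comm_U_X
  have hneg : cfc (fun x => stepFn (-x)) (imPt U) = cfc stepFn (-imPt U) := cfc_stepFn_neg _ hS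
  have hb : ∀ x, ‖stepFn x‖ ≤ 1 := fun x => by
    rw [Real.norm_eq_abs, abs_of_nonneg (stepFn_nonneg x)]; exact stepFn_le_one x
  have hle : ∀ {D a : ℝ}, D ≤ 1 + C1 + C2 + C3 → a ≤ D * μ → a ≤ (1 + C1 + C2 + C3) * μ :=
    fun h1 h2 => h2.trans (mul_le_mul_of_nonneg_right h1 hμ)
  refine ⟨{ saX := h.saX, sap := cfc_predicate _ _, sam := cfc_predicate _ _, sacp := h.sacp,
            sacm := h.sacm, norm_O := h.norm_O, O_left := h.O_left, O_right := h.O_right,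
            norm_p := norm_cfc_le zero_le_one fun x _ => hb x
            norm_m := norm_cfc_le zero_le_one fun x _ => hb (-x)
            norm_sum := ?_, orth := ?_, comm_p := ?_, comm_m := ?_, loc_p := ?_, loc_m := ?_ }, ?_⟩
  · rw [← cfc_twoStep (imPt U)]
    refine norm_cfc_le zero_le_one fun x _ => ?_
    have := twoStep_le_one x
    have := twoStep_nonneg x
    rwa [Real.norm_eq_abs, abs_of_nonneg this]
  · exact cfc_stepFn_mul_neg _
  · exact hle (by linarith) ((h1 _ _ hS hS1).trans (mul_le_mul_of_nonneg_left hSX hC1))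
  · rw [hneg]
    refine hle (D := C1) (by linarith) ((h1 (-imPt U) X hS.neg (by rwa [norm_neg])).trans
      (mul_le_mul_of_nonneg_left ?_ hC1))
    rw [← norm_neg]
    refine le_of_eq_of_le (congrArg norm ?_) hSX
    noncomm_ring
  · exact hle (by linarith) (h3 _ H c χp dp μ hS hS1 h.nonneg h.norm_H hSc h.norm_c_sub h.norm_cp
      h.norm_dp h.edge_p)
  · rw [hneg]
    refine hle (by linarith) (h3 _ H (-c) χm dm μ hS.neg (by rwa [norm_neg]) h.nonneg h.norm_H
      ?_ ?_ h.norm_cm h.norm_dm h.edge_m)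
    · refine le_of_eq_of_le (congrArg norm ?_) hSc
      noncomm_ring
    · rw [← norm_neg]
      refine le_of_eq_of_le (congrArg norm ?_) h.norm_c_sub
      noncomm_ring
  · exact hle (by linarith) ((h2 _ _ (isSelfAdjoint_rePt U) (norm_rePt_le h.norm_U)).trans
      (mul_le_mul_of_nonneg_left hRX hC2))

/-- The glued operator of a staircase. -/
def stairOp (X O U : A) : A :=
  (1 - cfc twoStep (imPt U) * cfc twoStep (imPt U)) * cfc sgnFn (rePt U) +
    glue X O (cfc stepFn (imPt U)) (cfc (fun x => stepFn (-x)) (imPt U))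

namespace Stair

variable (h : Stair X c U H K O χp χm dp dm μ)
include h

lemma commute_cfc_re_im (f g : ℝ → ℝ) : Commute (cfc f (rePt U)) (cfc g (imPt U)) :=
  (Commute.cfc_real (Commute.cfc_real h.rePt_comm_imPt f).symm g).symm

lemma comm_K_star : Commute K (star U) := by
  have := h.comm_KU.star_star
  rwa [h.saK.star_eq] at this

lemma comm_K_re (f : ℝ → ℝ) : Commute K (cfc f (rePt U)) :=
  (Commute.cfc_real (((h.comm_KU.add_right h.comm_K_star).smul_right _).symm) f).symm

lemma comm_K_im (f : ℝ → ℝ) : Commute K (cfc f (imPt U)) :=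
  (Commute.cfc_real (((h.comm_KU.sub_right h.comm_K_star).smul_right _).symm) f).symm

lemma isSelfAdjoint_stairOp : IsSelfAdjoint (stairOp X O U) := by
  have h1 : IsSelfAdjoint (1 - cfc twoStep (imPt U) * cfc twoStep (imPt U)) :=
    (IsSelfAdjoint.one A).sub ((IsSelfAdjoint.commute_iff (cfc_predicate twoStep _)
      (cfc_predicate twoStep _)).1 (Commute.refl _))
  have h2 : IsSelfAdjoint (cfc sgnFn (rePt U)) := cfc_predicate _ _
  refine IsSelfAdjoint.add ?_ ?_
  · exact (h1.commute_iff h2).1 ((Commute.one_left _).sub_left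
      ((h.commute_cfc_re_im _ _).symm.mul_left (h.commute_cfc_re_im _ _).symm))
  · obtain ⟨C, -, hC⟩ := exists_gluing
    exact (hC h).1.star_glue

lemma commute_stairOp : Commute (K - cfc sideFn (imPt U)) (stairOp X O U) := by
  have hS := isSelfAdjoint_imPt U
  have hp : cfc sideFn (imPt U) * cfc stepFn (imPt U) = 0 := by
    rw [← cfc_mul _ _ (imPt U)]
    simp only [sideFn_mul_stepFn]
    exact cfc_const_zero ℝ _
  have hm : cfc sideFn (imPt U) * cfc (fun x => stepFn (-x)) (imPt U) =
      cfc (fun x => stepFn (-x)) (imPt U) := by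
    rw [← cfc_mul _ _ (imPt U)]
    simp only [sideFn_mul_stepFn_neg]
  have hp' : cfc stepFn (imPt U) * cfc sideFn (imPt U) = 0 := by
    rw [(cfc_commute_cfc stepFn sideFn _).eq, hp]
  have hm' : cfc (fun x => stepFn (-x)) (imPt U) * cfc sideFn (imPt U) =
      cfc (fun x => stepFn (-x)) (imPt U) := by
    rw [(cfc_commute_cfc (fun x => stepFn (-x)) sideFn _).eq, hm]
  have hKp := (h.comm_K_im stepFn).eq
  have hKm := (h.comm_K_im (fun x => stepFn (-x))).eq
  have hKX := h.comm_KX.eq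
  have hsh := h.shift
  have hsh' : star O * K = K * star O + star O := by
    have := congrArg star hsh
    simpa [h.saK.star_eq] using this
  rw [stairOp]
  refine Commute.add_right (Commute.sub_left ?_ ?_) ?_
  · exact ((Commute.one_right _).sub_right ((h.comm_K_im _).mul_right (h.comm_K_im _))).mul_right
      (h.comm_K_re _)
  · exact ((Commute.one_right _).sub_right ((cfc_commute_cfc _ _ _).mul_right
      (cfc_commute_cfc _ _ _))).mul_right (h.commute_cfc_re_im _ _).symm
  rw [glue]
  generalize cfc stepFn (imPt U) = p at *
  generalize cfc (fun x => stepFn (-x)) (imPt U) = m at *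
  generalize cfc sideFn (imPt U) = s at *
  have e1 : (K - s) * (p * X * p) = p * X * p * (K - s) := by
    have : K * (p * X * p) = p * X * p * K := by
      rw [← mul_assoc, ← mul_assoc, hKp, mul_assoc p, hKX, ← mul_assoc, mul_assoc _ K, hKp,
        ← mul_assoc]
    rw [sub_mul, mul_sub, this, ← mul_assoc s, ← mul_assoc s, hp, mul_assoc _ p s, hp']
    simp
  have e2 : (K - s) * (m * X * m) = m * X * m * (K - s) := by
    have : K * (m * X * m) = m * X * m * K := by
      rw [← mul_assoc, ← mul_assoc, hKm, mul_assoc m, hKX, ← mul_assoc, mul_assoc _ K, hKm,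
        ← mul_assoc]
    rw [sub_mul, mul_sub, this, ← mul_assoc s, ← mul_assoc s, hm, mul_assoc _ m s, hm']
  have e3 : (K - s) * (m * O * p) = m * O * p * (K - s) := by
    have : K * (m * O * p) = m * O * p * K + m * O * p := by
      rw [← mul_assoc, ← mul_assoc, hKm, mul_assoc m, hsh, mul_add, add_mul, ← mul_assoc,
        mul_assoc _ K, hKp, ← mul_assoc]
    rw [sub_mul, mul_sub, this, ← mul_assoc s, ← mul_assoc s, hm, mul_assoc _ p s, hp']
    simp
  have e4 : (K - s) * (p * star O * m) = p * star O * m * (K - s) := by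
    have : p * star O * m * K = K * (p * star O * m) + p * star O * m := by
      rw [mul_assoc, ← hKm, ← mul_assoc, mul_assoc p, hsh', mul_add, add_mul, ← mul_assoc p,
        ← hKp]
      simp only [mul_assoc]
    rw [sub_mul, mul_sub, this, ← mul_assoc s, ← mul_assoc s, hp, mul_assoc _ m s, hm']
    simp
  simp only [Commute, SemiconjBy, mul_add, add_mul, e1, e2, e3, e4]

end Stair

theorem exists_stair_bound : ∃ C : ℝ, 0 ≤ C ∧
    ∀ {A : Type} [CStarAlgebra A] [PartialOrder A] [StarOrderedRing A]
      {X c U H K O χp χm dp dm : A} {μ : ℝ}, Stair X c U H K O χp χm dp dm μ →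
      ∀ {e : A} {σ ε : ℝ}, σ = 1 ∨ σ = -1 → ‖e‖ ≤ 1 → ‖(X + O + star O) * e - σ • e‖ ≤ ε →
      ‖stairOp X O U * e - σ • e‖ ≤ C * (μ + ε) := by
  obtain ⟨C, hC1, hC⟩ := exists_gluing
  refine ⟨4 + 112 * C + 9, by linarith,
    fun {A} _ _ _ X c U H K O χp χm dp dm μ h e σ ε hσ he hW => ?_⟩
  obtain ⟨hg, hk⟩ := hC h
  have hμ := h.mu_nonneg
  have hε : 0 ≤ ε := (norm_nonneg _).trans hW
  have hσn : ‖σ‖ = 1 := by rcases hσ with rfl | rfl <;> norm_num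
  have hσ2 : σ * σ = 1 := by rcases hσ with rfl | rfl <;> norm_num
  have hS := isSelfAdjoint_imPt U
  have hR := isSelfAdjoint_rePt U
  have htw := continuous_twoStep
  set κf : ℝ → ℝ := fun x => (1 - σ * sgnFn x) / 2 with hκf
  set κ : A := cfc κf (rePt U) with hκ
  have hκc : Continuous κf := by fun_prop
  have hκs : star κ = κ := (cfc_predicate κf (rePt U)).star_eq
  have hκe : κ = (1 / 2 : ℝ) • (1 - σ • cfc sgnFn (rePt U)) := by
    rw [hκ, hκf, ← cfc_smul σ sgnFn (rePt U), ← cfc_const_one ℝ (rePt U),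
      ← cfc_sub (fun _ => (1 : ℝ)) _ (rePt U), ← cfc_smul (1 / 2 : ℝ) _ (rePt U)]
    congr 1
    ext x
    simp only [smul_eq_mul]
    ring
  have hκn : ‖κ‖ ≤ 1 := norm_cfc_le zero_le_one fun x _ => norm_half_one_sub_sgnFn_le hσ x
  have hκX : ‖κ * X - X * κ‖ ≤ C * μ := by
    have : κ * X - X * κ = -((1 / 2 : ℝ) • σ • (cfc sgnFn (rePt U) * X - X * cfc sgnFn (rePt U))) := by
      rw [hκe]
      simp only [sub_mul, mul_sub, smul_mul_assoc, mul_smul_comm, one_mul, mul_one]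
      module
    rw [this, norm_neg, norm_smul, norm_smul, hσn]
    norm_num
    have : 0 ≤ C * μ := by positivity
    linarith
  set ζ : A := cfc stepFn (imPt U) + cfc (fun x => stepFn (-x)) (imPt U) with hζ
  have hζe : ζ = cfc twoStep (imPt U) := (cfc_twoStep _).symm
  have hτe : 1 - ζ * ζ = cfc (fun x => 1 - twoStep x * twoStep x) (imPt U) := by
    rw [cfc_sub _ _ (imPt U), cfc_const_one ℝ (imPt U), cfc_mul _ _ (imPt U), hζe]
  have hτn : ‖1 - ζ * ζ‖ ≤ 1 := by
    rw [hτe]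
    refine norm_cfc_le zero_le_one fun x _ => ?_
    have h1 := twoStep_nonneg x
    have h2 := twoStep_le_one x
    rw [Real.norm_eq_abs, abs_le]
    constructor <;> nlinarith
  have hτs : star (1 - ζ * ζ) = 1 - ζ * ζ := by
    rw [hτe]; exact (cfc_predicate (fun x => 1 - twoStep x * twoStep x) (imPt U)).star_eq
  have hκτ : Commute κ (1 - ζ * ζ) := by rw [hτe]; exact h.commute_cfc_re_im _ _
  have hκζ : Commute κ ζ := by rw [hζe]; exact h.commute_cfc_re_im _ _
  have hint := hg.norm_interior hκn hτn hκX hκζ he hW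
  set τ : A := 1 - ζ * ζ with hτ
  set G : A := τ * κ * e with hGdef
  have hG1 : ‖G‖ ≤ 1 := by
    simpa using norm_mul_le_of_le (norm_mul_le_of_le hτn hκn) he
  have hsG : star G = star e * (κ * τ) := by
    rw [hGdef, star_mul (τ * κ) e, star_mul τ κ, hκs, hτs]
  have hG := h.norm_le_of_interior hσ hG1 ?_ ?_ hint
  · have hge := hg.norm_glue_eigen he hW
    have key : stairOp X O U * e - σ • e = -((2 * σ) • G) +
        (glue X O (cfc stepFn (imPt U)) (cfc (fun x => stepFn (-x)) (imPt U)) * e -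
          σ • (ζ * ζ * e)) := by
      have h1 : cfc sgnFn (rePt U) = σ • (1 - (2 : ℝ) • κ) := by
        rw [hκe, smul_smul, show (2 : ℝ) * (1 / 2) = 1 by norm_num, one_smul, sub_sub_cancel,
          smul_smul, hσ2, one_smul]
      rw [stairOp, ← hζe, h1, hGdef, hτ]
      simp only [add_mul, sub_mul, mul_sub, one_mul, mul_one, mul_smul_comm, smul_mul_assoc,
        smul_sub]
      module
    rw [key]
    refine (norm_add_le _ _).trans ?_
    rw [norm_neg, norm_smul, norm_mul, hσn]
    norm_num
    have : 0 ≤ C * μ := by positivity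
    have : 0 ≤ C * ε := by positivity
    nlinarith
  · have h1 : 0 ≤ τ * (algebraMap ℝ A ((1 / 64) ^ 2) - imPt U * imPt U) * τ := by
      have : τ * (algebraMap ℝ A ((1 / 64) ^ 2) - imPt U * imPt U) * τ =
          cfc (fun x => (1 - twoStep x * twoStep x) * ((1 / 64) ^ 2 - x * x) *
            (1 - twoStep x * twoStep x)) (imPt U) := by
        rw [cfc_mul _ _ (imPt U), cfc_mul _ _ (imPt U), ← hτe, cfc_sub _ _ (imPt U),
          cfc_const _ (imPt U), cfc_mul _ _ (imPt U), cfc_id' ℝ (imPt U)]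
      rw [this]
      exact cfc_nonneg fun x _ => twoStep_interior_nonneg x
    convert star_left_conjugate_nonneg h1 (κ * e) using 1
    rw [hsG, hGdef, star_mul κ e, hκs]
    simp only [mul_assoc]
  · have h1 : 0 ≤ κ * ((algebraMap ℝ A (1 / 2) - σ • rePt U) * (1 + σ • rePt U)) * κ := by
      have : κ * ((algebraMap ℝ A (1 / 2) - σ • rePt U) * (1 + σ • rePt U)) * κ =
          cfc (fun x => κf x * ((1 / 2 - σ • x) * (1 + σ • x)) * κf x) (rePt U) := by
        rw [cfc_mul _ _ (rePt U), cfc_mul _ _ (rePt U), cfc_mul _ _ (rePt U), cfc_sub _ _ (rePt U),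
          cfc_add (rePt U) _ _, cfc_const _ (rePt U), cfc_const_one ℝ (rePt U),
          cfc_smul σ _ (rePt U), cfc_id' ℝ (rePt U)]
      rw [this]
      refine cfc_nonneg fun x hx => sgnFn_interior_nonneg hσ ?_
      exact norm_le_of_mem_spectrum (norm_rePt_le h.norm_U) hx
    convert star_left_conjugate_nonneg h1 (τ * e) using 1
    have hcomm : τ * (κ * e) = κ * (τ * e) := by rw [← mul_assoc, ← mul_assoc, hκτ.eq]
    rw [hsG, hGdef, star_mul τ e, hτs, hκτ.eq]
    simp only [mul_assoc]
    rw [hcomm]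

end Stair

section Block

variable {A : Type*} [CStarAlgebra A] [PartialOrder A] [StarOrderedRing A]

/-- A self-adjoint projection. -/
structure IsProj (p : A) : Prop where
  sa : star p = p
  idem : p * p = p

omit [PartialOrder A] [StarOrderedRing A] in
lemma IsProj.one_sub {p : A} (h : IsProj p) : IsProj (1 - p) where
  sa := by simp [h.sa]
  idem := by simp [mul_sub, sub_mul, h.idem]

lemma IsProj.nonneg {p : A} (h : IsProj p) : 0 ≤ p := by
  have := star_mul_self_nonneg p
  rwa [h.sa, h.idem] at this

lemma IsProj.le_one {p : A} (h : IsProj p) : p ≤ 1 := sub_nonneg.1 h.one_sub.nonneg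

omit [PartialOrder A] [StarOrderedRing A] in
lemma IsProj.norm_le {p : A} (h : IsProj p) : ‖p‖ ≤ 1 := by
  have := CStarRing.norm_star_mul_self (x := p)
  rw [h.sa, h.idem] at this
  nlinarith [norm_nonneg p]

omit [PartialOrder A] [StarOrderedRing A] in
lemma isProj_sum {ι : Type*} [DecidableEq ι] (s : Finset ι) {p : ι → A}
    (hp : ∀ i ∈ s, IsProj (p i)) (hpp : ∀ i ∈ s, ∀ j ∈ s, i ≠ j → p i * p j = 0) :
    IsProj (∑ i ∈ s, p i) where
  sa := by rw [star_sum]; exact Finset.sum_congr rfl fun i hi => (hp i hi).sa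
  idem := by
    rw [Finset.sum_mul_sum]
    refine Finset.sum_congr rfl fun i hi => ?_
    rw [Finset.sum_eq_single i (fun j hj hji => hpp i hi j hj hji.symm) (fun h => absurd hi h),
      (hp i hi).idem]

/-- The norm of a generalised block-diagonal element is at most the largest norm of a block. -/
lemma norm_sum_block_le {ι : Type*} [DecidableEq ι] (s : Finset ι) {p q : ι → A} {M : ι → A}
    {r : ℝ} (hr : 0 ≤ r) (hp : ∀ i ∈ s, IsProj (p i)) (hq : ∀ i ∈ s, IsProj (q i))
    (hpp : ∀ i ∈ s, ∀ j ∈ s, i ≠ j → p i * p j = 0)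
    (hqq : ∀ i ∈ s, ∀ j ∈ s, i ≠ j → q i * q j = 0)
    (hM : ∀ i ∈ s, ‖p i * M i * q i‖ ≤ r) :
    ‖∑ i ∈ s, p i * M i * q i‖ ≤ r := by
  set N : ι → A := fun i => p i * M i * q i
  have h1 : star (∑ i ∈ s, N i) * ∑ i ∈ s, N i = ∑ i ∈ s, star (N i) * N i := by
    rw [star_sum, Finset.sum_mul_sum]
    refine Finset.sum_congr rfl fun i hi => ?_
    rw [Finset.sum_eq_single i (fun j hj hji => ?_) (fun h => absurd hi h)]
    simp only [N]
    rw [star_mul, star_mul, (hp i hi).sa,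
      show star (q i) * (star (M i) * p i) * (p j * M j * q j) =
        star (q i) * star (M i) * (p i * p j) * M j * q j by simp only [mul_assoc],
      hpp i hi j hj hji.symm]
    simp
  have h2 : ∀ i ∈ s, star (N i) * N i ≤ (r ^ 2) • q i := by
    intro i hi
    have h3 : star (N i) * N i ≤ algebraMap ℝ A (r ^ 2) := by
      refine (CStarAlgebra.star_mul_le_algebraMap_norm_sq).trans ?_
      rw [← sub_nonneg, ← map_sub]
      have := hM i hi
      exact algebraMap_nonneg A (sub_nonneg.2 (pow_le_pow_left₀ (norm_nonneg _) this 2))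
    have h4 := star_left_conjugate_le_conjugate h3 (q i)
    rw [(hq i hi).sa, Algebra.algebraMap_eq_smul_one, mul_smul_comm, mul_one, smul_mul_assoc,
      (hq i hi).idem] at h4
    convert h4 using 1
    simp only [N]
    rw [star_mul, (hq i hi).sa, show q i * (q i * star (p i * M i) * (p i * M i * q i)) * q i =
      (q i * q i) * star (p i * M i) * (p i * M i) * (q i * q i) by simp only [mul_assoc],
      (hq i hi).idem]
    simp only [mul_assoc]
  have h5 : star (∑ i ∈ s, N i) * ∑ i ∈ s, N i ≤ (r ^ 2) • (1 : A) := by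
    rw [h1]
    refine (Finset.sum_le_sum h2).trans ?_
    rw [← Finset.smul_sum]
    exact smul_le_smul_of_nonneg_left (isProj_sum s hq hqq).le_one (by positivity)
  have h6 := norm_sq_le_of_star_mul_self_le h5
  rw [norm_smul] at h6
  have h7 := Gluing.norm_one_le (A := A)
  have h8 : ‖r ^ 2‖ = r ^ 2 := by rw [Real.norm_eq_abs, abs_of_nonneg (by positivity)]
  rw [h8] at h6
  refine abs_le_of_sq_le_sq' (h6.trans ?_) hr |>.2
  nlinarith [sq_nonneg r]

omit [PartialOrder A] [StarOrderedRing A] in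
/-- The projection onto the positive part of a self-adjoint element with finite spectrum, acting on
approximate eigenvectors. -/
lemma exists_positive_proj {Y : A} (hY : IsSelfAdjoint Y) (hfin : (spectrum ℝ Y).Finite) :
    ∃ P : A, IsProj P ∧ (∀ Z, Commute Y Z → Commute P Z) ∧
      (∀ e : A, ‖(1 - P) * e‖ ≤ ‖Y * e - e‖) ∧ ∀ e : A, ‖P * e‖ ≤ ‖Y * e + e‖ := by
  classical
  have hc : ∀ f : ℝ → ℝ, ContinuousOn f (spectrum ℝ Y) := fun f => hfin.continuousOn f
  set f : ℝ → ℝ := fun y => if 0 < y then 1 else 0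
  refine ⟨cfc f Y, ⟨(cfc_predicate f Y).star_eq, ?_⟩, fun Z hZ => Commute.cfc_real hZ f,
    fun e => ?_, fun e => ?_⟩
  · rw [← cfc_mul f f Y (hc _) (hc _)]
    refine cfc_congr fun y _ => ?_
    by_cases h : 0 < y <;> simp [f, h]
  · set g : ℝ → ℝ := fun y => if 0 < y then 0 else 1 / (y - 1)
    have hg : ‖cfc g Y‖ ≤ 1 := by
      refine norm_cfc_le zero_le_one fun y _ => ?_
      by_cases h : 0 < y
      · simp [g, h]
      · simp only [g, h, if_false, norm_div, norm_one]
        rw [Real.norm_eq_abs, abs_of_neg (by linarith)]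
        rw [div_le_one (by linarith)]
        linarith
    have h1 : 1 - cfc f Y = cfc g Y * (Y - 1) := by
      have : Y - 1 = cfc (fun y : ℝ => y - 1) Y := by
        rw [cfc_sub _ _ Y (hc _) (hc _), cfc_id' ℝ Y, cfc_const_one ℝ Y]
      rw [this, ← cfc_mul _ _ Y (hc _) (hc _), ← cfc_const_one ℝ Y, ← cfc_sub _ _ Y (hc _) (hc _)]
      refine cfc_congr fun y _ => ?_
      by_cases h : 0 < y
      · simp [f, g, h]
      · have : y - 1 ≠ 0 := by linarith
        simp [f, g, h, this]
    rw [h1, mul_assoc]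
    refine (norm_mul_le_of_le hg le_rfl).trans_eq ?_
    rw [one_mul, sub_mul, one_mul]
  · set g : ℝ → ℝ := fun y => if 0 < y then 1 / (y + 1) else 0
    have hg : ‖cfc g Y‖ ≤ 1 := by
      refine norm_cfc_le zero_le_one fun y _ => ?_
      by_cases h : 0 < y
      · simp only [g, h, if_true, norm_div, norm_one]
        rw [Real.norm_eq_abs, abs_of_pos (by linarith), div_le_one (by linarith)]
        linarith
      · simp [g, h]
    have h1 : cfc f Y = cfc g Y * (Y + 1) := by
      have : Y + 1 = cfc (fun y : ℝ => y + 1) Y := by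
        rw [cfc_add Y _ _ (hc _) (hc _), cfc_id' ℝ Y, cfc_const_one ℝ Y]
      rw [this, ← cfc_mul _ _ Y (hc _) (hc _)]
      refine cfc_congr fun y _ => ?_
      by_cases h : 0 < y
      · have : y + 1 ≠ 0 := by linarith
        simp [f, g, h, this]
      · simp [f, g, h]
    rw [h1, mul_assoc]
    refine (norm_mul_le_of_le hg le_rfl).trans_eq ?_
    rw [one_mul, add_mul, one_mul]

end Block

section DiagBlock
open scoped Matrix.Norms.L2Operator MatrixOrder
set_option linter.unusedSectionVars false

variable {m : Type} [Fintype m] [DecidableEq m]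

/-- The diagonal matrix with real entries. -/
def rdiag (b : m → ℝ) : Matrix m m ℂ := diagonal fun i => (b i : ℂ)

lemma rdiag_mul_apply (b : m → ℝ) (X : Matrix m m ℂ) (i j : m) :
    (rdiag b * X) i j = b i * X i j := by simp [rdiag]

lemma mul_rdiag_apply (b : m → ℝ) (X : Matrix m m ℂ) (i j : m) :
    (X * rdiag b) i j = X i j * b j := by simp [rdiag]

lemma star_rdiag (b : m → ℝ) : star (rdiag b) = rdiag b := by
  rw [rdiag, star_eq_conjTranspose, diagonal_conjTranspose]
  congr 1
  ext i
  simp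

lemma rdiag_mul_rdiag (a b : m → ℝ) : rdiag a * rdiag b = rdiag (fun i => a i * b i) := by
  simp [rdiag]

lemma norm_rdiag_le {b : m → ℝ} {r : ℝ} (hr : 0 ≤ r) (h : ∀ i, |b i| ≤ r) : ‖rdiag b‖ ≤ r := by
  rw [rdiag, l2_opNorm_diagonal, pi_norm_le_iff_of_nonneg hr]
  intro i
  rw [Complex.norm_real]
  exact h i

open Classical in
/-- The diagonal projection onto the coordinates in `s`. -/
def dproj (s : Set m) : Matrix m m ℂ := rdiag fun i => if i ∈ s then 1 else 0

lemma isProj_dproj (s : Set m) : IsProj (dproj s) where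
  sa := star_rdiag _
  idem := by
    rw [dproj, rdiag_mul_rdiag]
    congr 1; ext i
    split_ifs <;> simp

lemma dproj_mul_of_disjoint {s t : Set m} (h : ∀ i, i ∈ s → i ∉ t) : dproj s * dproj t = 0 := by
  classical
  rw [dproj, dproj, rdiag_mul_rdiag, rdiag, ← diagonal_zero]
  congr 1; ext i
  by_cases hs : i ∈ s
  · simp [h i hs]
  · simp [hs]

open Classical in
lemma dproj_mul_mul_apply (s t : Set m) (X : Matrix m m ℂ) (i j : m) :
    (dproj s * X * dproj t) i j = if i ∈ s ∧ j ∈ t then X i j else 0 := by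
  rw [dproj, dproj, mul_rdiag_apply, rdiag_mul_apply]
  by_cases hi : i ∈ s <;> by_cases hj : j ∈ t <;> simp [hi, hj]

/-- The entries of `X` which raise the level function `k` by exactly `d`. -/
def band (k : m → ℤ) (d : ℤ) (X : Matrix m m ℂ) : Matrix m m ℂ :=
  of fun i j => if k i = k j + d then X i j else 0

lemma band_apply (k : m → ℤ) (d : ℤ) (X : Matrix m m ℂ) (i j : m) :
    band k d X i j = if k i = k j + d then X i j else 0 := rfl

lemma norm_band_le (k : m → ℤ) (d : ℤ) (X : Matrix m m ℂ) : ‖band k d X‖ ≤ ‖X‖ := by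
  classical
  have h : band k d X = ∑ a ∈ Finset.univ.image k, dproj {i | k i = a + d} * X *
      dproj {j | k j = a} := by
    ext i j
    rw [Matrix.sum_apply, Finset.sum_eq_single (k j)]
    · rw [dproj_mul_mul_apply, band_apply]; simp
    · intro a _ ha
      rw [dproj_mul_mul_apply, if_neg]
      simp [ha.symm]
    · intro h
      exact absurd (Finset.mem_image_of_mem k (Finset.mem_univ j)) h
  rw [h]
  refine norm_sum_block_le _ (norm_nonneg X) (fun _ _ => isProj_dproj _) (fun _ _ => isProj_dproj _)
    ?_ ?_ fun a _ => ?_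
  · intro a _ b _ hab
    exact dproj_mul_of_disjoint fun i hi hi' => hab (by simp at hi hi'; omega)
  · intro a _ b _ hab
    exact dproj_mul_of_disjoint fun i hi hi' => hab (by simp at hi hi'; omega)
  · refine (norm_mul_le_of_le (norm_mul_le_of_le (isProj_dproj _).norm_le le_rfl)
      (isProj_dproj _).norm_le).trans_eq (by ring)

end DiagBlock

section DiagStair
open scoped Matrix.Norms.L2Operator MatrixOrder
set_option linter.unusedSectionVars false

variable {m : Type} [Fintype m] [DecidableEq m]

lemma exists_isUnit_add_smul_one (T : Matrix m m ℂ) {r : ℝ} (hr : 0 < r) :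
    ∃ s : ℝ, 0 < s ∧ s < r ∧ IsUnit (T + s • (1 : Matrix m m ℂ)) := by
  have hfin : (spectrum ℝ (-T)).Finite := Matrix.finite_real_spectrum
  obtain ⟨s, hs, hsp⟩ := (Set.Ioo_infinite hr).exists_notMem_finite hfin
  refine ⟨s, hs.1, hs.2, ?_⟩
  rw [spectrum.notMem_iff, sub_neg_eq_add, Algebra.algebraMap_eq_smul_one, add_comm] at hsp
  exact hsp

variable (b : m → ℝ) (w : ℝ)

/-- The step of the staircase of width `w`. -/
def level (i : m) : ℤ := ⌊b i / w⌋

/-- The rescaled position inside a step, between `-1` and `1`. -/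
def pos (i : m) : ℝ := 2 * (b i / w - level b w i) - 1

lemma abs_pos_le (i : m) : |pos b w i| ≤ 1 := by
  have h1 := Int.floor_le (b i / w)
  have h2 := Int.lt_floor_add_one (b i / w)
  rw [abs_le, pos, level]
  constructor <;> linarith

variable {b w}

lemma mul_level_eq (hw : 0 < w) (i : m) : b i = w * (level b w i + (pos b w i + 1) / 2) := by
  rw [pos]; field_simp; ring

variable {X : Matrix m m ℂ}

lemma apply_eq_zero_of_level (hw : 0 < w) (hband : ∀ i j, w / 256 ≤ |b i - b j| → X i j = 0) {i j : m}
    (h1 : level b w i ≠ level b w j) (h2 : level b w i ≠ level b w j + 1)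
    (h3 : level b w j ≠ level b w i + 1) : X i j = 0 := by
  refine hband i j ?_
  rw [mul_level_eq (b := b) hw i, mul_level_eq (b := b) hw j]
  obtain ⟨a1, a2⟩ := abs_le.1 (abs_pos_le b w i)
  obtain ⟨a3, a4⟩ := abs_le.1 (abs_pos_le b w j)
  rcases lt_or_gt_of_ne h1 with h | h
  · have h4 : (level b w i : ℝ) + 2 ≤ level b w j := by
      have : level b w i + 2 ≤ level b w j := by omega
      exact_mod_cast this
    rw [abs_sub_comm, le_abs]; left; nlinarith
  · have h4 : (level b w j : ℝ) + 2 ≤ level b w i := by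
      have : level b w j + 2 ≤ level b w i := by omega
      exact_mod_cast this
    rw [le_abs]; left; nlinarith

lemma pos_of_apply_ne_zero (hw : 0 < w) (hband : ∀ i j, w / 256 ≤ |b i - b j| → X i j = 0) {i j : m}
    (h : level b w i = level b w j + 1) (hX : X i j ≠ 0) :
    pos b w i ≤ -1 + 1 / 128 ∧ 1 - 1 / 128 ≤ pos b w j := by
  have h1 : |b i - b j| < w / 256 := by by_contra! h'; exact hX (hband i j h')
  have h2 : b i - b j < w * (1 / 256) := by linarith [(abs_lt.1 h1).2]
  have h3 : (level b w i : ℝ) = level b w j + 1 := by exact_mod_cast h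
  obtain ⟨a1, a2⟩ := abs_le.1 (abs_pos_le b w i)
  obtain ⟨a3, a4⟩ := abs_le.1 (abs_pos_le b w j)
  rw [mul_level_eq (b := b) hw i, mul_level_eq (b := b) hw j, h3, ← mul_sub] at h2
  have := lt_of_mul_lt_mul_left h2 hw.le
  constructor <;> linarith

lemma band_zero_add (hw : 0 < w) (hX : star X = X)
    (hband : ∀ i j, w / 256 ≤ |b i - b j| → X i j = 0) :
    band (level b w) 0 X + band (level b w) 1 X + star (band (level b w) 1 X) = X := by
  ext i j
  have hXij : star (X j i) = X i j := by
    conv_rhs => rw [← hX]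
    rfl
  simp only [Matrix.add_apply, band_apply, star_apply, add_zero]
  by_cases h1 : level b w i = level b w j
  · simp [h1]
  by_cases h2 : level b w i = level b w j + 1
  · simp only [h2, add_eq_left, one_ne_zero, if_false, if_true, zero_add]
    rw [if_neg (by omega), star_zero]
  by_cases h3 : level b w j = level b w i + 1
  · rw [if_neg h1, if_neg h2, if_pos h3, zero_add, zero_add, hXij]
  · simp [h1, h2, h3, apply_eq_zero_of_level hw hband h1 h2 h3]

lemma norm_comm_band_le (hw : 0 < w) {κ : ℝ} (hκ : ‖X * rdiag b - rdiag b * X‖ ≤ κ) :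
    ‖band (level b w) 0 X * rdiag (pos b w) - rdiag (pos b w) * band (level b w) 0 X‖ ≤
      2 / w * κ := by
  have : band (level b w) 0 X * rdiag (pos b w) - rdiag (pos b w) * band (level b w) 0 X =
      (2 / w : ℝ) • band (level b w) 0 (X * rdiag b - rdiag b * X) := by
    ext i j
    simp only [Matrix.sub_apply, mul_rdiag_apply, rdiag_mul_apply, Matrix.smul_apply, band_apply,
      add_zero]
    by_cases h : level b w i = level b w j
    · have : ((w : ℝ) : ℂ) ≠ 0 := by exact_mod_cast hw.ne'
      simp only [h, if_true, pos, Complex.real_smul]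
      push_cast
      field_simp
      ring
    · simp [h]
  rw [this, norm_smul, Real.norm_eq_abs, abs_of_pos (by positivity)]
  exact mul_le_mul_of_nonneg_left ((norm_band_le _ _ _).trans hκ) (by positivity)

open Classical in
/-- The part of the coordinate `c` in the set `s`. -/
def restrict (s : Set m) (c : m → ℝ) : m → ℝ := fun i => if i ∈ s then c i else 0

lemma stair_of_band (hw : 0 < w) (hX : star X = X) (hX1 : ‖X‖ ≤ 3 / 2)
    (hband : ∀ i j, w / 256 ≤ |b i - b j| → X i j = 0) {κ : ℝ}
    (hκ : ‖X * rdiag b - rdiag b * X‖ ≤ κ) {r : ℝ} (hr : 0 < r) :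
    ∃ (s : ℝ) (U H χp χm dp dm : Matrix m m ℂ), 0 < s ∧ s < r ∧
      Stair (band (level b w) 0 X + s • (1 : Matrix m m ℂ)) (rdiag (pos b w)) U H
        (rdiag fun i => (level b w i : ℝ)) (band (level b w) 1 X) χp χm dp dm
        (2 * √(κ / w)) := by
  classical
  have hκ0 : 0 ≤ κ := (norm_nonneg _).trans hκ
  obtain ⟨s, hs0, hsr, hu⟩ := exists_isUnit_add_smul_one
    (band (level b w) 0 X + Complex.I • rdiag (pos b w)) (lt_min hr (by norm_num : (0 : ℝ) < 1 / 2))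
  obtain ⟨hsr, hs2⟩ := lt_min_iff.1 hsr
  set Xb := band (level b w) 0 X with hXb
  set c : Matrix m m ℂ := rdiag (pos b w) with hc
  have hXbs : star Xb = Xb := by
    ext i j
    have hXij : star (X j i) = X i j := by
      conv_rhs => rw [← hX]
      rfl
    simp only [star_apply, hXb, band_apply, add_zero]
    by_cases h : level b w i = level b w j
    · simpa [h] using hXij
    · simp [h, Ne.symm h]
  have hcs : star c = c := star_rdiag _
  have hc1 : ‖c‖ ≤ 1 := norm_rdiag_le zero_le_one (abs_pos_le b w)
  set X1 := Xb + s • (1 : Matrix m m ℂ) with hX1d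
  have hX1s : star X1 = X1 := by rw [hX1d]; simp [hXbs]
  have hX1n : ‖X1‖ ≤ 2 := by
    have : ‖s • (1 : Matrix m m ℂ)‖ ≤ 1 / 2 := by
      rw [norm_smul, Real.norm_eq_abs, abs_of_pos hs0]
      exact (mul_le_mul hs2.le Gluing.norm_one_le (norm_nonneg _) (by norm_num)).trans (by norm_num)
    exact (norm_add_le_of_le ((norm_band_le _ _ _).trans hX1) this).trans (by norm_num)
  set T := X1 + Complex.I • c with hT
  have hTu : IsUnit T := by rw [hT, hX1d, add_right_comm]; exact hu
  have hTs : star T = X1 - Complex.I • c := by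
    rw [hT]; simp [hX1s, hcs, sub_eq_add_neg]
  obtain ⟨U, H, hU1, hU2, hH, -, hTUH, hcomm, hK⟩ := exists_polar hTu
  have hKX1 : Commute (rdiag fun i => (level b w i : ℝ)) X1 := by
    refine Commute.add_right ?_ ((Commute.one_right _).smul_right _)
    rw [Commute, SemiconjBy]
    ext i j
    rw [rdiag_mul_apply, mul_rdiag_apply, hXb, band_apply]
    by_cases h : level b w i = level b w j
    · simp [h, mul_comm]
    · simp [h]
  have hKc : Commute (rdiag fun i => (level b w i : ℝ)) c := by
    rw [Commute, SemiconjBy, hc, rdiag_mul_rdiag, rdiag_mul_rdiag]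
    simp only [mul_comm]
  set sp : Set m := {i | 1 - 1 / 128 ≤ pos b w i}
  set sm : Set m := {i | pos b w i ≤ -1 + 1 / 128}
  refine ⟨s, U, H, dproj sp, dproj sm, rdiag (restrict sp fun i => pos b w i - 1),
    rdiag (restrict sm fun i => -pos b w i - 1), hs0, hsr,
    { saX := hX1s, sac := hcs, unit_left := hU1, unit_right := hU2, nonneg := hH, eq := hTUH,
      norm_X := hX1n, saK := star_rdiag _, comm_KX := hKX1
      comm_KU := (hK _ (hKX1.add_right (hKc.smul_right _)).symm
        (by rw [hTs]; exact (hKX1.sub_right (hKc.smul_right _)).symm)).symm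
      norm_O := (norm_band_le _ _ _).trans (by linarith)
      sacp := (isProj_dproj _).sa, sacm := (isProj_dproj _).sa
      norm_cp := (isProj_dproj _).norm_le, norm_cm := (isProj_dproj _).norm_le
      norm_H := ?_, comm := ?_, shift := ?_, O_left := ?_, O_right := ?_, norm_dp := ?_
      norm_dm := ?_, edge_p := ?_, edge_m := ?_ }⟩
  · have : H = star U * T := by rw [hTUH, ← mul_assoc, hU1, one_mul]
    rw [this]
    have hIc : ‖Complex.I • c‖ ≤ 1 := by rwa [norm_smul, Complex.norm_I, one_mul]
    exact (norm_mul_le_of_le ((norm_star U).le.trans (norm_le_one_of_star_mul_self hU1))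
      (norm_add_le_of_le hX1n hIc)).trans (by norm_num)
  · refine abs_le_of_sq_le_sq' (hcomm.trans ?_) (by positivity) |>.2
    have : T * star T - star T * T = (-2 * Complex.I) • (Xb * c - c * Xb) := by
      rw [hTs, hT, hX1d]
      simp only [mul_add, add_mul, mul_sub, sub_mul, mul_smul_comm, smul_mul_assoc, mul_one,
        one_mul]
      module
    rw [this, norm_smul, mul_pow, Real.sq_sqrt (by positivity)]
    have := norm_comm_band_le hw hκ
    norm_num
    have h2 : 2 ^ 2 * (κ / w) = 2 * (2 / w * κ) := by ring
    linarith
  · ext i j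
    rw [Matrix.add_apply, rdiag_mul_apply, mul_rdiag_apply, band_apply]
    by_cases h : level b w i = level b w j + 1
    · simp [h]; ring
    · simp [h]
  · ext i j
    rw [dproj, rdiag_mul_apply, band_apply]
    by_cases h : level b w i = level b w j + 1 ∧ X i j ≠ 0
    · have : i ∈ sm := (pos_of_apply_ne_zero hw hband h.1 h.2).1
      simp [this]
    · rw [not_and_or, not_not] at h
      rcases h with h | h <;> simp [h]
  · ext i j
    rw [dproj, mul_rdiag_apply, band_apply]
    by_cases h : level b w i = level b w j + 1 ∧ X i j ≠ 0
    · have : j ∈ sp := (pos_of_apply_ne_zero hw hband h.1 h.2).2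
      simp [this]
    · rw [not_and_or, not_not] at h
      rcases h with h | h <;> simp [h]
  · refine norm_rdiag_le (by norm_num) fun i => ?_
    have := (abs_le.1 (abs_pos_le b w i)).2
    by_cases h : i ∈ sp
    · have h' : 1 - 1 / 128 ≤ pos b w i := h
      simp only [restrict, h, if_true, abs_le]; constructor <;> linarith
    · simp [restrict, h]
  · refine norm_rdiag_le (by norm_num) fun i => ?_
    have := (abs_le.1 (abs_pos_le b w i)).1
    by_cases h : i ∈ sm
    · have h' : pos b w i ≤ -1 + 1 / 128 := h
      simp only [restrict, h, if_true, abs_le]; constructor <;> linarith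
    · simp [restrict, h]
  · rw [sub_mul, one_mul, dproj, hc, rdiag_mul_rdiag, rdiag_mul_rdiag, sub_eq_iff_eq_add]
    ext i j
    rw [Matrix.add_apply, rdiag, rdiag, rdiag]
    by_cases hij : i = j
    · subst hij
      by_cases h : i ∈ sp <;> simp [restrict, h]
    · simp [hij]
  · rw [sub_mul, neg_mul, one_mul, dproj, hc, rdiag_mul_rdiag, rdiag_mul_rdiag, sub_eq_iff_eq_add]
    ext i j
    rw [Matrix.add_apply, Matrix.neg_apply, rdiag, rdiag, rdiag]
    by_cases hij : i = j
    · subst hij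
      by_cases h : i ∈ sm <;> simp [restrict, h]
    · simp [hij]

/-- Separating the approximate eigenspaces `1` and `-1` of a Hermitian matrix `X` by a projection
almost commuting with a diagonal matrix, when `X` has small bandwidth. -/
theorem exists_proj_of_band : ∃ C : ℝ, 1 ≤ C ∧
    ∀ {m : Type} [Fintype m] [DecidableEq m] {b : m → ℝ} {X : Matrix m m ℂ} {w κ : ℝ},
      star X = X → ‖X‖ ≤ 3 / 2 → 0 < w → 0 < κ →
      (∀ i j, w / 256 ≤ |b i - b j| → X i j = 0) → ‖X * rdiag b - rdiag b * X‖ ≤ κ →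
      ∃ P : Matrix m m ℂ, IsProj P ∧ ‖P * rdiag b - rdiag b * P‖ ≤ 3 * w ∧
        (∀ (e : Matrix m m ℂ) (ε : ℝ), ‖e‖ ≤ 1 → ‖X * e - e‖ ≤ ε →
          ‖(1 - P) * e‖ ≤ C * (√(κ / w) + ε)) ∧
        ∀ (e : Matrix m m ℂ) (ε : ℝ), ‖e‖ ≤ 1 → ‖X * e + e‖ ≤ ε →
          ‖P * e‖ ≤ C * (√(κ / w) + ε) := by
  obtain ⟨C, hC0, hC⟩ := exists_stair_bound
  refine ⟨3 * C + 1, by linarith, fun {m} _ _ {b X w κ} hX hX1 hw hκ0 hband hκ => ?_⟩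
  have hr : 0 < √(κ / w) := Real.sqrt_pos.2 (by positivity)
  obtain ⟨s, U, H, χp, χm, dp, dm, hs0, hsr, hst⟩ := stair_of_band hw hX hX1 hband hκ hr
  have hW : band (level b w) 0 X + s • (1 : Matrix m m ℂ) + band (level b w) 1 X +
      star (band (level b w) 1 X) = X + s • (1 : Matrix m m ℂ) := by
    conv_rhs => rw [← band_zero_add hw hX hband]
    abel
  set Y := stairOp (band (level b w) 0 X + s • (1 : Matrix m m ℂ)) (band (level b w) 1 X) U with hY
  have hYe : ∀ (e : Matrix m m ℂ) (σ ε : ℝ), σ = 1 ∨ σ = -1 → ‖e‖ ≤ 1 → ‖X * e - σ • e‖ ≤ ε →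
      ‖Y * e - σ • e‖ ≤ (3 * C + 1) * (√(κ / w) + ε) := by
    intro e σ ε hσ he h
    have hε : 0 ≤ ε := (norm_nonneg _).trans h
    refine (hC hst hσ he (ε := ε + s) ?_).trans ?_
    · rw [hW, add_mul, smul_mul_assoc, one_mul, add_sub_right_comm]
      refine norm_add_le_of_le h ?_
      rw [norm_smul, Real.norm_eq_abs, abs_of_pos hs0]
      nlinarith
    · have : 2 * √(κ / w) + (ε + s) ≤ 3 * (√(κ / w) + ε) := by linarith
      have := mul_le_mul_of_nonneg_left this hC0
      nlinarith
  obtain ⟨P, hP, hPc, hP1, hP2⟩ := exists_positive_proj hst.isSelfAdjoint_stairOp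
    (Matrix.finite_real_spectrum)
  refine ⟨P, hP, ?_, fun e ε he h => ?_, fun e ε he h => ?_⟩
  · set K : Matrix m m ℂ := rdiag fun i => (level b w i : ℝ)
    set ϖ := cfc sideFn (imPt U)
    have hϖ : ‖ϖ‖ ≤ 1 := norm_cfc_le zero_le_one fun x _ => by
      rw [Real.norm_eq_abs, sideFn, abs_of_nonneg (Real.smoothTransition.nonneg _)]
      exact Real.smoothTransition.le_one _
    have hb : rdiag b = w • ((K - ϖ) + (ϖ + (1 / 2 : ℝ) • rdiag (pos b w)) +
        (1 / 2 : ℝ) • (1 : Matrix m m ℂ)) := by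
      rw [← add_assoc, sub_add_cancel]
      ext i j
      by_cases hij : i = j
      · subst hij
        have := mul_level_eq (b := b) hw i
        simp only [rdiag, diagonal_apply_eq, Matrix.smul_apply, Matrix.add_apply, Matrix.one_apply_eq,
          K, Complex.real_smul]
        conv_lhs => rw [this]
        push_cast
        ring
      · simp [rdiag, K, hij]
    have hcomm := (hPc _ hst.commute_stairOp.symm).eq
    have : P * rdiag b - rdiag b * P = w • (P * (ϖ + (1 / 2 : ℝ) • rdiag (pos b w)) -
        (ϖ + (1 / 2 : ℝ) • rdiag (pos b w)) * P) := by
      rw [hb]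
      generalize K - ϖ = J at *
      generalize ϖ + (1 / 2 : ℝ) • rdiag (pos b w) = Q at *
      simp only [mul_add, add_mul, mul_smul_comm, smul_mul_assoc, mul_one, one_mul, hcomm]
      module
    have hQ : ‖ϖ + (1 / 2 : ℝ) • rdiag (pos b w)‖ ≤ 3 / 2 := by
      have hp := norm_rdiag_le zero_le_one (abs_pos_le b w)
      have : ‖(1 / 2 : ℝ) • rdiag (pos b w)‖ ≤ 1 / 2 := by
        rw [norm_smul]
        norm_num
        linarith
      exact (norm_add_le_of_le hϖ this).trans (by norm_num)
    rw [this, norm_smul, Real.norm_eq_abs, abs_of_pos hw, mul_comm 3 w]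
    refine mul_le_mul_of_nonneg_left ((norm_sub_le_of_le (norm_mul_le_of_le hP.norm_le hQ)
      (norm_mul_le_of_le hQ hP.norm_le)).trans (by norm_num)) hw.le
  · have := hYe e 1 ε (Or.inl rfl) he (by rwa [one_smul])
    rw [one_smul] at this
    exact (hP1 e).trans this
  · have := hYe e (-1) ε (Or.inr rfl) he (by rwa [neg_smul, one_smul, sub_neg_eq_add])
    rw [neg_smul, one_smul, sub_neg_eq_add] at this
    exact (hP2 e).trans this

end DiagStair

section Banding
open scoped Matrix.Norms.L2Operator MatrixOrder
open MeasureTheory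
set_option linter.unusedSectionVars false

variable {m : Type} [Fintype m] [DecidableEq m]

lemma expI_rdiag (b : m → ℝ) (t : ℝ) :
    expI (rdiag b) t = diagonal fun i => Complex.exp ((t : ℂ) * Complex.I * b i) := by
  have h : t • (Complex.I • rdiag b) = diagonal fun i => (t : ℂ) * Complex.I * b i := by
    ext i j
    by_cases hij : i = j
    · subst hij
      simp [rdiag, mul_assoc]
    · simp [rdiag, hij]
  rw [expI, h, Matrix.exp_diagonal]
  congr 1
  ext i
  rw [Pi.coe_exp, ← Complex.exp_eq_exp_ℂ]

lemma IsFourierDensity.smear_rdiag_apply {f : ℝ → ℝ} {g : ℝ → ℂ} {C : ℝ}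
    (hg : IsFourierDensity f g C) (b : m → ℝ) (K : Matrix m m ℂ) (i j : m) :
    smear g (rdiag b) K i j = f (b i - b j) * K i j := by
  have h := (LinearMap.toContinuousLinearMap (Matrix.entryLinearMap ℂ ℂ i j)).integral_comp_comm
    (hg.integrable_smear (B := rdiag b) (star_rdiag b) K)
  change _ = smear g (rdiag b) K i j at h
  rw [← h, hg.eq_integral, ← integral_mul_const]
  congr 1
  ext t
  change (g t • (expI (rdiag b) (2 * Real.pi * t) * K * expI (rdiag b) (-(2 * Real.pi * t)))) i j = _
  rw [expI_rdiag, expI_rdiag, Matrix.smul_apply, mul_diagonal, diagonal_mul, smul_eq_mul, mul_assoc (g t)]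
  have : Complex.exp (((2 * Real.pi * t : ℝ) : ℂ) * Complex.I * ((b i - b j : ℝ) : ℂ)) =
      Complex.exp (((2 * Real.pi * t : ℝ) : ℂ) * Complex.I * b i) *
      Complex.exp (((-(2 * Real.pi * t) : ℝ) : ℂ) * Complex.I * b j) := by
    rw [← Complex.exp_add]
    congr 1
    push_cast
    ring
  rw [this]
  ring

lemma norm_conj_unitary_le {V : Matrix m m ℂ} (h1 : star V * V = 1) (Y : Matrix m m ℂ) :
    ‖V * Y * star V‖ ≤ ‖Y‖ := by
  have hV := norm_le_one_of_star_mul_self h1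
  refine (norm_mul_le_of_le (norm_mul_le_of_le hV le_rfl) ((norm_star V).le.trans hV)).trans ?_
  simp

lemma exists_diagonalize {B : Matrix m m ℂ} (hB : star B = B) :
    ∃ (V : Matrix m m ℂ) (b : m → ℝ), star V * V = 1 ∧ V * star V = 1 ∧
      B = V * rdiag b * star V := by
  have hA : B.IsHermitian := hB
  refine ⟨hA.eigenvectorUnitary, hA.eigenvalues, Unitary.coe_star_mul_self _,
    Unitary.coe_mul_star_self _, ?_⟩
  conv_lhs => rw [hA.spectral_theorem]
  rfl

theorem exists_banded : ∃ C : ℝ, 1 ≤ C ∧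
    ∀ {m : Type} [Fintype m] [DecidableEq m] (b : m → ℝ) {K : Matrix m m ℂ} {r : ℝ},
      star K = K → 0 < r → ∃ K' : Matrix m m ℂ, star K' = K' ∧
        ‖K' - K‖ ≤ C / r * ‖K * rdiag b - rdiag b * K‖ ∧
        ‖K' * rdiag b - rdiag b * K'‖ ≤ C * ‖K * rdiag b - rdiag b * K‖ ∧
        ‖K'‖ ≤ C * ‖K‖ ∧ ∀ i j, r ≤ |b i - b j| → K' i j = 0 := by
  obtain ⟨g, C, hg⟩ := exists_fourierDensity (contDiff_cutoff 0) (hasCompactSupport_cutoff 0)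
  set I := ∫ t, ‖g t‖
  refine ⟨max 1 (max C I), le_max_left _ _, fun {m} _ _ b K r hK hr => ?_⟩
  have hCm : C ≤ max 1 (max C I) := (le_max_left _ _).trans (le_max_right _ _)
  have hIm : I ≤ max 1 (max C I) := (le_max_right _ _).trans (le_max_right _ _)
  generalize max 1 (max C I) = C' at *
  have hb : rdiag b = r • rdiag fun i => b i / r := by
    ext i j
    by_cases hij : i = j
    · subst hij
      have : (r : ℂ) ≠ 0 := by exact_mod_cast hr.ne'
      simp [rdiag]
      field_simp
    · simp [rdiag, hij]
  have hcomm : ∀ Y : Matrix m m ℂ, ‖Y * rdiag b - rdiag b * Y‖ =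
      r * ‖(rdiag fun i => b i / r) * Y - Y * rdiag fun i => b i / r‖ := by
    intro Y
    rw [hb, mul_smul_comm, smul_mul_assoc, ← smul_sub, norm_smul, Real.norm_eq_abs, abs_of_pos hr,
      norm_sub_rev]
  have hsa : IsSelfAdjoint (rdiag fun i => b i / r) := star_rdiag _
  refine ⟨smear g (rdiag fun i => b i / r) K, ?_, ?_, ?_, ?_, ?_⟩
  · ext i j
    have hKij : star (K j i) = K i j := by
      conv_rhs => rw [← hK]
      rfl
    have he : cutoff 0 (b j / r - b i / r) = cutoff 0 (b i / r - b j / r) := by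
      rw [cutoff, cutoff, mul_comm]
      congr 2 <;> ring
    rw [star_apply, hg.smear_rdiag_apply, hg.smear_rdiag_apply, star_mul', hKij, he]
    simp
  · refine (hg.norm_smear_sub_le (cutoff_eq_one (by simp)) hsa K).trans ?_
    rw [hcomm, ← mul_assoc, div_mul_cancel₀ _ hr.ne']
    gcongr
  · rw [hcomm, hcomm, hg.comm_smear hsa]
    calc _ ≤ r * (I * _) := mul_le_mul_of_nonneg_left (hg.norm_smear_le hsa _) hr.le
      _ ≤ r * (C' * _) := by gcongr
      _ = _ := by ring
  · exact (hg.norm_smear_le hsa K).trans (by gcongr)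
  · intro i j hij
    rw [hg.smear_rdiag_apply, cutoff_eq_zero, Complex.ofReal_zero, zero_mul]
    rw [← sub_div, abs_div, abs_of_pos hr, zero_add, le_div_iff₀ hr, one_mul]
    exact hij

end Banding

section Separate
open scoped Matrix.Norms.L2Operator MatrixOrder
set_option linter.unusedSectionVars false

lemma IsProj.conj {A : Type*} [CStarAlgebra A] {P V : A} (hP : IsProj P)
    (hV : star V * V = 1) : IsProj (V * P * star V) where
  sa := by rw [star_mul, star_mul, star_star, hP.sa, mul_assoc]
  idem := by
    have h : V * P * star V * (V * P * star V) = V * P * (star V * V) * (P * star V) := by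
      noncomm_ring
    rw [h, hV, mul_one, mul_assoc V P, ← mul_assoc P P, hP.idem, mul_assoc]

/-- Separating the eigenspaces `1` and `-1` of a Hermitian contraction `X` by a projection
almost commuting with a Hermitian matrix `B`. -/
theorem exists_separating_proj : ∃ C : ℝ, 1 ≤ C ∧
    ∀ {m : Type} [Fintype m] [DecidableEq m] {B X : Matrix m m ℂ} {w κ : ℝ},
      star B = B → star X = X → ‖X‖ ≤ 1 → 0 < w → 0 < κ → ‖X * B - B * X‖ ≤ κ →
      ∃ P : Matrix m m ℂ, IsProj P ∧ ‖P * B - B * P‖ ≤ 3 * w ∧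
        (∀ e : Matrix m m ℂ, ‖e‖ ≤ 1 → X * e = e → ‖(1 - P) * e‖ ≤ C * √(κ / w)) ∧
        ∀ e : Matrix m m ℂ, ‖e‖ ≤ 1 → X * e = -e → ‖P * e‖ ≤ C * √(κ / w) := by
  obtain ⟨C1, hC1, h1⟩ := exists_banded
  obtain ⟨C2, hC2, h2⟩ := exists_proj_of_band
  have hC21 : 1 ≤ C2 * C1 := one_le_mul_of_one_le_of_one_le hC2 hC1
  refine ⟨512 * (C2 * C1), by linarith, fun {m} _ _ B X w κ hB hX hX1 hw hκ hXB => ?_⟩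
  have hq0 : 0 < κ / w := by positivity
  by_cases hsmall : 256 * C1 * (κ / w) ≤ 1 / 2
  swap
  · have hC1' : C1 ≤ C2 * C1 := by nlinarith
    have hq : 1 ≤ 512 * (C2 * C1) * √(κ / w) := by
      by_contra! hlt
      have h3 : √(κ / w) * √(κ / w) = κ / w := Real.mul_self_sqrt hq0.le
      have h4 : √(κ / w) ≤ 1 := by
        by_contra! h
        nlinarith
      have h5 : κ / w ≤ √(κ / w) := by nlinarith [Real.sqrt_nonneg (κ / w)]
      nlinarith
    have hz : IsProj (0 : Matrix m m ℂ) := ⟨star_zero _, mul_zero _⟩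
    refine ⟨0, hz, by simp; positivity, fun e he _ => ?_, fun e he _ => ?_⟩
    · rw [sub_zero, one_mul]; exact he.trans hq
    · rw [zero_mul, norm_zero]; exact zero_le_one.trans hq
  · obtain ⟨V, b, hV1, hV2, hBV⟩ := exists_diagonalize hB
    have hU1 : star (star V) * star V = 1 := by rwa [star_star]
    have hX' : star (star V * X * V) = star V * X * V := by
      rw [star_mul, star_mul, star_star, hX, mul_assoc]
    have hX'n : ‖star V * X * V‖ ≤ 1 := by
      simpa using (norm_conj_unitary_le hU1 X).trans hX1
    have hcomm : star V * X * V * rdiag b - rdiag b * (star V * X * V) =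
        star V * (X * B - B * X) * V := by
      rw [hBV]
      have e1 : star V * (X * (V * rdiag b * star V) - V * rdiag b * star V * X) * V =
        star V * X * V * rdiag b * (star V * V) - (star V * V) * rdiag b * (star V * X * V) := by
        noncomm_ring
      rw [e1, hV1, mul_one, one_mul]
    have hcommn : ‖star V * X * V * rdiag b - rdiag b * (star V * X * V)‖ ≤ κ := by
      rw [hcomm]
      simpa using (norm_conj_unitary_le hU1 (X * B - B * X)).trans hXB
    obtain ⟨Y, hY, hYX, hYc, -, hYb⟩ := h1 b hX' (r := w / 256) (by positivity)
    have hYX' : ‖Y - star V * X * V‖ ≤ 256 * C1 * (κ / w) := by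
      refine hYX.trans ?_
      calc _ ≤ C1 / (w / 256) * κ := by gcongr
        _ = _ := by field_simp
    have hYn : ‖Y‖ ≤ 3 / 2 := by
      have := norm_add_le_of_le hX'n (hYX'.trans hsmall)
      rw [add_sub_cancel] at this
      linarith
    obtain ⟨P, hP, hPb, hP1, hP2⟩ := h2 hY hYn hw (κ := C1 * κ) (by positivity) hYb
      (hYc.trans (by gcongr))
    have hfinal : C2 * (√(C1 * κ / w) + 256 * C1 * (κ / w)) ≤ 512 * (C2 * C1) * √(κ / w) := by
      have h3 : √(κ / w) * √(κ / w) = κ / w := Real.mul_self_sqrt hq0.le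
      have h4 : √(κ / w) ≤ 1 := by
        by_contra! h
        nlinarith
      have h5 : κ / w ≤ √(κ / w) := by nlinarith [Real.sqrt_nonneg (κ / w)]
      have h6 : √(C1 * κ / w) ≤ C1 * √(κ / w) := by
        rw [mul_div_assoc, Real.sqrt_mul (by linarith)]
        gcongr
        rw [Real.sqrt_le_left (by linarith)]
        nlinarith
      have h7 : √(C1 * κ / w) + 256 * C1 * (κ / w) ≤ 512 * C1 * √(κ / w) := by nlinarith
      nlinarith
    have hVe : ∀ e : Matrix m m ℂ, ‖e‖ ≤ 1 → ‖star V * e‖ ≤ 1 := fun e he => by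
      simpa using norm_mul_le_of_le (norm_le_one_of_star_mul_self hU1) he
    have hback : ∀ e : Matrix m m ℂ, ‖V * e‖ ≤ ‖e‖ := fun e => by
      simpa using norm_mul_le_of_le (norm_le_one_of_star_mul_self hV1) (le_refl ‖e‖)
    have hYe : ∀ e : Matrix m m ℂ, ‖e‖ ≤ 1 →
        ‖(Y - star V * X * V) * (star V * e)‖ ≤ 256 * C1 * (κ / w) := fun e he => by
      simpa using norm_mul_le_of_le hYX' (hVe e he)
    have hXe : ∀ e, star V * X * V * (star V * e) = star V * (X * e) := fun e => by
      have : star V * X * V * (star V * e) = star V * X * (V * star V) * e := by noncomm_ring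
      rw [this, hV2, mul_one, mul_assoc]
    refine ⟨V * P * star V, hP.conj hV1, ?_, fun e he h => ?_, fun e he h => ?_⟩
    · have : V * P * star V * B - B * (V * P * star V) =
          V * (P * rdiag b - rdiag b * P) * star V := by
        rw [hBV]
        have e1 : V * P * star V * (V * rdiag b * star V) - V * rdiag b * star V * (V * P * star V) =
          V * P * (star V * V) * (rdiag b * star V) - V * rdiag b * (star V * V) * (P * star V) := by
          noncomm_ring
        rw [e1, hV1]
        noncomm_ring
      rw [this]
      exact (norm_conj_unitary_le hV1 _).trans hPb
    · have h3 := hP1 (star V * e) _ (hVe e he) (le_of_eq_of_le (congrArg norm (?_ : _ =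
        (Y - star V * X * V) * (star V * e))) (hYe e he))
      · refine le_trans ?_ (h3.trans hfinal)
        have : (1 - V * P * star V) * e = V * ((1 - P) * (star V * e)) := by
          have e1 : V * ((1 - P) * (star V * e)) = (V * star V - V * P * star V) * e := by
            noncomm_ring
          rw [e1, hV2]
        rw [this]
        exact hback _
      · rw [sub_mul, hXe, h]
    · have h3 := hP2 (star V * e) _ (hVe e he) (le_of_eq_of_le (congrArg norm (?_ : _ =
        (Y - star V * X * V) * (star V * e))) (hYe e he))
      · refine le_trans ?_ (h3.trans hfinal)
        have : V * P * star V * e = V * (P * (star V * e)) := by noncomm_ring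
        rw [this]
        exact hback _
      · rw [sub_mul, hXe, h, mul_neg, sub_neg_eq_add]

end Separate

section Ladder

lemma sum_Ico_int_sub {A : Type*} [AddCommGroup A] (Q : ℤ → A) {a b : ℤ} (h : a ≤ b) :
    ∑ l ∈ Finset.Ico a b, (Q l - Q (l + 1)) = Q a - Q b := by
  induction b, h using Int.leInduction with
  | base => simp
  | succ n hn ih =>
    have : Finset.Ico a (n + 1) = insert n (Finset.Ico a n) := by
      ext x
      simp only [Finset.mem_Ico, Finset.mem_insert]
      omega
    rw [this, Finset.sum_insert (by simp), ih]
    abel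

variable {A : Type*} [CStarAlgebra A] [PartialOrder A] [StarOrderedRing A]

/-- A decreasing chain of projections from `1` to `0`. -/
structure Ladder (Q : ℤ → A) (a b : ℤ) : Prop where
  proj : ∀ j, IsProj (Q j)
  mul : ∀ {i j}, i ≤ j → Q i * Q j = Q j
  eq_one : ∀ {j}, j ≤ a → Q j = 1
  eq_zero : ∀ {j}, b ≤ j → Q j = 0

namespace Ladder

/-- The steps of a ladder. -/
def step (Q : ℤ → A) (k : ℤ) : A := Q k - Q (k + 1)

variable {Q : ℤ → A} {a b : ℤ}

omit [PartialOrder A] [StarOrderedRing A]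

lemma mul' (h : Ladder Q a b) {i j : ℤ} (hij : i ≤ j) : Q j * Q i = Q j := by
  have := congrArg star (h.mul hij)
  rwa [star_mul, (h.proj _).sa, (h.proj _).sa] at this

lemma mul_step (h : Ladder Q a b) (l k : ℤ) : Q l * step Q k = if l ≤ k then step Q k else 0 := by
  rw [step, mul_sub]
  split_ifs with hlk
  · rw [h.mul hlk, h.mul (by omega)]
  · rw [h.mul' (by omega), h.mul' (by omega), sub_self]

lemma step_mul (h : Ladder Q a b) (l k : ℤ) : step Q k * Q l = if l ≤ k then step Q k else 0 := by
  rw [step, sub_mul]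
  split_ifs with hlk
  · rw [h.mul' hlk, h.mul' (by omega)]
  · rw [h.mul (by omega), h.mul (by omega), sub_self]

lemma isProj_step (h : Ladder Q a b) (k : ℤ) : IsProj (step Q k) where
  sa := by rw [step, star_sub, (h.proj _).sa, (h.proj _).sa]
  idem := by
    conv_lhs => rw [step, sub_mul]
    rw [← step, h.mul_step, h.mul_step, if_pos le_rfl, if_neg (by omega), sub_zero]

lemma step_mul_step (h : Ladder Q a b) {k l : ℤ} (hkl : k ≠ l) : step Q k * step Q l = 0 := by
  conv_lhs => rw [step, sub_mul]
  rw [h.mul_step, h.mul_step]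
  split_ifs <;> first | omega | simp

lemma sum_step (h : Ladder Q a b) {a' b' : ℤ} (ha : a' ≤ a) (hb : b ≤ b') (hab : a' ≤ b') :
    ∑ k ∈ Finset.Ico a' b', step Q k = 1 := by
  have := sum_Ico_int_sub Q hab
  rw [h.eq_one ha, h.eq_zero hb, sub_zero] at this
  exact this

lemma norm_comm_step_le {B : A} {r : ℝ} (hB : ∀ j, ‖Q j * B - B * Q j‖ ≤ r) (k : ℤ) :
    ‖step Q k * B - B * step Q k‖ ≤ 2 * r := by
  have : step Q k * B - B * step Q k =
      (Q k * B - B * Q k) - (Q (k + 1) * B - B * Q (k + 1)) := by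
    rw [step]; noncomm_ring
  rw [this, two_mul]
  exact norm_sub_le_of_le (hB _) (hB _)

variable [PartialOrder A] [StarOrderedRing A]

/-- A self-adjoint element almost commuting with a ladder and block-banded with respect to it
is close to a self-adjoint element commuting with the ladder. -/
lemma exists_commute (h : Ladder Q a b) (hab : a ≤ b) {B : A} (hBs : star B = B) {r : ℝ}
    (hB : ∀ j, ‖Q j * B - B * Q j‖ ≤ r)
    (hband : ∀ k l, 3 ≤ |k - l| → step Q k * B * step Q l = 0) :
    ∃ B' : A, star B' = B' ∧ (∀ j, Commute (Q j) B') ∧ ‖B - B'‖ ≤ 8 * r := by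
  have hr : 0 ≤ r := (norm_nonneg _).trans (hB 0)
  set s := Finset.Ico a b
  set T : ℤ → A := fun d => ∑ k ∈ s, step Q k * B * step Q (k + d)
  have hT : B = ∑ d ∈ Finset.Icc (-2 : ℤ) 2, T d := by
    have h1 : ∀ k ∈ s, step Q k * B = ∑ d ∈ Finset.Icc (-2 : ℤ) 2, step Q k * B * step Q (k + d) := by
      intro k hk
      have hk' := Finset.mem_Ico.1 hk
      have h2 := h.sum_step (a' := a - 2) (b' := b + 2) (by omega) (by omega) (by omega)
      conv_lhs => rw [← mul_one (step Q k * B), ← h2, Finset.mul_sum]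
      rw [← Finset.sum_subset (s₁ := Finset.Icc (k - 2) (k + 2))]
      · refine Finset.sum_nbij' (fun l => l - k) (fun d => k + d) ?_ ?_ ?_ ?_ ?_ <;>
          intro l hl <;> simp only [Finset.mem_Icc] at * <;> first | omega | simp
      · intro l hl
        simp only [Finset.mem_Icc, Finset.mem_Ico] at *
        omega
      · intro l _ hl
        refine hband k l ?_
        simp only [Finset.mem_Icc] at hl
        rw [le_abs]
        omega
    rw [Finset.sum_comm, ← Finset.sum_congr rfl h1, ← Finset.sum_mul,
      h.sum_step le_rfl le_rfl hab, one_mul]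
  have hTn : ∀ d, d ≠ 0 → ‖T d‖ ≤ 2 * r := by
    intro d hd
    refine norm_sum_block_le s (by positivity) (fun k _ => h.isProj_step k)
      (fun k _ => h.isProj_step _) (fun k _ l _ hkl => h.step_mul_step hkl)
      (fun k _ l _ hkl => h.step_mul_step (by omega)) fun k _ => ?_
    have : step Q k * B * step Q (k + d) =
        (step Q k * B - B * step Q k) * step Q (k + d) := by
      rw [sub_mul, mul_assoc B, h.step_mul_step (by omega), mul_zero, sub_zero]
    rw [this]
    simpa using norm_mul_le_of_le (norm_comm_step_le hB k) (h.isProj_step (k + d)).norm_le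
  refine ⟨T 0, ?_, fun j => ?_, ?_⟩
  · simp only [T, add_zero, star_sum, star_mul, (h.isProj_step _).sa, hBs, mul_assoc]
  · refine Commute.sum_right _ _ _ fun k _ => ?_
    rw [Commute, SemiconjBy, add_zero, ← mul_assoc, ← mul_assoc, h.mul_step, mul_assoc _ _ (Q j),
      h.step_mul]
    split_ifs <;> simp
  · have h3 : Finset.Icc (-2 : ℤ) 2 = {-2, -1, 0, 1, 2} := by decide
    have h4 : B - T 0 = T (-2) + T (-1) + T 1 + T 2 := by
      conv_lhs => rw [hT, h3]
      rw [Finset.sum_insert (by decide), Finset.sum_insert (by decide),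
        Finset.sum_insert (by decide), Finset.sum_insert (by decide), Finset.sum_singleton]
      abel
    rw [h4]
    refine (norm_add_le_of_le (norm_add_le_of_le (norm_add_le_of_le (hTn (-2) (by decide))
      (hTn (-1) (by decide))) (hTn 1 (by decide))) (hTn 2 (by decide))).trans (by linarith)

end Ladder
end Ladder

section Squeeze
open scoped Matrix.Norms.L2Operator MatrixOrder
set_option linter.unusedSectionVars false

variable {m : Type} [Fintype m] [DecidableEq m]

/-- A projection almost dominating `e` and almost orthogonal to `k` can be moved to one exactly
dominating `e` and orthogonal to `k`. -/
lemma exists_squeezed_proj {P e k : Matrix m m ℂ} (hP : IsProj P) (he : IsProj e) (hk : IsProj k)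
    (hek : e * k = 0) {c : ℝ} (h1 : ‖(1 - P) * e‖ ≤ c) (h2 : ‖P * k‖ ≤ c) :
    ∃ P' : Matrix m m ℂ, IsProj P' ∧ P' * e = e ∧ P' * k = 0 ∧ ‖P' - P‖ ≤ 68 * c := by
  have hke : k * e = 0 := by
    have := congrArg star hek
    rwa [star_mul, he.sa, hk.sa, star_zero] at this
  have hc : 0 ≤ c := (norm_nonneg _).trans h1
  set h := 1 - e - k with hh
  have hhe : h * e = 0 := by rw [hh, sub_mul, sub_mul, one_mul, he.idem, hke]; simp
  have hhk : h * k = 0 := by rw [hh, sub_mul, sub_mul, one_mul, hk.idem, hek]; simp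
  have hhs : star h = h := by rw [hh, star_sub, star_sub, star_one, he.sa, hk.sa]
  have hhp : IsProj h := ⟨hhs, by
    conv_lhs => rw [hh, mul_sub, mul_sub, mul_one]
    rw [← hh, hhe, hhk, sub_zero, sub_zero]⟩
  clear_value h
  set D := e + h * P * h with hD
  have hDs : star D = D := by
    rw [hD, star_add, star_mul, star_mul, he.sa, hhs, hP.sa, mul_assoc]
  have hDe : D * e = e := by rw [hD, add_mul, he.idem, mul_assoc, hhe, mul_zero, add_zero]
  have hDk : D * k = 0 := by rw [hD, add_mul, hek, mul_assoc, hhk, mul_zero, add_zero]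
  have hDn : ‖D‖ ≤ 2 := by
    refine (norm_add_le_of_le he.norm_le (norm_mul_le_of_le (norm_mul_le_of_le hhp.norm_le
      hP.norm_le) hhp.norm_le)).trans (by norm_num)
  have hPD : ‖P - D‖ ≤ 4 * c := by
    have h1' : ‖star ((1 - P) * e)‖ ≤ c := by rwa [norm_star]
    have h2' : ‖star (P * k)‖ ≤ c := by rwa [norm_star]
    have e1 : P - D = -star ((1 - P) * e) + star (P * k) + (-(h * ((1 - P) * e)) + h * (P * k)) := by
      rw [star_mul, star_sub, star_one, star_mul, hP.sa, hk.sa, he.sa, hD]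
      have e2 : h * ((1 - P) * e) = -(h * P * e) := by
        rw [sub_mul, one_mul, mul_sub, hhe]; noncomm_ring
      rw [e2]
      have e3 : h * P * h = h * P - h * P * e - h * P * k := by
        conv_lhs => rw [hh]
        rw [hh]
        noncomm_ring
      rw [e3, hh]
      noncomm_ring
    have h3 : ‖-(h * ((1 - P) * e))‖ ≤ c := by
      rw [norm_neg]; simpa using norm_mul_le_of_le hhp.norm_le h1
    have h4 : ‖h * (P * k)‖ ≤ c := by simpa using norm_mul_le_of_le hhp.norm_le h2
    rw [e1]
    refine (norm_add_le_of_le (norm_add_le_of_le ((norm_neg _).le.trans h1') h2')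
      (norm_add_le_of_le h3 h4)).trans (by linarith)
  have hDD : ‖D * D - D‖ ≤ 16 * c := by
    have e1 : D * D - D = -(D * (P - D)) - (P - D) * P + (P - D) := by
      have := hP.idem
      rw [mul_sub, sub_mul, this]
      abel
    have hn : ‖-(D * (P - D))‖ ≤ 2 * (4 * c) := by rw [norm_neg]; exact norm_mul_le_of_le hDn hPD
    rw [e1]
    exact (norm_add_le_of_le (norm_sub_le_of_le hn (norm_mul_le_of_le hPD hP.norm_le)) hPD).trans
      (by linarith)
  obtain ⟨P', hP', -, hP1, hP2⟩ := exists_positive_proj (Y := (2 : ℝ) • D - 1)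
    (by rw [IsSelfAdjoint, star_sub, star_smul, hDs]; simp) Matrix.finite_real_spectrum
  refine ⟨P', hP', ?_, ?_, ?_⟩
  · have := hP1 e
    rw [sub_mul ((2 : ℝ) • D), smul_mul_assoc, hDe, one_mul, two_smul, add_sub_cancel_right, sub_self,
      norm_zero, sub_mul, one_mul, norm_le_zero_iff, sub_eq_zero] at this
    exact this.symm
  · have := hP2 k
    rw [sub_mul ((2 : ℝ) • D), smul_mul_assoc, hDk, one_mul, smul_zero, zero_sub, neg_add_cancel,
      norm_zero, norm_le_zero_iff] at this
    exact this
  · have n1 : ‖(1 - P') * D‖ ≤ 32 * c := by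
      refine (hP1 D).trans ?_
      have : ((2 : ℝ) • D - 1) * D - D = (2 : ℝ) • (D * D - D) := by
        rw [sub_mul, smul_mul_assoc, one_mul]; module
      rw [this, norm_smul, Real.norm_eq_abs, abs_of_pos two_pos]
      linarith
    have n2 : ‖P' * (1 - D)‖ ≤ 32 * c := by
      refine (hP2 (1 - D)).trans ?_
      have : ((2 : ℝ) • D - 1) * (1 - D) + (1 - D) = (-2 : ℝ) • (D * D - D) := by
        rw [sub_mul, smul_mul_assoc, one_mul, mul_sub, mul_one]; module
      rw [this, norm_smul]
      norm_num
      linarith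
    have e1 : P' - P = P' * (1 - D) - (1 - P') * D - (P - D) := by noncomm_ring
    rw [e1]
    exact (norm_sub_le_of_le (norm_sub_le_of_le n2 n1) hPD).trans (by linarith)

lemma IsFourierDensity.cfc_rdiag {f : ℝ → ℝ} {g : ℝ → ℂ} {C : ℝ}
    (hg : IsFourierDensity f g C) (b : m → ℝ) : cfc f (rdiag b) = rdiag fun i => f (b i) := by
  ext i j
  have h := (LinearMap.toContinuousLinearMap (Matrix.entryLinearMap ℂ ℂ i j)).integral_comp_comm
    (hg.integrable_smul (F := fun t => expI (rdiag b) (2 * Real.pi * t)) (by fun_prop)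
      fun t => norm_expI_le (star_rdiag b) _)
  rw [hg.cfc_eq_integral (star_rdiag b)]
  refine h.symm.trans ?_
  by_cases hij : i = j
  · subst hij
    rw [rdiag, rdiag, diagonal_apply_eq, hg.eq_integral]
    congr 1
    ext t
    change (g t • expI (rdiag b) (2 * Real.pi * t)) i i = _
    rw [expI_rdiag, Matrix.smul_apply, diagonal_apply_eq]
    simp
  · rw [rdiag, rdiag, diagonal_apply_ne _ hij]
    convert MeasureTheory.integral_zero ℝ ℂ using 2
    ext t
    change (g t • expI (rdiag b) (2 * Real.pi * t)) i j = _
    rw [expI_rdiag, Matrix.smul_apply, diagonal_apply_ne _ hij, smul_zero]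

/-- Commutators with a smoothed threshold of a diagonal matrix. -/
lemma exists_norm_comm_threshold_le : ∃ C : ℝ, 1 ≤ C ∧
    ∀ {m : Type} [Fintype m] [DecidableEq m] (b : m → ℝ) (K : Matrix m m ℂ),
      ‖(rdiag fun i => Real.smoothTransition (b i)) * K -
        K * rdiag fun i => Real.smoothTransition (b i)‖ ≤ C * ‖rdiag b * K - K * rdiag b‖ := by
  obtain ⟨C, hC⟩ := exists_uniform_fourierDensity_smoothTransition
  refine ⟨max 1 C, le_max_left _ _, fun {m} _ _ b K => ?_⟩
  obtain ⟨M, hM0, hM⟩ : ∃ M : ℝ, 0 ≤ M ∧ ∀ i, b i ≤ M :=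
    ⟨∑ i, |b i|, by positivity, fun i => (le_abs_self _).trans
      (Finset.single_le_sum (f := fun i => |b i|) (fun i _ => abs_nonneg _) (Finset.mem_univ i))⟩
  obtain ⟨g, hg⟩ := hC M hM0
  have h := hg.norm_comm_cfc_le (star_rdiag b) K
  rw [hg.cfc_rdiag] at h
  have e1 : (fun i => Real.smoothTransition (b i) - Real.smoothTransition (b i - M)) =
      fun i => Real.smoothTransition (b i) := by
    ext i
    rw [Real.smoothTransition.zero_of_nonpos (x := b i - M) (by linarith [hM i]), sub_zero]
  rw [e1] at h
  exact h.trans (by gcongr; exact le_max_right _ _)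

end Squeeze

section Chain
open scoped Matrix.Norms.L2Operator MatrixOrder
set_option linter.unusedSectionVars false

variable {m : Type} [Fintype m] [DecidableEq m]

lemma dproj_eq_one {s : Set m} (h : ∀ i, i ∈ s) : dproj s = 1 := by
  classical
  rw [dproj, rdiag, ← diagonal_one]
  congr 1; ext i
  simp [h i]

lemma dproj_mul_of_subset {s t : Set m} (h : ∀ i, i ∈ s → i ∈ t) : dproj s * dproj t = dproj s := by
  classical
  rw [dproj, dproj, rdiag_mul_rdiag]
  congr 1; ext i
  by_cases hs : i ∈ s
  · simp [hs, h i hs]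
  · simp [hs]

lemma dproj_add_add_eq_one {s t u : Set m} (h : ∀ i, (i ∈ s ∧ i ∉ t ∧ i ∉ u) ∨
    (i ∉ s ∧ i ∈ t ∧ i ∉ u) ∨ (i ∉ s ∧ i ∉ t ∧ i ∈ u)) : dproj s + dproj t + dproj u = 1 := by
  classical
  rw [dproj, dproj, dproj, rdiag, rdiag, rdiag, diagonal_add, diagonal_add, ← diagonal_one]
  congr 1; ext i
  rcases h i with h | h | h <;> simp [h]

/-- The coordinates where `a` is at least `jΔ`. -/
def above (a : m → ℝ) (Δ : ℝ) (j : ℤ) : Matrix m m ℂ := dproj {i | j * Δ ≤ a i}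

/-- The coordinates where `a` is at most `jΔ`. -/
def below (a : m → ℝ) (Δ : ℝ) (j : ℤ) : Matrix m m ℂ := dproj {i | a i ≤ j * Δ}

/-- The coordinates where `a` is strictly between `jΔ` and `kΔ`. -/
def between (a : m → ℝ) (Δ : ℝ) (j k : ℤ) : Matrix m m ℂ :=
  dproj {i | j * Δ < a i ∧ a i < k * Δ}

variable {a : m → ℝ} {Δ : ℝ} {Q : ℤ → Matrix m m ℂ}

lemma between_add_above_add_below (hΔ : 0 < Δ) {j k : ℤ} (hjk : j < k) :
    between a Δ j k + above a Δ k + below a Δ j = 1 := by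
  refine dproj_add_add_eq_one fun i => ?_
  have h : (j : ℝ) * Δ < k * Δ := by
    have : (j : ℝ) < k := by exact_mod_cast hjk
    gcongr
  simp only [Set.mem_ofPred_eq, not_le, not_and_or, not_lt]
  rcases le_or_gt (a i) (j * Δ) with h1 | h1
  · right; right; exact ⟨Or.inl h1, by linarith, h1⟩
  rcases lt_or_ge (a i) (k * Δ) with h2 | h2
  · left; exact ⟨⟨h1, h2⟩, h2, h1⟩
  · right; left; exact ⟨Or.inr h2, h2, h1⟩

/-- A family of projections squeezed between consecutive spectral projections of a diagonal
matrix. -/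
structure Chain (a : m → ℝ) (Δ : ℝ) (Q : ℤ → Matrix m m ℂ) : Prop where
  pos : 0 < Δ
  proj : ∀ j, IsProj (Q j)
  mul_above : ∀ j, Q j * above a Δ (j + 1) = above a Δ (j + 1)
  mul_below : ∀ j, Q j * below a Δ j = 0

namespace Chain

lemma above_mul (h : Chain a Δ Q) (j : ℤ) :
    above a Δ (j + 1) * Q j = above a Δ (j + 1) := by
  have := congrArg star (h.mul_above j)
  rwa [star_mul, (h.proj j).sa, above, (isProj_dproj _).sa, ← above] at this

lemma below_mul (h : Chain a Δ Q) (j : ℤ) : below a Δ j * Q j = 0 := by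
  have := congrArg star (h.mul_below j)
  rwa [star_mul, (h.proj j).sa, below, (isProj_dproj _).sa, ← below, star_zero] at this

lemma mul_eq (h : Chain a Δ Q) {i j : ℤ} (hij : i ≤ j) : Q i * Q j = Q j := by
  rcases hij.eq_or_lt with rfl | hij
  · exact (h.proj i).idem
  have h1 : above a Δ (i + 1) + between a Δ i (i + 1) + below a Δ i = 1 := by
    rw [add_comm (above _ _ _)]
    exact between_add_above_add_below h.pos (by omega)
  have hj : ((i : ℝ) + 1) * Δ ≤ j * Δ := by
    have : (i : ℝ) + 1 ≤ j := by exact_mod_cast hij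
    have := h.pos
    gcongr
  have hΔ := h.pos
  have h2 : between a Δ i (i + 1) * Q j = 0 := by
    have : between a Δ i (i + 1) * below a Δ j = between a Δ i (i + 1) :=
      dproj_mul_of_subset fun x hx => by
        have := hx.2
        push_cast at this
        exact this.le.trans hj
    rw [← this, mul_assoc, h.below_mul, mul_zero]
  have h3 : below a Δ i * Q j = 0 := by
    have : below a Δ i * below a Δ j = below a Δ i :=
      dproj_mul_of_subset fun x hx => by
        have hx' : a x ≤ i * Δ := hx
        change a x ≤ j * Δ
        nlinarith
    rw [← this, mul_assoc, h.below_mul, mul_zero]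
  have h4 : Q j = above a Δ (i + 1) * Q j := by
    conv_lhs => rw [← one_mul (Q j), ← h1, add_mul, add_mul, h2, h3, add_zero, add_zero]
  rw [h4, ← mul_assoc, h.mul_above]

lemma ladder (h : Chain a Δ Q) {N : ℤ} (ha : ∀ i, |a i| ≤ N * Δ) : Ladder Q (-N - 1) N where
  proj := h.proj
  mul := h.mul_eq
  eq_one := by
    intro j hj
    have : above a Δ (j + 1) = 1 := dproj_eq_one fun i => by
      have h1 := (abs_le.1 (ha i)).1
      have h2 : ((j + 1 : ℤ) : ℝ) ≤ -N := by exact_mod_cast (by omega : j + 1 ≤ -N)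
      have := h.pos
      change _ ≤ a i
      nlinarith
    simpa [this] using h.mul_above j
  eq_zero := by
    intro j hj
    have : below a Δ j = 1 := dproj_eq_one fun i => by
      have h1 := (abs_le.1 (ha i)).2
      have h2 : (N : ℝ) ≤ j := by exact_mod_cast hj
      have := h.pos
      change a i ≤ _
      nlinarith
    simpa [this] using h.mul_below j

lemma step_mul_between (h : Chain a Δ Q) (k : ℤ) :
    Ladder.step Q k * between a Δ k (k + 2) = Ladder.step Q k := by
  have h1 := between_add_above_add_below (a := a) h.pos (show k < k + 2 by omega)
  have h2 : Ladder.step Q k * above a Δ (k + 2) = 0 := by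
    have h4 := h.mul_above (k + 1)
    rw [add_assoc, one_add_one_eq_two] at h4
    rw [Ladder.step, sub_mul, h4]
    nth_rewrite 1 [← h4]
    rw [← mul_assoc, h.mul_eq (by omega), h4, sub_self]
  have h3 : Ladder.step Q k * below a Δ k = 0 := by
    have h4 := congrArg star (h.mul_eq (show k ≤ k + 1 by omega))
    rw [star_mul, (h.proj _).sa, (h.proj _).sa] at h4
    rw [Ladder.step, sub_mul, h.mul_below, ← h4, mul_assoc, h.mul_below, mul_zero, sub_zero]
  conv_rhs => rw [← mul_one (Ladder.step Q k), ← h1, mul_add, mul_add, h2, h3, add_zero, add_zero]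

lemma step_block_eq_zero (h : Chain a Δ Q) {B : Matrix m m ℂ}
    (hB : ∀ i j, Δ ≤ |a i - a j| → B i j = 0) {k l : ℤ} (hkl : 3 ≤ |k - l|) :
    Ladder.step Q k * B * Ladder.step Q l = 0 := by
  classical
  have h1 : between a Δ k (k + 2) * Ladder.step Q k = Ladder.step Q k := by
    have := congrArg star (h.step_mul_between k)
    rwa [star_mul, Ladder.step, star_sub, (h.proj _).sa, (h.proj _).sa, between,
      (isProj_dproj _).sa, ← between, ← Ladder.step] at this
  have h2 : star (between a Δ k (k + 2)) = between a Δ k (k + 2) := (isProj_dproj _).sa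
  have h3 : between a Δ k (k + 2) * B * between a Δ l (l + 2) = 0 := by
    ext i j
    rw [between, between, dproj_mul_mul_apply]
    split_ifs with hij
    · obtain ⟨⟨a1, a2⟩, a3, a4⟩ := hij
      refine hB i j ?_
      push_cast at a2 a4
      have hΔ := h.pos
      rw [le_abs] at hkl ⊢
      rcases hkl with hkl | hkl
      · left
        have : (3 : ℝ) ≤ k - l := by exact_mod_cast hkl
        nlinarith
      · right
        have : (3 : ℝ) ≤ -(k - l) := by exact_mod_cast hkl
        nlinarith
    · rfl
  have h4 : between a Δ l (l + 2) * Ladder.step Q l = Ladder.step Q l := by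
    have := congrArg star (h.step_mul_between l)
    rwa [star_mul, Ladder.step, star_sub, (h.proj _).sa, (h.proj _).sa, between,
      (isProj_dproj _).sa, ← between, ← Ladder.step] at this
  calc Ladder.step Q k * B * Ladder.step Q l
      = (Ladder.step Q k * between a Δ k (k + 2)) * B *
        (between a Δ l (l + 2) * Ladder.step Q l) := by rw [h.step_mul_between, h4]
    _ = Ladder.step Q k * (between a Δ k (k + 2) * B * between a Δ l (l + 2)) *
        Ladder.step Q l := by noncomm_ring
    _ = 0 := by rw [h3, mul_zero, zero_mul]

lemma eq_above_add (h : Chain a Δ Q) (j : ℤ) :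
    Q j = above a Δ (j + 1) + between a Δ j (j + 1) * Q j * between a Δ j (j + 1) := by
  have h1 := between_add_above_add_below (a := a) h.pos (show j < j + 1 by omega)
  have h2 : above a Δ (j + 1) * between a Δ j (j + 1) = 0 :=
    dproj_mul_of_disjoint fun i hi hi' => by
      have h3 : _ ≤ a i := hi
      exact absurd hi'.2 (not_lt.2 h3)
  have h3 : Q j * between a Δ j (j + 1) = between a Δ j (j + 1) * Q j * between a Δ j (j + 1) := by
    conv_lhs => rw [← one_mul (Q j), ← h1, add_mul, add_mul, add_mul, add_mul, h.above_mul, h.below_mul,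
      h2, zero_mul, add_zero, add_zero]
  conv_lhs => rw [← mul_one (Q j), ← h1, mul_add, mul_add, h.mul_below, h.mul_above, h3, add_zero,
    add_comm]

lemma sum_above (h : Chain a Δ Q) {N : ℤ} (ha : ∀ i, |a i| ≤ N * Δ) :
    Δ • ∑ j ∈ Finset.Ico (-N - 1) N, above a Δ (j + 1) - ((N + 1) * Δ : ℝ) • (1 : Matrix m m ℂ) =
      rdiag fun i => Δ * ⌊a i / Δ⌋ := by
  classical
  have hΔ := h.pos
  ext i i'
  rw [Matrix.sub_apply, Matrix.smul_apply, Matrix.sum_apply, Matrix.smul_apply]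
  by_cases hi : i = i'
  swap
  · rw [Finset.sum_eq_zero fun j _ => by simp [above, dproj, rdiag, hi]]
    simp [rdiag, hi]
  subst hi
  obtain ⟨h1, h2⟩ := abs_le.1 (ha i)
  have hf1 : ⌊a i / Δ⌋ ≤ N := by
    have := (Int.floor_le (a i / Δ)).trans ((div_le_iff₀ hΔ).2 h2)
    exact_mod_cast this
  have hf2 : -N ≤ ⌊a i / Δ⌋ := by
    rw [Int.le_floor, le_div_iff₀ hΔ]
    push_cast
    linarith
  have : ∑ j ∈ Finset.Ico (-N - 1) N, above a Δ (j + 1) i i = ((⌊a i / Δ⌋ + N + 1 : ℤ) : ℂ) := by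
    have e1 : ∀ j : ℤ, above a Δ (j + 1) i i = if j < ⌊a i / Δ⌋ then 1 else 0 := by
      intro j
      rw [above, dproj, rdiag, diagonal_apply_eq]
      have : i ∈ {i | ((j + 1 : ℤ) : ℝ) * Δ ≤ a i} ↔ j < ⌊a i / Δ⌋ := by
        rw [Set.mem_ofPred_eq, ← le_div_iff₀ hΔ, ← Int.le_floor, Int.add_one_le_iff]
      by_cases hj : j < ⌊a i / Δ⌋
      · rw [if_pos hj, if_pos (this.2 hj), Complex.ofReal_one]
      · rw [if_neg hj, if_neg (mt this.1 hj), Complex.ofReal_zero]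
    simp_rw [e1]
    rw [Finset.sum_boole]
    have e2 : (Finset.Ico (-N - 1) N).filter (fun j => j < ⌊a i / Δ⌋) =
        Finset.Ico (-N - 1) ⌊a i / Δ⌋ := by
      ext j
      simp only [Finset.mem_filter, Finset.mem_Ico]
      omega
    rw [e2, Int.card_Ico, ← Int.cast_natCast, Int.toNat_of_nonneg (by omega)]
    congr 1
    ring
  rw [this]
  simp only [rdiag, diagonal_apply_eq, one_apply_eq, Complex.real_smul]
  push_cast
  ring

/-- The diagonal matrix is approximated by the sum of the chain. -/
lemma norm_sub_le (h : Chain a Δ Q) {N : ℤ} (ha : ∀ i, |a i| ≤ N * Δ) :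
    ‖rdiag a - (Δ • ∑ j ∈ Finset.Ico (-N - 1) N, Q j -
      ((N + 1) * Δ : ℝ) • (1 : Matrix m m ℂ))‖ ≤ 2 * Δ := by
  have hΔ := h.pos
  set s := Finset.Ico (-N - 1) N
  have h1 : ∑ j ∈ s, Q j = ∑ j ∈ s, above a Δ (j + 1) +
      ∑ j ∈ s, between a Δ j (j + 1) * Q j * between a Δ j (j + 1) := by
    rw [← Finset.sum_add_distrib]
    exact Finset.sum_congr rfl fun j _ => h.eq_above_add j
  have hor : ∀ i ∈ s, ∀ j ∈ s, i ≠ j → between a Δ i (i + 1) * between a Δ j (j + 1) = 0 := by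
    intro i _ j _ hij
    refine dproj_mul_of_disjoint fun x hx hx' => ?_
    obtain ⟨a1, a2⟩ := hx
    obtain ⟨a3, a4⟩ := hx'
    push_cast at a2 a4
    rcases lt_or_gt_of_ne hij with hij | hij
    · have : (i : ℝ) + 1 ≤ j := by exact_mod_cast hij
      nlinarith
    · have : (j : ℝ) + 1 ≤ i := by exact_mod_cast hij
      nlinarith
  have h2 : ‖∑ j ∈ s, between a Δ j (j + 1) * Q j * between a Δ j (j + 1)‖ ≤ 1 :=
    norm_sum_block_le s zero_le_one (fun _ _ => isProj_dproj _) (fun _ _ => isProj_dproj _) hor hor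
      fun j _ => by
        have hb : ‖between a Δ j (j + 1)‖ ≤ 1 := (isProj_dproj _).norm_le
        exact (norm_mul_le_of_le (norm_mul_le_of_le hb (h.proj j).norm_le) hb).trans (by norm_num)
  have h3 : ‖rdiag a - rdiag fun i => Δ * ⌊a i / Δ⌋‖ ≤ Δ := by
    have : (rdiag a - rdiag fun i => Δ * ⌊a i / Δ⌋) = rdiag fun i => a i - Δ * ⌊a i / Δ⌋ := by
      simp [rdiag]
    rw [this]
    refine norm_rdiag_le hΔ.le fun i => ?_
    have e1 := mul_le_mul_of_nonneg_left (Int.floor_le (a i / Δ)) hΔ.le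
    have e2 := mul_lt_mul_of_pos_left (Int.lt_floor_add_one (a i / Δ)) hΔ
    rw [mul_div_cancel₀ _ hΔ.ne'] at e1 e2
    rw [abs_le]
    constructor <;> linarith
  have h4 : ‖Δ • ∑ j ∈ s, between a Δ j (j + 1) * Q j * between a Δ j (j + 1)‖ ≤ Δ := by
    rw [norm_smul, Real.norm_eq_abs, abs_of_pos hΔ]
    exact mul_le_of_le_one_right hΔ.le h2
  have h5 : rdiag a - (Δ • ∑ j ∈ s, Q j - ((N + 1) * Δ : ℝ) • (1 : Matrix m m ℂ)) =
      (rdiag a - rdiag fun i => Δ * ⌊a i / Δ⌋) -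
      Δ • ∑ j ∈ s, between a Δ j (j + 1) * Q j * between a Δ j (j + 1) := by
    rw [← h.sum_above ha, h1, smul_add]
    abel
  rw [h5, two_mul]
  exact norm_sub_le_of_le h3 h4

end Chain
end Chain

section Lin
open scoped Matrix.Norms.L2Operator MatrixOrder
set_option linter.unusedSectionVars false

/-- Projections separating the spectral subspaces of a diagonal matrix and almost commuting with a
second matrix. -/
lemma exists_chain : ∃ C : ℝ, 1 ≤ C ∧
    ∀ {m : Type} [Fintype m] [DecidableEq m] (a : m → ℝ) {B : Matrix m m ℂ} {Δ κ : ℝ},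
      star B = B → 0 < Δ → 1 ≤ κ → ‖B‖ ≤ κ → ‖B * rdiag a - rdiag a * B‖ ≤ κ * Δ ^ 4 →
      ∃ Q : ℤ → Matrix m m ℂ, Chain a Δ Q ∧ ∀ j, ‖Q j * B - B * Q j‖ ≤ C * κ ^ 2 * Δ := by
  obtain ⟨C2, hC2, h2⟩ := exists_separating_proj
  obtain ⟨C3, hC3, h3⟩ := exists_norm_comm_threshold_le
  refine ⟨3 + 136 * (2 * C2 * C3), by nlinarith, fun {m} _ _ a B Δ κ hB hΔ hκ hBn hBa => ?_⟩
  set c := 2 * C2 * C3 * κ * Δ with hc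
  have key : ∀ j : ℤ, ∃ P : Matrix m m ℂ, IsProj P ∧ ‖P * B - B * P‖ ≤ 3 * Δ ∧
      ‖(1 - P) * above a Δ (j + 1)‖ ≤ c ∧ ‖P * below a Δ j‖ ≤ c := by
    intro j
    set T : Matrix m m ℂ := rdiag fun i => Real.smoothTransition (a i / Δ - j)
    set X : Matrix m m ℂ := rdiag fun i => 2 * Real.smoothTransition (a i / Δ - j) - 1
    have hXT : X = (2 : ℝ) • T - 1 := by
      ext i i'
      by_cases hi : i = i'
      · subst hi; simp [X, T, rdiag]
      · simp [X, T, rdiag, hi]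
    have hX1 : ‖X‖ ≤ 1 := norm_rdiag_le zero_le_one fun i => by
      have := Real.smoothTransition.nonneg (a i / Δ - j)
      have := Real.smoothTransition.le_one (a i / Δ - j)
      rw [abs_le]; constructor <;> linarith
    have hTB : ‖T * B - B * T‖ ≤ C3 * (κ * Δ ^ 3) := by
      refine (h3 _ B).trans (mul_le_mul_of_nonneg_left ?_ (by linarith))
      have : (rdiag fun i => a i / Δ - j) * B - B * (rdiag fun i => a i / Δ - j) =
          (-1 / Δ : ℝ) • (B * rdiag a - rdiag a * B) := by
        ext i i'
        rw [Matrix.sub_apply, Matrix.smul_apply, Matrix.sub_apply, rdiag_mul_apply, mul_rdiag_apply,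
          rdiag_mul_apply, mul_rdiag_apply, Complex.real_smul]
        push_cast
        ring
      rw [this, norm_smul, norm_div, norm_neg, norm_one, Real.norm_eq_abs, abs_of_pos hΔ]
      calc 1 / Δ * ‖B * rdiag a - rdiag a * B‖ ≤ 1 / Δ * (κ * Δ ^ 4) := by gcongr
        _ = _ := by field_simp
    have hXB : ‖X * B - B * X‖ ≤ 2 * C3 * κ * Δ ^ 3 := by
      have : X * B - B * X = (2 : ℝ) • (T * B - B * T) := by
        rw [hXT, sub_mul, mul_sub, smul_mul_assoc, mul_smul_comm, one_mul, mul_one, smul_sub]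
        abel
      rw [this, norm_smul, Real.norm_eq_abs, abs_of_pos two_pos]
      linarith
    have hκ' : 0 < 2 * C3 * κ * Δ ^ 3 := by positivity
    obtain ⟨P, hP, hPB, hP1, hP2⟩ := h2 hB (star_rdiag _) hX1 hΔ hκ' hXB
    have hcb : C2 * √(2 * C3 * κ * Δ ^ 3 / Δ) ≤ c := by
      have h4 : 1 ≤ C3 * κ := one_le_mul_of_one_le_of_one_le hC3 hκ
      have h5 : √(2 * C3 * κ * Δ ^ 3 / Δ) ≤ 2 * C3 * κ * Δ := by
        rw [Real.sqrt_le_left (by positivity)]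
        have : 2 * C3 * κ * Δ ^ 3 / Δ = 2 * (C3 * κ) * Δ ^ 2 := by field_simp
        rw [this]
        have : (2 * C3 * κ * Δ) ^ 2 = (4 * (C3 * κ) ^ 2) * Δ ^ 2 := by ring
        rw [this]
        have h6 : C3 * κ ≤ (C3 * κ) ^ 2 := le_self_pow₀ h4 two_ne_zero
        gcongr
        norm_num
      calc C2 * √(2 * C3 * κ * Δ ^ 3 / Δ) ≤ C2 * (2 * C3 * κ * Δ) := by gcongr
        _ = c := by rw [hc]; ring
    refine ⟨P, hP, hPB, (hP1 _ (isProj_dproj _).norm_le ?_).trans hcb,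
      (hP2 _ (isProj_dproj _).norm_le ?_).trans hcb⟩
    · rw [dproj, rdiag_mul_rdiag]
      congr 1
      ext i
      split_ifs with hi
      · have hi' : ((j + 1 : ℤ) : ℝ) * Δ ≤ a i := hi
        rw [← le_div_iff₀ hΔ] at hi'
        push_cast at hi'
        rw [Real.smoothTransition.one_of_one_le (by linarith)]
        norm_num
      · simp
    · rw [dproj, rdiag_mul_rdiag, rdiag, rdiag, diagonal_neg]
      congr 1
      ext i
      split_ifs with hi
      · have hi' : a i ≤ j * Δ := hi
        rw [← div_le_iff₀ hΔ] at hi'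
        rw [Real.smoothTransition.zero_of_nonpos (by linarith)]
        norm_num
      · simp
  have key2 : ∀ j : ℤ, ∃ P' : Matrix m m ℂ, IsProj P' ∧
      P' * above a Δ (j + 1) = above a Δ (j + 1) ∧ P' * below a Δ j = 0 ∧
      ‖P' * B - B * P'‖ ≤ (3 + 136 * (2 * C2 * C3)) * κ ^ 2 * Δ := by
    intro j
    obtain ⟨P, hP, hPB, hP1, hP2⟩ := key j
    obtain ⟨P', hP', h1, h2, h3⟩ := exists_squeezed_proj hP (isProj_dproj _) (isProj_dproj _)
      (dproj_mul_of_disjoint fun i (hi : _ ≤ a i) (hi' : a i ≤ _) => by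
        push_cast at hi; linarith) hP1 hP2
    refine ⟨P', hP', h1, h2, ?_⟩
    have e1 : P' * B - B * P' = (P * B - B * P) + ((P' - P) * B - B * (P' - P)) := by noncomm_ring
    rw [e1]
    refine (norm_add_le_of_le hPB (norm_sub_le_of_le (norm_mul_le_of_le h3 hBn)
      (norm_mul_le_of_le hBn h3))).trans ?_
    have h4 : Δ ≤ κ ^ 2 * Δ := le_mul_of_one_le_left hΔ.le (one_le_pow₀ hκ)
    calc _ = 3 * Δ + 136 * (2 * C2 * C3) * κ ^ 2 * Δ := by rw [hc]; ring
      _ ≤ _ := by linarith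
  choose Q hQ1 hQ2 hQ3 hQ4 using key2
  exact ⟨Q, ⟨hΔ, hQ1, hQ2, hQ3⟩, hQ4⟩

lemma exists_commuting_of_diag : ∃ C : ℝ, 1 ≤ C ∧
    ∀ {m : Type} [Fintype m] [DecidableEq m] (a : m → ℝ) {B : Matrix m m ℂ} {Δ : ℝ},
      (∀ i, |a i| ≤ 1) → star B = B → ‖B‖ ≤ 1 → 0 < Δ → Δ ≤ 1 →
      ‖B * rdiag a - rdiag a * B‖ ≤ Δ ^ 4 →
      ∃ A' B' : Matrix m m ℂ, star A' = A' ∧ star B' = B' ∧ Commute A' B' ∧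
        ‖rdiag a - A'‖ ≤ C * Δ ∧ ‖B - B'‖ ≤ C * Δ := by
  obtain ⟨C1, hC1, h1⟩ := exists_banded
  obtain ⟨C2, hC2, h2⟩ := exists_chain
  have hC21 : 1 ≤ C2 * C1 ^ 2 := one_le_mul_of_one_le_of_one_le hC2 (one_le_pow₀ hC1)
  refine ⟨C1 + 8 * (C2 * C1 ^ 2), by linarith,
    fun {m} _ _ a B Δ ha hB hBn hΔ hΔ1 hBa => ?_⟩
  obtain ⟨K, hK, hKB, hKa, hKn, hKb⟩ := h1 a hB hΔ
  have hKB' : ‖K - B‖ ≤ C1 * Δ := by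
    refine hKB.trans ?_
    calc C1 / Δ * ‖B * rdiag a - rdiag a * B‖ ≤ C1 / Δ * Δ ^ 4 := by gcongr
      _ = C1 * Δ * Δ ^ 2 := by field_simp
      _ ≤ C1 * Δ * 1 := by gcongr; exact pow_le_one₀ hΔ.le hΔ1
      _ = C1 * Δ := mul_one _
  obtain ⟨Q, hQ, hQK⟩ := h2 a hK hΔ hC1 (hKn.trans (mul_le_of_le_one_right (by linarith) hBn))
    (hKa.trans (by gcongr))
  set N : ℤ := ⌈1 / Δ⌉
  have hN0 : 0 ≤ N := Int.ceil_nonneg (by positivity)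
  have haN : ∀ i, |a i| ≤ N * Δ := fun i => (ha i).trans ((div_le_iff₀ hΔ).1 (Int.le_ceil _))
  obtain ⟨B', hB', hc, hBB'⟩ := (hQ.ladder haN).exists_commute (by omega) hK hQK
    fun k l hkl => hQ.step_block_eq_zero hKb hkl
  refine ⟨Δ • ∑ j ∈ Finset.Ico (-N - 1) N, Q j - ((N + 1) * Δ : ℝ) • (1 : Matrix m m ℂ), B',
    ?_, hB', ?_, (hQ.norm_sub_le haN).trans ?_, ?_⟩
  · simp only [star_sub, star_smul, star_sum, (hQ.proj _).sa, star_one, star_trivial]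
  · exact ((Commute.sum_left _ _ _ fun j _ => hc j).smul_left Δ).sub_left
      ((Commute.one_left B').smul_left _)
  · gcongr
    linarith
  · rw [norm_sub_rev] at hKB'
    rw [← sub_add_sub_cancel B K B']
    refine (norm_add_le_of_le hKB' hBB').trans_eq ?_
    ring

/-- A quantitative form of Lin's theorem on almost commuting Hermitian matrices. -/
theorem exists_commuting_approx : ∃ C : ℝ, 1 ≤ C ∧
    ∀ {m : Type} [Fintype m] [DecidableEq m] {A B : Matrix m m ℂ} {Δ : ℝ},
      star A = A → star B = B → ‖A‖ ≤ 1 → ‖B‖ ≤ 1 → 0 < Δ → Δ ≤ 1 → ‖B * A - A * B‖ ≤ Δ ^ 4 →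
      ∃ A' B' : Matrix m m ℂ, star A' = A' ∧ star B' = B' ∧ Commute A' B' ∧
        ‖A - A'‖ ≤ C * Δ ∧ ‖B - B'‖ ≤ C * Δ := by
  obtain ⟨C, hC, h⟩ := exists_commuting_of_diag
  refine ⟨C, hC, fun {m} _ _ A B Δ hA hB hAn hBn hΔ hΔ1 hBA => ?_⟩
  obtain ⟨V, a, hV1, hV2, hAV⟩ := exists_diagonalize hA
  have hU1 : star (star V) * star V = 1 := by rwa [star_star]
  have hconj : ∀ Y : Matrix m m ℂ, ‖star V * Y * V‖ ≤ ‖Y‖ := fun Y => by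
    simpa using norm_conj_unitary_le hU1 Y
  have hstar : ∀ {Y : Matrix m m ℂ}, star Y = Y → star (V * Y * star V) = V * Y * star V := by
    intro Y hY
    rw [star_mul, star_mul, star_star, hY, mul_assoc]
  have hmul : ∀ Y Z : Matrix m m ℂ, (V * Y * star V) * (V * Z * star V) = V * (Y * Z) * star V := by
    intro Y Z
    have : (V * Y * star V) * (V * Z * star V) = V * Y * (star V * V) * Z * star V := by
      noncomm_ring
    rw [this, hV1]
    noncomm_ring
  have hAV' : star V * A * V = rdiag a := by
    have : star V * A * V = (star V * V) * rdiag a * (star V * V) := by rw [hAV]; noncomm_ring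
    rw [this, hV1, one_mul, mul_one]
  have hBV : V * (star V * B * V) * star V = B := by
    have : V * (star V * B * V) * star V = (V * star V) * B * (V * star V) := by noncomm_ring
    rw [this, hV2, one_mul, mul_one]
  have hcomm : star V * B * V * rdiag a - rdiag a * (star V * B * V) =
      star V * (B * A - A * B) * V := by
    rw [← hAV']
    have : star V * B * V * (star V * A * V) - star V * A * V * (star V * B * V) =
      star V * B * (V * star V) * A * V - star V * A * (V * star V) * B * V := by noncomm_ring
    rw [this, hV2]
    noncomm_ring
  have ha : ∀ i, |a i| ≤ 1 := by
    have h1 : ‖rdiag a‖ ≤ 1 := hAV' ▸ (hconj A).trans hAn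
    rw [rdiag, l2_opNorm_diagonal, pi_norm_le_iff_of_nonneg zero_le_one] at h1
    intro i
    have := h1 i
    rwa [Complex.norm_real] at this
  obtain ⟨A', B', hA', hB', hc, hAA', hBB'⟩ := h a (B := star V * B * V) ha
    (by rw [star_mul, star_mul, star_star, hB, mul_assoc]) ((hconj B).trans hBn) hΔ hΔ1
    (by rw [hcomm]; exact (hconj _).trans hBA)
  refine ⟨V * A' * star V, V * B' * star V, hstar hA', hstar hB', ?_, ?_, ?_⟩
  · rw [Commute, SemiconjBy, hmul, hmul, hc.eq]
  · have : A - V * A' * star V = V * (rdiag a - A') * star V := by rw [mul_sub, sub_mul, ← hAV]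
    rw [this]
    exact (norm_conj_unitary_le hV1 _).trans hAA'
  · have : B - V * B' * star V = V * (star V * B * V - B') * star V := by
      rw [mul_sub, sub_mul, hBV]
    rw [this]
    exact (norm_conj_unitary_le hV1 _).trans hBB'

end Lin

section ExactSphere
variable {A : Type*} [CStarAlgebra A]

lemma rePt_sub_of_isSelfAdjoint {Z X Y : A} (hX : star X = X) (hY : star Y = Y) :
    rePt (Z - (X + Complex.I • Y)) = rePt Z - X := by
  simp only [rePt, star_sub, star_add, star_smul, hX, hY, Complex.star_def, Complex.conj_I]
  module

lemma imPt_sub_of_isSelfAdjoint {Z X Y : A} (hX : star X = X) (hY : star Y = Y) :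
    imPt (Z - (X + Complex.I • Y)) = imPt Z - Y := by
  simp only [imPt, star_sub, star_add, star_smul, hX, hY, Complex.star_def, Complex.conj_I]
  match_scalars <;> ring_nf
  simp

lemma norm_imPt_mul_rePt_sub_le {D : A} {r : ℝ} (h : ‖D * star D - star D * D‖ ≤ 2 * r) :
    ‖imPt D * rePt D - rePt D * imPt D‖ ≤ r := by
  have : imPt D * rePt D - rePt D * imPt D = (-Complex.I / 2) • (D * star D - star D * D) := by
    simp only [rePt, imPt, smul_mul_smul_comm, mul_add, add_mul, mul_sub, sub_mul]
    module
  rw [this, norm_smul]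
  norm_num
  linarith

lemma rePt_sq_add_imPt_sq {Z : A} (hZ : star Z * Z = Z * star Z) :
    rePt Z ^ 2 + imPt Z ^ 2 = star Z * Z := by
  simp only [rePt, imPt, sq, smul_mul_smul_comm, mul_add, add_mul, mul_sub, sub_mul, hZ]
  match_scalars <;> ring_nf <;> simp
  norm_num

/-- A normal contraction `N` and `C = √(1 - N⋆N)` give an exact commuting representation of the
sphere. -/
lemma exact_sphere {N C : A} (hN : star N * N = N * star N) (hC : star C = C)
    (hCC : C * C = 1 - star N * N) (h1 : Commute C N) (h2 : Commute C (star N)) :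
    rePt ((2 : ℂ) • (N * C)) * imPt ((2 : ℂ) • (N * C)) =
        imPt ((2 : ℂ) • (N * C)) * rePt ((2 : ℂ) • (N * C)) ∧
      rePt ((2 : ℂ) • (N * C)) * (1 - (2 : ℂ) • (star N * N)) =
        (1 - (2 : ℂ) • (star N * N)) * rePt ((2 : ℂ) • (N * C)) ∧
      imPt ((2 : ℂ) • (N * C)) * (1 - (2 : ℂ) • (star N * N)) =
        (1 - (2 : ℂ) • (star N * N)) * imPt ((2 : ℂ) • (N * C)) ∧
      rePt ((2 : ℂ) • (N * C)) ^ 2 + imPt ((2 : ℂ) • (N * C)) ^ 2 +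
        (1 - (2 : ℂ) • (star N * N)) ^ 2 = 1 := by
  set Z := (2 : ℂ) • (N * C) with hZ
  set K := 1 - (2 : ℂ) • (star N * N) with hK
  have hN' : Commute (star N) N := hN
  have hsZ : star Z = (2 : ℂ) • (C * star N) := by
    rw [hZ, star_smul, star_mul, hC]
    simp
  have cNM : Commute N K :=
    (Commute.one_right _).sub_right ((hN'.symm.mul_right (Commute.refl N)).smul_right _)
  have cNM' : Commute (star N) K :=
    (Commute.one_right _).sub_right (((Commute.refl _).mul_right hN').smul_right _)
  have cCM : Commute C K := (Commute.one_right _).sub_right ((h2.mul_right h1).smul_right _)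
  have cZK : Commute Z K := (cNM.mul_left cCM).smul_left _
  have cZK' : Commute (star Z) K := by
    rw [hsZ]
    exact (cCM.mul_left cNM').smul_left _
  have cZ : Commute (star Z) Z := by
    rw [hsZ]
    exact ((h1.mul_left hN').mul_right ((Commute.refl C).mul_left h2.symm)).smul_left _
      |>.smul_right _
  refine ⟨?_, ?_, ?_, ?_⟩
  · exact (((Commute.refl Z).add_left cZ).sub_right
      (cZ.symm.add_left (Commute.refl _))).smul_left _ |>.smul_right _
  · exact (cZK.add_left cZK').smul_left _
  · exact (cZK.sub_left cZK').smul_left _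
  · have e : star Z * Z = (4 : ℂ) • ((1 - star N * N) * (star N * N)) := by
      rw [hsZ, hZ, smul_mul_smul_comm]
      have : C * star N * (N * C) = C * C * (star N * N) := by
        rw [mul_assoc C C, ← h1.eq, ← mul_assoc, mul_assoc C (star N) C, ← h2.eq]
        simp only [mul_assoc]
      rw [this, hCC]
      norm_num
    rw [rePt_sq_add_imPt_sq cZ.eq, e, hK, sq]
    simp only [mul_sub, sub_mul, mul_one, one_mul, smul_mul_smul_comm]
    module

variable [PartialOrder A] [StarOrderedRing A]

lemma exists_sqrt_one_sub {N : A} (hN : star N * N = N * star N) (hn : ‖N‖ ≤ 1) :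
    ∃ C : A, 0 ≤ C ∧ C * C = 1 - star N * N ∧ Commute C N ∧ Commute C (star N) := by
  have h1 : ‖star N * N‖ ≤ 1 := by
    rw [CStarRing.norm_star_mul_self]
    nlinarith [norm_nonneg N]
  have h0 : 0 ≤ 1 - star N * N :=
    sub_nonneg.2 ((CStarAlgebra.norm_le_one_iff_of_nonneg _ (star_mul_self_nonneg N)).1 h1)
  have c1 : Commute (1 - star N * N) N :=
    (Commute.one_left _).sub_left (by rw [Commute, SemiconjBy, ← mul_assoc, hN])
  have c2 : Commute (1 - star N * N) (star N) :=
    (Commute.one_left _).sub_left (by rw [Commute, SemiconjBy, mul_assoc, ← hN])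
  exact ⟨CFC.sqrt (1 - star N * N), CFC.sqrt_nonneg _, CFC.sqrt_mul_sqrt_self _ h0,
    c1.cfcₙ_nnreal _, c2.cfcₙ_nnreal _⟩

end ExactSphere

section Near
open scoped Matrix.Norms.L2Operator MatrixOrder

lemma exists_normal_contraction : ∃ C : ℝ, 1 ≤ C ∧
    ∀ {m : Type} [Fintype m] [DecidableEq m] {D : Matrix m m ℂ} {Δ : ℝ},
      ‖D‖ ≤ 1 → 0 < Δ → Δ ≤ 1 → ‖D * star D - star D * D‖ ≤ 2 * Δ ^ 4 →
      ∃ N : Matrix m m ℂ, star N * N = N * star N ∧ ‖N‖ ≤ 1 ∧ ‖D - N‖ ≤ C * Δ := by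
  obtain ⟨C, hC, h⟩ := exists_commuting_approx
  refine ⟨4 * C, by linarith, fun {m} _ _ D Δ hD hΔ hΔ1 hDD => ?_⟩
  obtain ⟨X, Y, hX, hY, hXY, hDX, hDY⟩ := h (isSelfAdjoint_rePt D).star_eq
    (isSelfAdjoint_imPt D).star_eq (norm_rePt_le hD) (norm_imPt_le hD) hΔ hΔ1
    (norm_imPt_mul_rePt_sub_le hDD)
  set W := X + Complex.I • Y
  have hW : star W * W = W * star W := by
    have : star W = X - Complex.I • Y := by
      simp [W, hX, hY, sub_eq_add_neg]
    rw [this]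
    simp only [W, mul_add, add_mul, mul_sub, sub_mul, smul_mul_assoc, mul_smul_comm, hXY.eq]
    module
  have hDW : ‖D - W‖ ≤ 2 * C * Δ := by
    have : D - W = (rePt D - X) + Complex.I • (imPt D - Y) := by
      conv_lhs => rw [← rePt_add_imPt D]
      module
    rw [this]
    refine (norm_add_le_of_le hDX ((norm_smul_le _ _).trans (mul_le_mul_of_nonneg_left hDY
      (norm_nonneg _)))).trans_eq ?_
    rw [Complex.norm_I]
    ring
  set s : ℝ := 1 + 2 * C * Δ
  have hs : 1 ≤ s := by simp only [s]; nlinarith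
  have hs0 : 0 < s := by linarith
  have hWn : ‖W‖ ≤ s := by
    have := norm_sub_le_of_le hD hDW
    rwa [sub_sub_cancel] at this
  refine ⟨s⁻¹ • W, ?_, ?_, ?_⟩
  · rw [star_smul, smul_mul_smul_comm, smul_mul_smul_comm, hW]
    simp
  · rw [norm_smul, Real.norm_eq_abs, abs_of_pos (inv_pos.2 hs0)]
    exact inv_mul_le_one_of_le₀ hWn hs0.le
  · have : D - s⁻¹ • W = (D - W) + (1 - s⁻¹) • W := by module
    have h1 : 0 ≤ 1 - s⁻¹ := sub_nonneg.2 (inv_le_one_of_one_le₀ hs)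
    have h2 : ‖(1 - s⁻¹) • W‖ ≤ 2 * C * Δ := by
      rw [norm_smul, Real.norm_eq_abs, abs_of_nonneg h1]
      refine (mul_le_mul_of_nonneg_left hWn h1).trans_eq ?_
      rw [sub_mul, inv_mul_cancel₀ hs0.ne']
      simp only [s]
      ring
    rw [this]
    refine (norm_add_le_of_le hDW h2).trans_eq (by ring)

/-- The passage from the off-diagonal block of the spectral projection to commuting matrices. -/
lemma exists_sphere_of_blocks : ∃ c : ℝ, 1 ≤ c ∧
    ∀ {m : Type} [Fintype m] [DecidableEq m] {H₁ H₂ H₃ C D : Matrix m m ℂ} {δ τ : ℝ},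
      star H₁ = H₁ → star H₂ = H₂ → star H₃ = H₃ → 0 ≤ C → ‖C‖ ≤ 2 → ‖D‖ ≤ 1 →
      0 < τ → τ ≤ 1 → 0 ≤ δ → 11 * δ ≤ τ ^ 8 →
      ‖C * C - (1 / 2 : ℝ) • (1 + H₃)‖ ≤ 11 * δ →
      ‖star D * D - (1 / 2 : ℝ) • (1 - H₃)‖ ≤ 14 * δ →
      ‖D * star D - (1 / 2 : ℝ) • (1 - H₃)‖ ≤ 8 * δ →
      ‖D * C - (1 / 2 : ℝ) • (H₁ + Complex.I • H₂)‖ ≤ 9 * δ →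
      ∃ K₁ K₂ K₃ : Matrix m m ℂ, star K₁ = K₁ ∧ star K₂ = K₂ ∧ star K₃ = K₃ ∧
        K₁ * K₂ = K₂ * K₁ ∧ K₁ * K₃ = K₃ * K₁ ∧ K₂ * K₃ = K₃ * K₂ ∧
        K₁ ^ 2 + K₂ ^ 2 + K₃ ^ 2 = 1 ∧
        ‖K₁ - H₁‖ ≤ c * τ ∧ ‖K₂ - H₂‖ ≤ c * τ ∧ ‖K₃ - H₃‖ ≤ c * τ := by
  obtain ⟨c, hc, h⟩ := exists_normal_contraction
  refine ⟨14 * c, by linarith, fun {m} _ _ H₁ H₂ H₃ C D δ τ s1 s2 s3 hC0 hCn hDn hτ hτ1 hδ hδτ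
    hCC hDD hDD' hDC => ?_⟩
  have hδτ2 : 11 * δ ≤ τ ^ 2 := hδτ.trans (pow_le_pow_of_le_one hτ.le hτ1 (by norm_num))
  have hτ2 : τ ^ 2 ≤ τ := by nlinarith
  have hτc : τ ≤ c * τ := le_mul_of_one_le_left hτ.le hc
  have hτc2 : τ ^ 2 ≤ c * τ ^ 2 := le_mul_of_one_le_left (by positivity) hc
  have hcτ2 : c * τ ^ 2 ≤ c * τ := by gcongr
  obtain ⟨N, hN, hN1, hDN⟩ := h (D := D) (Δ := τ ^ 2) hDn (by positivity)
    (pow_le_one₀ hτ.le hτ1) (by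
      have := norm_sub_le_of_le hDD' hDD
      rw [sub_sub_sub_cancel_right] at this
      refine this.trans ?_
      ring_nf at hδτ ⊢
      linarith)
  obtain ⟨C', hC'0, hCC', h1, h2⟩ := exists_sqrt_one_sub hN hN1
  have hNN : ‖star N * N - star D * D‖ ≤ 2 * (c * τ ^ 2) := by
    have e : star N * N - star D * D = star N * (N - D) + star (N - D) * D := by
      rw [star_sub]; noncomm_ring
    rw [norm_sub_rev] at hDN
    rw [e]
    refine (norm_add_le_of_le (norm_mul_le_of_le ((norm_star N).le.trans hN1) hDN)
      (norm_mul_le_of_le ((norm_star _).le.trans hDN) hDn)).trans_eq (by ring)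
  have hCs : ‖C' - C‖ ≤ 3 * (c * τ) := by
    have h3 := norm_sub_sq_le_of_nonneg hC'0 hC0
    have e : C' * C' - C * C = -((C * C - (1 / 2 : ℝ) • (1 + H₃)) +
        (star D * D - (1 / 2 : ℝ) • (1 - H₃)) + (star N * N - star D * D)) := by
      rw [hCC']; module
    have h4 := norm_add_le_of_le (norm_add_le_of_le hCC hDD) hNN
    rw [← norm_neg, ← e] at h4
    refine abs_le_of_sq_le_sq' ?_ (by positivity) |>.2
    have h5 : c * τ ^ 2 ≤ (c * τ) ^ 2 := by
      rw [mul_pow]; gcongr; exact le_self_pow₀ hc two_ne_zero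
    nlinarith
  obtain ⟨k1, k2, k3, k4⟩ := exact_sphere hN (IsSelfAdjoint.of_nonneg hC'0).star_eq hCC' h1 h2
  have hZ : ‖(2 : ℂ) • (N * C') - (H₁ + Complex.I • H₂)‖ ≤ 14 * c * τ := by
    have e : (2 : ℂ) • (N * C') - (H₁ + Complex.I • H₂) = (2 : ℝ) • (N * (C' - C) - (D - N) * C +
        (D * C - (1 / 2 : ℝ) • (H₁ + Complex.I • H₂))) := by
      rw [mul_sub, sub_mul]
      module
    rw [e, norm_smul, Real.norm_eq_abs, abs_of_pos two_pos]
    have h5 := norm_add_le_of_le (norm_sub_le_of_le (norm_mul_le_of_le hN1 hCs)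
      (norm_mul_le_of_le hDN hCn)) hDC
    linarith
  refine ⟨_, _, _, (isSelfAdjoint_rePt _).star_eq, (isSelfAdjoint_imPt _).star_eq, ?_,
    k1, k2, k3, k4, ?_, ?_, ?_⟩
  · simp
  · rw [← rePt_sub_of_isSelfAdjoint s1 s2]
    exact norm_rePt_le hZ
  · rw [← imPt_sub_of_isSelfAdjoint s1 s2]
    exact norm_imPt_le hZ
  · have e : 1 - (2 : ℂ) • (star N * N) - H₃ =
        (-2 : ℝ) • ((star D * D - (1 / 2 : ℝ) • (1 - H₃)) + (star N * N - star D * D)) := by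
      module
    rw [e, norm_smul]
    have h5 := norm_add_le_of_le hDD hNN
    rw [Real.norm_eq_abs, show |(-2 : ℝ)| = 2 by norm_num]
    linarith

end Near

section Blocks
open scoped Matrix.Norms.L2Operator MatrixOrder

variable {m : Type} [Fintype m] [DecidableEq m]

/-- The inclusion of the first summand. -/
def incl₁ (m : Type) [DecidableEq m] : Matrix (m ⊕ m) m ℂ := fromRows 1 0

/-- The inclusion of the second summand. -/
def incl₂ (m : Type) [DecidableEq m] : Matrix (m ⊕ m) m ℂ := fromRows 0 1

lemma norm_le_one_of_conjTranspose_mul_self {k l : Type} [Fintype k] [DecidableEq k] [Fintype l]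
    [DecidableEq l] {W : Matrix k l ℂ} (h : Wᴴ * W = 1) : ‖W‖ ≤ 1 := by
  have h1 := l2_opNorm_conjTranspose_mul_self W
  rw [h] at h1
  have h2 : ‖(1 : Matrix l l ℂ)‖ ≤ 1 := Gluing.norm_one_le
  nlinarith [norm_nonneg W]

lemma norm_conj_isometry_le {k l : Type} [Fintype k] [DecidableEq k] [Fintype l]
    [DecidableEq l] {W W' : Matrix k l ℂ} (h : Wᴴ * W = 1) (h' : W'ᴴ * W' = 1)
    (Y : Matrix l l ℂ) : ‖W * Y * W'ᴴ‖ ≤ ‖Y‖ := by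
  have h1 := norm_le_one_of_conjTranspose_mul_self h
  have h2 := norm_le_one_of_conjTranspose_mul_self h'
  rw [← l2_opNorm_conjTranspose] at h2
  calc ‖W * Y * W'ᴴ‖ ≤ ‖W * Y‖ * ‖W'ᴴ‖ := l2_opNorm_mul _ _
    _ ≤ ‖W‖ * ‖Y‖ * ‖W'ᴴ‖ := by gcongr; exact l2_opNorm_mul _ _
    _ ≤ 1 * ‖Y‖ * 1 := by gcongr
    _ = ‖Y‖ := by ring

lemma norm_compress_isometry_le {k l : Type} [Fintype k] [DecidableEq k] [Fintype l]
    [DecidableEq l] {W W' : Matrix k l ℂ} (h : Wᴴ * W = 1) (h' : W'ᴴ * W' = 1)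
    (Y : Matrix k k ℂ) : ‖Wᴴ * Y * W'‖ ≤ ‖Y‖ := by
  have h1 := norm_le_one_of_conjTranspose_mul_self h
  have h2 := norm_le_one_of_conjTranspose_mul_self h'
  rw [← l2_opNorm_conjTranspose] at h1
  calc ‖Wᴴ * Y * W'‖ ≤ ‖Wᴴ * Y‖ * ‖W'‖ := l2_opNorm_mul _ _
    _ ≤ ‖Wᴴ‖ * ‖Y‖ * ‖W'‖ := by gcongr; exact l2_opNorm_mul _ _
    _ ≤ 1 * ‖Y‖ * 1 := by gcongr
    _ = ‖Y‖ := by ring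

lemma incl₁_isometry : (incl₁ m)ᴴ * (incl₁ m) = 1 := by
  simp [incl₁, conjTranspose_fromRows_eq_fromCols_conjTranspose, fromCols_mul_fromRows]

lemma incl₂_isometry : (incl₂ m)ᴴ * (incl₂ m) = 1 := by
  simp [incl₂, conjTranspose_fromRows_eq_fromCols_conjTranspose, fromCols_mul_fromRows]

lemma incl_add : (incl₁ m) * (incl₁ m)ᴴ + (incl₂ m) * (incl₂ m)ᴴ = 1 := by
  ext (i | i) (j | j) <;>
    simp [incl₁, incl₂, conjTranspose_fromRows_eq_fromCols_conjTranspose, one_apply]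

lemma fromBlocks_eq_incl (A B C D : Matrix m m ℂ) :
    fromBlocks A B C D = (incl₁ m) * A * (incl₁ m)ᴴ + (incl₁ m) * B * (incl₂ m)ᴴ + (incl₂ m) * C * (incl₁ m)ᴴ +
      (incl₂ m) * D * (incl₂ m)ᴴ := by
  ext (i | i) (j | j) <;>
    simp [incl₁, incl₂, conjTranspose_fromRows_eq_fromCols_conjTranspose, fromRows_mul]

lemma incl₁_compress (A B C D : Matrix m m ℂ) : (incl₁ m)ᴴ * fromBlocks A B C D * (incl₁ m) = A := by
  simp [incl₁, conjTranspose_fromRows_eq_fromCols_conjTranspose, fromCols_mul_fromBlocks,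
    fromCols_mul_fromRows]

lemma incl₂_compress (A B C D : Matrix m m ℂ) : (incl₂ m)ᴴ * fromBlocks A B C D * (incl₂ m) = D := by
  simp [incl₂, conjTranspose_fromRows_eq_fromCols_conjTranspose, fromCols_mul_fromBlocks,
    fromCols_mul_fromRows]

lemma incl₂₁_compress (A B C D : Matrix m m ℂ) : (incl₂ m)ᴴ * fromBlocks A B C D * (incl₁ m) = C := by
  simp [incl₁, incl₂, conjTranspose_fromRows_eq_fromCols_conjTranspose, fromCols_mul_fromBlocks,
    fromCols_mul_fromRows]

lemma norm_fromBlocks_le {A B C D : Matrix m m ℂ} {r : ℝ} (hA : ‖A‖ ≤ r) (hB : ‖B‖ ≤ r)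
    (hC : ‖C‖ ≤ r) (hD : ‖D‖ ≤ r) : ‖fromBlocks A B C D‖ ≤ 4 * r := by
  rw [fromBlocks_eq_incl]
  refine (norm_add_le_of_le (norm_add_le_of_le (norm_add_le_of_le
    ((norm_conj_isometry_le incl₁_isometry incl₁_isometry A).trans hA)
    ((norm_conj_isometry_le incl₁_isometry incl₂_isometry B).trans hB))
    ((norm_conj_isometry_le incl₂_isometry incl₁_isometry C).trans hC))
    ((norm_conj_isometry_le incl₂_isometry incl₂_isometry D).trans hD)).trans_eq ?_
  ring

omit [Fintype m] [DecidableEq m] in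
lemma isHermitian_sphS {H₁ H₂ H₃ : Matrix m m ℂ} (h1 : star H₁ = H₁) (h2 : star H₂ = H₂)
    (h3 : star H₃ = H₃) : (sphS H₁ H₂ H₃).IsHermitian := by
  rw [star_eq_conjTranspose] at h1 h2 h3
  rw [IsHermitian, sphS, fromBlocks_conjTranspose]
  simp [h1, h2, h3, sub_eq_add_neg]

lemma norm_sphS_sq_sub_one_le {H₁ H₂ H₃ : Matrix m m ℂ} {δ : ℝ}
    (h12 : ‖H₁ * H₂ - H₂ * H₁‖ ≤ δ) (h13 : ‖H₁ * H₃ - H₃ * H₁‖ ≤ δ)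
    (h23 : ‖H₂ * H₃ - H₃ * H₂‖ ≤ δ) (hs : ‖H₁ ^ 2 + H₂ ^ 2 + H₃ ^ 2 - 1‖ ≤ δ) :
    ‖sphS H₁ H₂ H₃ * sphS H₁ H₂ H₃ - 1‖ ≤ 8 * δ := by
  have hI : ∀ {Y : Matrix m m ℂ}, ‖Y‖ ≤ δ → ‖Complex.I • Y‖ ≤ δ := fun h => by
    rw [norm_smul, Complex.norm_I, one_mul]; exact h
  have e : sphS H₁ H₂ H₃ * sphS H₁ H₂ H₃ - 1 = fromBlocks
      ((H₁ ^ 2 + H₂ ^ 2 + H₃ ^ 2 - 1) + Complex.I • (H₁ * H₂ - H₂ * H₁))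
      (Complex.I • (H₂ * H₃ - H₃ * H₂) - (H₁ * H₃ - H₃ * H₁))
      ((H₁ * H₃ - H₃ * H₁) + Complex.I • (H₂ * H₃ - H₃ * H₂))
      ((H₁ ^ 2 + H₂ ^ 2 + H₃ ^ 2 - 1) - Complex.I • (H₁ * H₂ - H₂ * H₁)) := by
    rw [sphS, fromBlocks_multiply, ← fromBlocks_one, sub_eq_add_neg, fromBlocks_neg,
      fromBlocks_add]
    congr 1 <;> simp only [sq, mul_add, add_mul, mul_sub, sub_mul, smul_mul_assoc, mul_smul_comm,
      mul_neg, neg_mul] <;> match_scalars <;> simp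
  rw [e]
  refine (norm_fromBlocks_le (norm_add_le_of_le hs (hI h12)) (norm_sub_le_of_le (hI h23) h13)
    (norm_add_le_of_le h13 (hI h23)) (norm_sub_le_of_le hs (hI h12))).trans_eq (by ring)

/-- The positive spectral projection of an almost involution, as the range projection of an
isometry from a space of the right dimension. -/
lemma exists_isometry_of_card {k : Type} [Fintype k] [DecidableEq k] {S : Matrix k k ℂ}
    (hS : S.IsHermitian) {r : ℝ} (hr : ‖S * S - 1‖ ≤ 2 * r)
    (e : m ≃ {i // 0 < hS.eigenvalues i}) :
    ∃ W : Matrix k m ℂ, Wᴴ * W = 1 ∧ ‖W * Wᴴ - (1 / 2 : ℝ) • (1 + S)‖ ≤ r := by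
  set V := (hS.eigenvectorUnitary : Matrix k k ℂ)
  set b := hS.eigenvalues
  have hV1 : star V * V = 1 := Unitary.coe_star_mul_self _
  have hV2 : V * star V = 1 := Unitary.coe_mul_star_self _
  have hSV : S = V * rdiag b * star V := by
    conv_lhs => rw [hS.spectral_theorem]
    rfl
  have hr0 : 0 ≤ r := by linarith [norm_nonneg (S * S - 1)]
  have hb : ∀ i, |b i * b i - 1| ≤ 2 * r := by
    have h1 : rdiag (fun i => b i * b i - 1) = star V * (S * S - 1) * V := by
      have h2 : star V * (S * S - 1) * V =
          (star V * V) * rdiag b * (star V * V) * rdiag b * (star V * V) - star V * V := by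
        rw [hSV]; noncomm_ring
      rw [h2, hV1, one_mul, mul_one, mul_one, rdiag_mul_rdiag]
      ext i j
      by_cases hij : i = j
      · subst hij; simp [rdiag]
      · simp [rdiag, hij]
    have h3 : ‖star V * (S * S - 1) * V‖ ≤ 2 * r :=
      (norm_compress_isometry_le hV1 hV1 _).trans hr
    rw [← h1, rdiag, l2_opNorm_diagonal, pi_norm_le_iff_of_nonneg (by linarith)] at h3
    intro i
    have := h3 i
    rwa [Complex.norm_real] at this
  refine ⟨V.submatrix id fun i => (e i : k), ?_, ?_⟩
  · ext i j
    have := congrFun (congrFun hV1 (e i)) (e j)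
    rw [mul_apply] at this ⊢
    refine this.trans ?_
    simp [one_apply, Subtype.val_inj]
  · have hP : (V.submatrix id fun i => (e i : k)) * (V.submatrix id fun i => (e i : k))ᴴ =
        V * rdiag (fun i => if 0 < b i then 1 else 0) * star V := by
      ext i j
      rw [mul_apply, mul_apply]
      simp only [mul_rdiag_apply, submatrix_apply, conjTranspose_apply, id, star_apply]
      rw [e.sum_comp fun x : {i // 0 < hS.eigenvalues i} => V i x * star (V j x),
        ← Finset.sum_subtype (Finset.univ.filter fun x => 0 < b x) (by simp [b])
          (fun x => V i x * star (V j x)), Finset.sum_filter]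
      refine Finset.sum_congr rfl fun x _ => ?_
      split_ifs <;> simp
    have h4 : V * rdiag (fun i => if 0 < b i then 1 else 0) * star V - (1 / 2 : ℝ) • (1 + S) =
        V * rdiag (fun i => (if 0 < b i then 1 else 0) - (1 / 2) * (1 + b i)) * star V := by
      have h5 : rdiag (fun i => (if 0 < b i then 1 else 0) - (1 / 2) * (1 + b i)) =
          rdiag (fun i => if 0 < b i then 1 else 0) - (1 / 2 : ℝ) • (1 + rdiag b) := by
        ext i j
        by_cases hij : i = j
        · subst hij; simp [rdiag, mul_add]
        · simp [rdiag, hij]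
      rw [h5]
      conv_lhs => rw [hSV, ← hV2]
      rw [mul_sub, sub_mul, mul_smul_comm, smul_mul_assoc, mul_add, add_mul, mul_one]
    rw [hP, h4]
    refine (norm_conj_unitary_le hV1 _).trans (norm_rdiag_le hr0 fun i => ?_)
    have := abs_le.1 (hb i)
    rw [abs_le]
    split_ifs with hi <;> constructor <;> nlinarith

lemma exists_blocks {H₁ H₂ H₃ : Matrix m m ℂ} {δ : ℝ} (h1 : star H₁ = H₁) (h2 : star H₂ = H₂)
    (h3 : star H₃ = H₃) (h12 : ‖H₁ * H₂ - H₂ * H₁‖ ≤ δ) (h13 : ‖H₁ * H₃ - H₃ * H₁‖ ≤ δ)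
    (h23 : ‖H₂ * H₃ - H₃ * H₂‖ ≤ δ) (hs : ‖H₁ ^ 2 + H₂ ^ 2 + H₃ ^ 2 - 1‖ ≤ δ)
    (hbott : bott H₁ H₂ H₃ = 0) :
    ∃ C D : Matrix m m ℂ, star C * C + star D * D = 1 ∧
      ‖C * star C - (1 / 2 : ℝ) • (1 + H₃)‖ ≤ 4 * δ ∧
      ‖D * star D - (1 / 2 : ℝ) • (1 - H₃)‖ ≤ 4 * δ ∧
      ‖D * star C - (1 / 2 : ℝ) • (H₁ + Complex.I • H₂)‖ ≤ 4 * δ := by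
  have hS := isHermitian_sphS h1 h2 h3
  have hcard : Fintype.card m = Fintype.card {i // 0 < hS.eigenvalues i} := by
    rw [bott, dif_pos hS, sub_eq_zero] at hbott
    rw [Fintype.card_subtype]
    convert (Nat.cast_injective hbott).symm
  obtain ⟨W, hW1, hW2⟩ := exists_isometry_of_card hS (r := 4 * δ)
    ((norm_sphS_sq_sub_one_le h12 h13 h23 hs).trans_eq (by ring)) (Fintype.equivOfCardEq hcard)
  have hc : ∀ J K : Matrix (m ⊕ m) m ℂ, Jᴴ * W * star (Kᴴ * W) -
      (1 / 2 : ℝ) • (Jᴴ * (1 : Matrix (m ⊕ m) (m ⊕ m) ℂ) * K + Jᴴ * sphS H₁ H₂ H₃ * K) =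
      Jᴴ * (W * Wᴴ - (1 / 2 : ℝ) • (1 + sphS H₁ H₂ H₃)) * K := by
    intro J K
    rw [star_eq_conjTranspose, conjTranspose_mul, conjTranspose_conjTranspose, Matrix.mul_sub,
      Matrix.sub_mul, Matrix.mul_smul, Matrix.smul_mul, Matrix.mul_add, Matrix.add_mul]
    simp only [Matrix.mul_assoc]
  refine ⟨(incl₁ m)ᴴ * W, (incl₂ m)ᴴ * W, ?_, ?_, ?_, ?_⟩
  · simp only [star_eq_conjTranspose, conjTranspose_mul, conjTranspose_conjTranspose]
    have : Wᴴ * (incl₁ m) * ((incl₁ m)ᴴ * W) + Wᴴ * (incl₂ m) * ((incl₂ m)ᴴ * W) =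
        Wᴴ * (((incl₁ m) * (incl₁ m)ᴴ + (incl₂ m) * (incl₂ m)ᴴ) * W) := by
      simp only [Matrix.mul_add, Matrix.add_mul, Matrix.mul_assoc]
    rw [this, incl_add, Matrix.one_mul, hW1]
  · have := hc (incl₁ m) (incl₁ m)
    rw [sphS, incl₁_compress, Matrix.mul_one, incl₁_isometry] at this
    rw [this]
    exact (norm_compress_isometry_le incl₁_isometry incl₁_isometry _).trans hW2
  · have := hc (incl₂ m) (incl₂ m)
    rw [sphS, incl₂_compress, Matrix.mul_one, incl₂_isometry, ← sub_eq_add_neg] at this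
    rw [this]
    exact (norm_compress_isometry_le incl₂_isometry incl₂_isometry _).trans hW2
  · have := hc (incl₂ m) (incl₁ m)
    rw [← fromBlocks_one, incl₂₁_compress, zero_add, fromBlocks_one] at this
    conv_lhs at this => rw [sphS, incl₂₁_compress]
    rw [this]
    exact (norm_compress_isometry_le incl₂_isometry incl₁_isometry _).trans hW2

lemma exists_polar_blocks {H₁ H₂ H₃ C₀ D₀ : Matrix m m ℂ} {δ : ℝ} (hδ : 0 < δ)
    (h : star C₀ * C₀ + star D₀ * D₀ = 1)
    (hCC : ‖C₀ * star C₀ - (1 / 2 : ℝ) • (1 + H₃)‖ ≤ 4 * δ)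
    (hDD : ‖D₀ * star D₀ - (1 / 2 : ℝ) • (1 - H₃)‖ ≤ 4 * δ)
    (hDC : ‖D₀ * star C₀ - (1 / 2 : ℝ) • (H₁ + Complex.I • H₂)‖ ≤ 4 * δ) :
    ∃ C D : Matrix m m ℂ, 0 ≤ C ∧ ‖C‖ ≤ 2 ∧ ‖D‖ ≤ 1 ∧
      ‖C * C - (1 / 2 : ℝ) • (1 + H₃)‖ ≤ 11 * δ ∧
      ‖star D * D - (1 / 2 : ℝ) • (1 - H₃)‖ ≤ 14 * δ ∧
      ‖D * star D - (1 / 2 : ℝ) • (1 - H₃)‖ ≤ 8 * δ ∧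
      ‖D * C - (1 / 2 : ℝ) • (H₁ + Complex.I • H₂)‖ ≤ 9 * δ := by
  have h1 : ‖(1 : Matrix m m ℂ)‖ ≤ 1 := Gluing.norm_one_le
  have hC0 : ‖C₀‖ ≤ 1 := by
    have : star C₀ * C₀ ≤ 1 := by
      rw [← h]; exact le_add_of_nonneg_right (star_mul_self_nonneg D₀)
    nlinarith [norm_sq_le_of_star_mul_self_le this, norm_nonneg C₀]
  have hD0 : ‖D₀‖ ≤ 1 := by
    have : star D₀ * D₀ ≤ 1 := by
      rw [← h]; exact le_add_of_nonneg_left (star_mul_self_nonneg C₀)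
    nlinarith [norm_sq_le_of_star_mul_self_le this, norm_nonneg D₀]
  obtain ⟨s, hs0, hs, hT⟩ := exists_isUnit_add_smul_one C₀ (lt_min hδ one_pos)
  rw [lt_min_iff] at hs
  set T := C₀ + s • (1 : Matrix m m ℂ) with hTdef
  have hsT : star T = star C₀ + s • (1 : Matrix m m ℂ) := by
    rw [hTdef, star_add, star_smul, star_one, star_trivial s]
  have hs1 : ‖s • (1 : Matrix m m ℂ)‖ ≤ s := by
    rw [norm_smul, Real.norm_eq_abs, abs_of_pos hs0]
    exact mul_le_of_le_one_right hs0.le h1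
  have hTn : ‖T‖ ≤ 2 := (norm_add_le_of_le hC0 hs1).trans (by linarith)
  have herr : ‖s • (C₀ + star C₀) + s • (s • (1 : Matrix m m ℂ))‖ ≤ 3 * δ := by
    rw [← smul_add, norm_smul, Real.norm_eq_abs, abs_of_pos hs0]
    have := norm_add_le_of_le (norm_add_le_of_le hC0 ((norm_star C₀).le.trans hC0)) hs1
    nlinarith
  obtain ⟨U, H, hU1, hU2, hH0, hHH, hTU, -, -⟩ := exists_polar hT
  have hH : star H = H := (IsSelfAdjoint.of_nonneg hH0).star_eq
  have hUn := norm_le_one_of_star_mul_self hU1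
  have hsU : star T = H * star U := by rw [hTU, star_mul, hH]
  have hCsq : U * H * star U * (U * H * star U) = T * star T := by
    calc _ = U * H * (star U * U) * H * star U := by simp only [mul_assoc]
      _ = _ := by rw [hU1, mul_one, hsU, hTU]; simp only [mul_assoc]
  have hCsq' : U * (star T * T) * star U = T * star T := by
    rw [← hCsq, ← hHH]
    calc _ = U * H * 1 * H * star U := by rw [mul_one]; simp only [mul_assoc]
      _ = _ := by rw [← hU1]; simp only [mul_assoc]
  have hHn : ‖H‖ ≤ 2 := by
    have : H = star U * T := by rw [hTU, ← mul_assoc, hU1, one_mul]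
    rw [this]
    exact (norm_mul_le_of_le ((norm_star U).le.trans hUn) hTn).trans_eq (by norm_num)
  clear_value T
  have hCC' : ‖T * star T - (1 / 2 : ℝ) • (1 + H₃)‖ ≤ 7 * δ := by
    have e : T * star T - (1 / 2 : ℝ) • (1 + H₃) = (C₀ * star C₀ - (1 / 2 : ℝ) • (1 + H₃)) +
        (s • (C₀ + star C₀) + s • (s • (1 : Matrix m m ℂ))) := by
      rw [hsT, hTdef, add_mul, mul_add, mul_add, mul_smul_comm, smul_mul_assoc, mul_one, one_mul,
        smul_mul_assoc, one_mul]
      module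
    rw [e]
    exact (norm_add_le_of_le hCC herr).trans_eq (by ring)
  refine ⟨U * H * star U, D₀ * star U, star_right_conjugate_nonneg hH0 U,
    (norm_conj_unitary_le hU1 H).trans hHn, ?_, ?_, ?_, ?_, ?_⟩
  · exact (norm_mul_le_of_le hD0 ((norm_star U).le.trans hUn)).trans_eq (one_mul 1)
  · rw [hCsq]
    linarith
  · have e : star (D₀ * star U) * (D₀ * star U) - (1 / 2 : ℝ) • (1 - H₃) =
        U * (s • (C₀ + star C₀) + s • (s • (1 : Matrix m m ℂ))) * star U -
          (T * star T - (1 / 2 : ℝ) • (1 + H₃)) := by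
      have e1 : star D₀ * D₀ = 1 - star C₀ * C₀ := eq_sub_of_add_eq' h
      have e2 : star (D₀ * star U) * (D₀ * star U) = U * (star D₀ * D₀) * star U := by
        rw [star_mul, star_star]; simp only [mul_assoc]
      have e3 : s • (C₀ + star C₀) + s • (s • (1 : Matrix m m ℂ)) = star T * T - star C₀ * C₀ := by
        rw [hsT, hTdef, add_mul, mul_add, mul_add, mul_smul_comm, smul_mul_assoc, mul_one, one_mul,
          smul_mul_assoc, one_mul]
        module
      rw [e2, e1, e3, mul_sub, sub_mul, mul_one, hU2, mul_sub, sub_mul, hCsq']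
      module
    rw [e]
    exact (norm_sub_le_of_le ((norm_conj_unitary_le hU1 _).trans herr) hCC').trans (by linarith)
  · have e : D₀ * star U * star (D₀ * star U) = D₀ * star D₀ := by
      rw [star_mul, star_star, mul_assoc, ← mul_assoc (star U), hU1, one_mul]
    rw [e]
    linarith
  · have e : D₀ * star U * (U * H * star U) = D₀ * star C₀ + D₀ * (s • (1 : Matrix m m ℂ)) := by
      calc _ = D₀ * (star U * U) * (H * star U) := by simp only [mul_assoc]
        _ = _ := by rw [hU1, mul_one, ← hsU, hsT, mul_add]
    rw [e, add_sub_right_comm]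
    exact (norm_add_le_of_le hDC (norm_mul_le_of_le hD0 hs1)).trans (by linarith)

end Blocks

section Final
open scoped Matrix.Norms.L2Operator MatrixOrder

variable {m : Type} [Fintype m] [DecidableEq m]

lemma norm_le_two_of_sum_sq {H₁ H₂ H₃ : Matrix m m ℂ} {δ : ℝ} (h1 : star H₁ = H₁)
    (h2 : star H₂ = H₂) (h3 : star H₃ = H₃) (hδ : δ ≤ 1)
    (hs : ‖H₁ ^ 2 + H₂ ^ 2 + H₃ ^ 2 - 1‖ ≤ δ) : ‖H₁‖ ≤ 2 ∧ ‖H₂‖ ≤ 2 ∧ ‖H₃‖ ≤ 2 := by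
  have hone : ‖(1 : Matrix m m ℂ)‖ ≤ 1 := Gluing.norm_one_le
  have hR : ‖H₁ ^ 2 + H₂ ^ 2 + H₃ ^ 2‖ ≤ 2 := by
    have := norm_add_le_of_le hs hone
    rw [sub_add_cancel] at this
    linarith
  have p1 : 0 ≤ H₁ ^ 2 := by
    have := star_mul_self_nonneg H₁; rwa [h1, ← sq] at this
  have p2 : 0 ≤ H₂ ^ 2 := by
    have := star_mul_self_nonneg H₂; rwa [h2, ← sq] at this
  have p3 : 0 ≤ H₃ ^ 2 := by
    have := star_mul_self_nonneg H₃; rwa [h3, ← sq] at this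
  have key : ∀ {H : Matrix m m ℂ}, star H = H → H ^ 2 ≤ H₁ ^ 2 + H₂ ^ 2 + H₃ ^ 2 → ‖H‖ ≤ 2 := by
    intro H hH hle
    rw [sq] at hle
    nth_rewrite 1 [← hH] at hle
    have := (norm_sq_le_of_star_mul_self_le hle).trans hR
    nlinarith [norm_nonneg H]
  refine ⟨key h1 ?_, key h2 ?_, key h3 ?_⟩
  · rw [add_assoc]; exact le_add_of_nonneg_right (add_nonneg p2 p3)
  · rw [add_right_comm]; exact le_add_of_nonneg_left (add_nonneg p1 p3)
  · exact le_add_of_nonneg_left (add_nonneg p1 p2)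

/-- The quantitative result for the sphere with an explicit exponent. -/
lemma exists_sphere : ∃ c : ℝ, 1 ≤ c ∧
    ∀ {m : Type} [Fintype m] [DecidableEq m] {H₁ H₂ H₃ : Matrix m m ℂ} {δ τ : ℝ},
      star H₁ = H₁ → star H₂ = H₂ → star H₃ = H₃ → 0 < δ → δ ≤ 1 → 0 < τ → 11 * δ ≤ τ ^ 8 →
      ‖H₁ * H₂ - H₂ * H₁‖ ≤ δ → ‖H₁ * H₃ - H₃ * H₁‖ ≤ δ → ‖H₂ * H₃ - H₃ * H₂‖ ≤ δ →
      ‖H₁ ^ 2 + H₂ ^ 2 + H₃ ^ 2 - 1‖ ≤ δ → bott H₁ H₂ H₃ = 0 →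
      ∃ K₁ K₂ K₃ : Matrix m m ℂ, star K₁ = K₁ ∧ star K₂ = K₂ ∧ star K₃ = K₃ ∧
        K₁ * K₂ = K₂ * K₁ ∧ K₁ * K₃ = K₃ * K₁ ∧ K₂ * K₃ = K₃ * K₂ ∧
        K₁ ^ 2 + K₂ ^ 2 + K₃ ^ 2 = 1 ∧
        ‖K₁ - H₁‖ ≤ c * τ ∧ ‖K₂ - H₂‖ ≤ c * τ ∧ ‖K₃ - H₃‖ ≤ c * τ := by
  obtain ⟨c, hc, h⟩ := exists_sphere_of_blocks
  refine ⟨3 * c, by linarith, fun {m} _ _ H₁ H₂ H₃ δ τ s1 s2 s3 hδ hδ1 hτ hδτ h12 h13 h23 hs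
    hb => ?_⟩
  rcases le_or_gt τ 1 with hτ1 | hτ1
  · obtain ⟨C₀, D₀, h0, hCC₀, hDD₀, hDC₀⟩ := exists_blocks s1 s2 s3 h12 h13 h23 hs hb
    obtain ⟨C, D, hC0, hCn, hDn, hCC, hDD, hDD', hDC⟩ := exists_polar_blocks hδ h0 hCC₀ hDD₀ hDC₀
    obtain ⟨K₁, K₂, K₃, k1, k2, k3, k4, k5, k6, k7, k8, k9, k10⟩ :=
      h s1 s2 s3 hC0 hCn hDn hτ hτ1 hδ.le hδτ hCC hDD hDD' hDC
    have : c * τ ≤ 3 * c * τ := by nlinarith [mul_pos (zero_lt_one.trans_le hc) hτ]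
    exact ⟨K₁, K₂, K₃, k1, k2, k3, k4, k5, k6, k7, k8.trans this, k9.trans this, k10.trans this⟩
  · obtain ⟨n1, n2, n3⟩ := norm_le_two_of_sum_sq s1 s2 s3 hδ1 hs
    have hone : ‖(1 : Matrix m m ℂ)‖ ≤ 1 := Gluing.norm_one_le
    have : 3 ≤ 3 * c * τ := by nlinarith
    refine ⟨0, 0, 1, by simp, by simp, by simp, by simp, by simp, by simp, by simp, ?_, ?_, ?_⟩
    · rw [zero_sub, norm_neg]; linarith
    · rw [zero_sub, norm_neg]; linarith
    · linarith [norm_sub_le_of_le hone n3]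

end Final

end AC

/-- Theorem (quantitative result for the sphere, Theorem `thm:sphereQuantitative`):
there is a dimension-independent function `ε` with `ε(δ) = E(1/δ)·δ^{1/12}`
(so `ε(δ)/δ^{1/12−α} → 0` as `δ → 0⁺` for every `α ∈ (0, 1/12)`) such that any
δ-representation of the sphere with vanishing Bott index is within `ε(δ)` of an exact
commuting representation of the sphere. -/
theorem sphere_quantitative :
    ∃ ε : ℝ → ℝ,
      (∀ δ > (0 : ℝ), 0 < ε δ) ∧
      (∀ α ∈ Set.Ioo (0 : ℝ) (1/12),
        Filter.Tendsto (fun δ : ℝ => ε δ / δ ^ ((1:ℝ)/12 - α))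
          (nhdsWithin 0 (Set.Ioi 0)) (nhds 0)) ∧
      (∀ (n : ℕ), 1 ≤ n → ∀ δ ∈ Set.Ioo (0 : ℝ) (1/4),
        ∀ H₁ H₂ H₃ : Matrix (Fin n) (Fin n) ℂ,
          AC.IsSphereRep δ H₁ H₂ H₃ →
          AC.bott H₁ H₂ H₃ = 0 →
          ∃ K₁ K₂ K₃ : Matrix (Fin n) (Fin n) ℂ,
            K₁.IsHermitian ∧ K₂.IsHermitian ∧ K₃.IsHermitian ∧
            K₁ * K₂ = K₂ * K₁ ∧ K₁ * K₃ = K₃ * K₁ ∧ K₂ * K₃ = K₃ * K₂ ∧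
            K₁ ^ 2 + K₂ ^ 2 + K₃ ^ 2 = 1 ∧
            AC.opNorm (K₁ - H₁) ≤ ε δ ∧ AC.opNorm (K₂ - H₂) ≤ ε δ ∧
            AC.opNorm (K₃ - H₃) ≤ ε δ) := by
  obtain ⟨c, hc, h⟩ := AC.exists_sphere
  refine ⟨fun δ => c * (11 * δ) ^ (1 / 8 : ℝ), fun δ hδ => by positivity, fun α hα => ?_, ?_⟩
  · have hp : (0 : ℝ) < 1 / 8 - (1 / 12 - α) := by linarith [hα.1]
    have h1 : Filter.Tendsto (fun δ : ℝ => c * 11 ^ (1 / 8 : ℝ) * δ ^ (1 / 8 - (1 / 12 - α)))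
        (nhdsWithin 0 (Set.Ioi 0)) (nhds 0) := by
      have h2 := ((Real.continuousAt_rpow_const 0 (1 / 8 - (1 / 12 - α)) (Or.inr hp.le)).tendsto
        |>.mono_left (nhdsWithin_le_nhds (s := Set.Ioi 0))).const_mul (c * 11 ^ (1 / 8 : ℝ))
      rwa [Real.zero_rpow hp.ne', mul_zero] at h2
    refine h1.congr' ?_
    filter_upwards [self_mem_nhdsWithin] with δ hδ
    have hδ : 0 < δ := hδ
    rw [Real.rpow_sub hδ, Real.mul_rpow (by norm_num) hδ.le]
    ring
  · intro n _ δ hδ H₁ H₂ H₃ ⟨s1, s2, s3, h12, h13, h23, hs⟩ hb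
    have hδ0 : 0 < 11 * δ := by linarith [hδ.1]
    have hτ : ((11 * δ) ^ (1 / 8 : ℝ)) ^ 8 = 11 * δ := by
      rw [← Real.rpow_natCast, ← Real.rpow_mul hδ0.le]
      norm_num
    exact h s1 s2 s3 hδ.1 (by linarith [hδ.2]) (Real.rpow_pos_of_pos hδ0 _) hτ.ge h12 h13 h23 hs hb
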